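/- For every real c > 2 there is a constant K > 0 such that for all real x ≥ 3: | Σ_{p ≤ x, p prime} (p−1)/φ(p−1) − A · ∫_2^x dt/log t | ≤ K · x/(log x)^{c−1}, where A = ∏_{p prime} (1 + 1/(p−1)^2) is a convergent infinite product over all primes. -/

import Mathlib

namespace SiegelWalfisz
open Complex Metric Set

/-- Cauchy bound for the first derivative on a smaller ball. -/
lemma norm_deriv_le_of_ball {f : ℂ → ℂ} {s : ℂ} {R M : ℝ} (hR : 0 < R)
    (hf : DifferentiableOn ℂ f (ball s R)) (hM : ∀ z ∈ ball s R, ‖f z‖ ≤ M) {z : ℂ}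
    (hz : z ∈ ball s (R / 2)) : ‖deriv f z‖ ≤ 4 * M / R := by
  have hsub : closedBall z (R / 4) ⊆ ball s R := by
    intro w hw
    have h1 := mem_closedBall.1 hw
    have h2 := mem_ball.1 hz
    have := dist_triangle w z s
    exact mem_ball.2 (by linarith)
  have h := norm_deriv_le_of_forall_mem_sphere_norm_le (c := z) (R := R / 4) (f := f) (C := M)
    (by positivity) ?_ ?_
  · calc _ ≤ _ := h
      _ = _ := by field_simp
  · apply DifferentiableOn.diffContOnCl
    rw [closure_ball _ (by positivity)]
    exact hf.mono hsub
  · exact fun w hw => hM w (hsub (sphere_subset_closedBall hw))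

/-- A holomorphic function which is bounded above on a ball and bounded below at its centre has
controlled derivatives of its logarithmic derivative. -/
lemma norm_iteratedDeriv_logDeriv_le {f : ℂ → ℂ} {s : ℂ} {R M m : ℝ} (hR : 0 < R)
    (hf : DifferentiableOn ℂ f (ball s R)) (hM : ∀ z ∈ ball s R, ‖f z‖ ≤ M)
    (hm : 0 < m) (hfs : m ≤ ‖f s‖) (k : ℕ) :
    ‖iteratedDeriv k (fun z => deriv f z / f z) s‖ ≤ k.factorial * (16 * M / (m * R)) ^ (k +
        1) := by
  have hmM : m ≤ M := hfs.trans (hM s (mem_ball_self hR))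
  have hMpos : 0 < M := hm.trans_le hmM
  have hmR : m / M ≤ 1 := (div_le_one hMpos).2 hmM
  set r : ℝ := m * R / (8 * M) with hr
  have hrpos : 0 < r := by positivity
  have hr' : r ≤ R / 8 := by
    rw [hr, div_le_div_iff₀ (by positivity) (by positivity)]
    nlinarith [mul_le_mul_of_nonneg_right hmM hR.le]
  have hsub : closedBall s r ⊆ ball s (R / 2) := closedBall_subset_ball (by linarith)
  have hsub' : ball s (R / 2) ⊆ ball s R := ball_subset_ball (by linarith)
  have hder : ∀ z ∈ ball s (R / 2), ‖deriv f z‖ ≤ 4 * M / R := fun z hz =>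
    norm_deriv_le_of_ball hR hf hM hz
  have hdiff : ∀ z ∈ ball s R, DifferentiableAt ℂ f z := fun z hz =>
    hf.differentiableAt (isOpen_ball.mem_nhds hz)
  have hlow : ∀ z ∈ closedBall s r, m / 2 ≤ ‖f z‖ := by
    intro z hz
    have h1 : ‖f z - f s‖ ≤ 4 * M / R * ‖z - s‖ :=
      (convex_ball s (R / 2)).norm_image_sub_le_of_norm_deriv_le
        (fun w hw => hdiff w (hsub' hw)) hder (mem_ball_self (by positivity)) (hsub hz)
    have h2 : ‖z - s‖ ≤ r := by rwa [← dist_eq_norm]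
    have h3 : 4 * M / R * ‖z - s‖ ≤ m / 2 := by
      calc _ ≤ 4 * M / R * r := by gcongr
        _ = m / 2 := by rw [hr]; field_simp; norm_num
    have h4 : ‖f s‖ - ‖f z‖ ≤ ‖f z - f s‖ := by
      rw [norm_sub_rev]; exact norm_sub_norm_le _ _
    linarith
  have h := norm_iteratedDeriv_le_of_forall_mem_sphere_norm_le (c := s) (R := r)
    (f := fun z => deriv f z / f z) (C := 8 * M / (m * R)) k hrpos ?_ ?_
  · calc _ ≤ _ := h
      _ = k.factorial * (8 * M / (m * R)) ^ (k + 1) := by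
        have hr2 : r = (8 * M / (m * R))⁻¹ := by rw [hr, inv_div]
        rw [hr2, inv_pow, div_inv_eq_mul]; ring
      _ ≤ _ := by gcongr; norm_num
  · apply DifferentiableOn.diffContOnCl
    rw [closure_ball _ hrpos.ne']
    apply DifferentiableOn.div
    · exact ((hf.deriv isOpen_ball).mono hsub').mono hsub
    · exact (hf.mono hsub').mono hsub
    · intro z hz h0
      have := hlow z hz
      rw [h0, norm_zero] at this
      linarith
  · intro z hz
    have hz' := sphere_subset_closedBall hz
    rw [norm_div]
    calc _ ≤ (4 * M / R) / (m / 2) := by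
          gcongr
          · exact hder z (hsub hz')
          · exact hlow z hz'
      _ = _ := by field_simp; norm_num
end SiegelWalfisz

namespace SiegelWalfisz
open Complex MeasureTheory Set Filter Topology

/-- The Dirichlet integral of a bounded function supported on `[N, ∞)`. -/
noncomputable def dirichletTail (h : ℝ → ℂ) (s : ℂ) : ℂ :=
  ∫ t in Ioi (1 : ℝ), h t * (t : ℂ) ^ (-(s + 1))

lemma norm_dirichletTail_le {h : ℝ → ℂ} {H : ℝ} {N : ℕ} (hN : 1 ≤ N) (hH : ∀ t, ‖h t‖ ≤ H)
    (h0 : ∀ t < (N : ℝ), h t = 0) {s : ℂ} (hs : 0 < s.re) :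
    ‖dirichletTail h s‖ ≤ H * (N : ℝ) ^ (-s.re) / s.re := by
  have hN' : (1 : ℝ) ≤ N := by exact_mod_cast hN
  have hN0 : (0 : ℝ) < N := by linarith
  have hlt : -(s.re + 1) < -1 := by linarith
  have hEq : dirichletTail h s = ∫ t in Ici (N : ℝ), h t * (t : ℂ) ^ (-(s + 1)) := by
    rw [dirichletTail, ← integral_Ici_eq_integral_Ioi]
    apply setIntegral_eq_of_subset_of_forall_sdiff_eq_zero measurableSet_Ici
    · exact Ici_subset_Ici.2 hN'
    · intro t ht
      have : t < N := by simpa using ht.2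
      simp [h0 t this]
  rw [hEq]
  have hint : IntegrableOn (fun t : ℝ => H * t ^ (-(s.re + 1))) (Ici (N : ℝ)) :=
    (integrableOn_Ici_iff_integrableOn_Ioi).2 ((integrableOn_Ioi_rpow_of_lt hlt hN0).const_mul _)
  refine (norm_integral_le_of_norm_le hint ?_).trans ?_
  · refine (ae_restrict_iff' measurableSet_Ici).2 (ae_of_all _ fun t ht => ?_)
    have htpos : 0 < t := hN0.trans_le ht
    rw [norm_mul, norm_cpow_eq_rpow_re_of_pos htpos]
    have : (-(s + 1)).re = -(s.re + 1) := by simp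
    rw [this]
    gcongr
    exact hH t
  · rw [integral_const_mul, integral_Ici_eq_integral_Ioi, integral_Ioi_rpow_of_lt hlt hN0]
    apply le_of_eq
    have : -(s.re + 1) + 1 = -s.re := by ring
    rw [this, neg_div_neg_eq]
    ring

lemma differentiableAt_dirichletTail {h : ℝ → ℂ} {H : ℝ} (hm : Measurable h)
    (hH : ∀ t, ‖h t‖ ≤ H) {s : ℂ} (hs : 0 < s.re) :
    DifferentiableAt ℂ (dirichletTail h) s := by
  set f : ℝ → ℂ := (Ioi (1 : ℝ)).indicator h with hf
  have hfm : Measurable f := hm.indicator measurableSet_Ioi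
  have hfH : ∀ t, ‖f t‖ ≤ H := fun t => (norm_indicator_le_norm_self _ _).trans (hH t)
  have hEq : dirichletTail h = fun s => mellin f (-s) := by
    funext s
    rw [dirichletTail, mellin, ← integral_indicator measurableSet_Ioi,
      ← integral_indicator measurableSet_Ioi]
    congr 1
    funext t
    by_cases ht : 1 < t
    · have ht0 : 0 < t := by linarith
      rw [indicator_of_mem (by exact ht), indicator_of_mem (by exact ht0), hf,
        indicator_of_mem (by exact ht), smul_eq_mul, mul_comm, neg_add']
    · rw [indicator_of_notMem (by exact ht)]
      by_cases ht0 : 0 < t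
      · rw [indicator_of_mem (by exact ht0), hf, indicator_of_notMem (by exact ht), smul_zero]
      · rw [indicator_of_notMem (by exact ht0)]
  rw [hEq]
  have key : DifferentiableAt ℂ (mellin f) (-s) := by
    refine mellin_differentiableAt_of_isBigO_rpow (a := 0) (b := (-s).re - 1) ?_ ?_ (by simpa)
      ?_ (by linarith)
    · refine LocallyIntegrable.locallyIntegrableOn ?_ _
      exact (locallyIntegrable_const H).mono hfm.aestronglyMeasurable
        (ae_of_all _ fun t => (hfH t).trans (le_abs_self H))
    · simp only [neg_zero, Real.rpow_zero]
      exact Asymptotics.IsBigO.of_bound H (Eventually.of_forall fun t => by simpa using hfH t)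
    · refine Asymptotics.IsBigO.of_bound 0 ?_
      have : Iio (1 : ℝ) ∈ 𝓝[>] (0 : ℝ) := mem_nhdsWithin_of_mem_nhds (Iio_mem_nhds one_pos)
      filter_upwards [this] with t ht
      rw [hf, indicator_of_notMem (by simpa using le_of_lt ht)]
      simp
  exact key.comp s differentiableAt_id.neg

section Periodic
variable {q : ℕ} [NeZero q]

lemma sum_Ico_add_eq_zero {Φ : ZMod q → ℂ} (hΦ : ∑ j, Φ j = 0) (a : ℕ) :
    ∑ k ∈ Finset.Ico a (a + q), Φ k = 0 := by
  have h1 : ∑ k ∈ Finset.Ico a (a + q), Φ k = ∑ k ∈ Finset.range q, Φ k := by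
    rw [← Nat.image_Ico_mod a q, Finset.sum_image]
    · simp
    · intro x hx y hy hxy
      simp only [Finset.coe_Ico, mem_Ico] at hx hy
      have hxy' : x ≡ y [MOD q] := hxy
      rcases le_total x y with h | h
      · exact hxy'.eq_of_abs_lt (by rw [abs_lt]; constructor <;> omega)
      · exact hxy'.eq_of_abs_lt (by rw [abs_lt]; constructor <;> omega)
  rw [h1, ← hΦ]
  refine Finset.sum_bij' (fun k _ => (k : ZMod q)) (fun j _ => j.val) ?_ ?_ ?_ ?_ ?_
  · simp
  · intro j _; simpa using ZMod.val_lt j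
  · intro k hk; exact ZMod.val_cast_of_lt (by simpa using hk)
  · intro j _; simp
  · simp

lemma norm_sum_Ico_le {Φ : ZMod q → ℂ} (hΦ : ∑ j, Φ j = 0) (hΦ1 : ∀ j, ‖Φ j‖ ≤ 1) (m a : ℕ) :
    ‖∑ k ∈ Finset.Ico a (a + m), Φ k‖ ≤ q := by
  induction m using Nat.strong_induction_on generalizing a with
  | _ m ih =>
    rcases le_or_gt q m with h | h
    · have hq : 0 < q := Nat.pos_of_ne_zero (NeZero.ne q)
      rw [← Finset.sum_Ico_consecutive _ (Nat.le_add_right a q) (by omega),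
        sum_Ico_add_eq_zero hΦ, zero_add]
      have := ih (m - q) (by omega) (a + q)
      rwa [show a + q + (m - q) = a + m by omega] at this
    · refine (norm_sum_le _ _).trans ((Finset.sum_le_sum fun k _ => hΦ1 _).trans ?_)
      simp only [Finset.sum_const, Nat.card_Ico, nsmul_eq_mul, mul_one]
      exact_mod_cast (by omega : a + m - a ≤ q)

end Periodic

/-- The coefficients `a n` for `n > N`, and zero otherwise. -/
noncomputable def tailCoeff (a : ℕ → ℂ) (N n : ℕ) : ℂ := if n ≤ N then 0 else a n

/-- Summatory function of `tailCoeff`. -/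
noncomputable def tailSum (a : ℕ → ℂ) (N : ℕ) (t : ℝ) : ℂ :=
  ∑ k ∈ Finset.Icc 1 ⌊t⌋₊, tailCoeff a N k

lemma tailSum_eq (a : ℕ → ℂ) (N : ℕ) (t : ℝ) :
    tailSum a N t = ∑ k ∈ Finset.Ico (N + 1) (⌊t⌋₊ + 1), a k := by
  rw [tailSum]
  simp only [tailCoeff]
  rw [Finset.sum_ite, Finset.sum_const_zero, zero_add]
  apply Finset.sum_congr _ fun _ _ => rfl
  ext k
  simp only [Finset.mem_filter, Finset.mem_Icc, Finset.mem_Ico]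
  omega

lemma measurable_tailSum (a : ℕ → ℂ) (N : ℕ) : Measurable (tailSum a N) :=
  (measurable_from_top (f := fun n : ℕ => ∑ k ∈ Finset.Icc 1 n, tailCoeff a N k)).comp
    Nat.measurable_floor

lemma tailSum_eq_zero (a : ℕ → ℂ) (N : ℕ) {t : ℝ} (ht : t < N) : tailSum a N t = 0 := by
  rw [tailSum_eq]
  have : ⌊t⌋₊ ≤ N := by
    by_contra h
    have h1 : N + 1 ≤ ⌊t⌋₊ := by omega
    have := (Nat.le_floor_iff' (by omega)).1 h1
    push_cast at this
    linarith
  rw [Finset.Ico_eq_empty (by omega), Finset.sum_empty]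

lemma LSeries_eq_sum_add_tail {a : ℕ → ℂ} {s : ℂ} (h : LSeriesSummable a s) (N : ℕ) :
    LSeries a s = ∑ n ∈ Finset.Icc 1 N, a n * (n : ℂ) ^ (-s) + LSeries (tailCoeff a N) s := by
  have h2 : LSeriesSummable (tailCoeff a N) s := by
    refine (LSeriesSummable_congr' s ?_).1 h
    filter_upwards [eventually_gt_atTop N] with n hn
    simp [tailCoeff, not_le.2 hn]
  set g : ℕ → ℂ := fun n => if n ∈ Finset.Icc 1 N then a n * (n : ℂ) ^ (-s) else 0 with hg
  have hterm : LSeries.term a s = g + LSeries.term (tailCoeff a N) s := by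
    funext n
    rcases Nat.eq_zero_or_pos n with rfl | hn
    · simp [hg]
    · by_cases hnN : n ≤ N
      · simp [hg, LSeries.term, tailCoeff, hnN, hn.ne', Nat.one_le_iff_ne_zero, cpow_neg,
          div_eq_mul_inv]
      · simp [hg, LSeries.term, tailCoeff, hnN, hn.ne']
  have hgs : ∀ n ∉ Finset.Icc 1 N, g n = 0 := fun n hn => if_neg hn
  rw [LSeries, LSeries, hterm]
  simp only [Pi.add_apply]
  rw [(summable_of_ne_finset_zero hgs).tsum_add h2, tsum_eq_sum hgs]
  congr 1
  exact Finset.sum_congr rfl fun n hn => if_pos hn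

lemma LSeries_eq_sum_add_dirichletTail {a : ℕ → ℂ} {s : ℂ} (h : LSeriesSummable a s)
    (hs : 1 < s.re) (ha : ∀ n, ‖a n‖ ≤ 1) (N : ℕ) :
    LSeries a s = ∑ n ∈ Finset.Icc 1 N, a n * (n : ℂ) ^ (-s)
      + s * dirichletTail (tailSum a N) s := by
  rw [LSeries_eq_sum_add_tail h N]
  congr 1
  apply LSeries_eq_mul_integral' _ zero_le_one hs
  refine Asymptotics.IsBigO.of_bound 1 (Eventually.of_forall fun n => ?_)
  rw [Real.rpow_one, one_mul, Real.norm_natCast, Real.norm_of_nonneg (by positivity)]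
  refine (Finset.sum_le_sum (g := fun _ => (1 : ℝ)) fun k _ => ?_).trans (by simp)
  unfold tailCoeff
  split_ifs
  · simp
  · exact ha k

/-- Analytic continuation of the Dirichlet integral representation. -/
lemma eqOn_of_eqOn_one_lt_re {F G : ℂ → ℂ} {U : Set ℂ} (hU : IsOpen U) (hc : Convex ℝ U)
    (hF : DifferentiableOn ℂ F U) (hG : DifferentiableOn ℂ G U) {z : ℂ} (hz : z ∈ U)
    (hz1 : 1 < z.re) (h : ∀ s, 1 < s.re → F s = G s) : EqOn F G U := by
  refine (hF.analyticOnNhd hU).eqOn_of_preconnected_of_eventuallyEq (hG.analyticOnNhd hU)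
    hc.isPreconnected hz ?_
  filter_upwards [(isOpen_lt continuous_const continuous_re).mem_nhds hz1] with s hs using h s hs

lemma differentiable_sum_cpow (a : ℕ → ℂ) (N : ℕ) :
    Differentiable ℂ fun s : ℂ => ∑ n ∈ Finset.Icc 1 N, a n * (n : ℂ) ^ (-s) := by
  refine Differentiable.fun_sum fun n hn => ?_
  have : (n : ℂ) ≠ 0 := by
    have := (Finset.mem_Icc.1 hn).1
    exact_mod_cast (by omega : n ≠ 0)
  exact ((differentiable_id.neg).const_cpow (Or.inl this)).const_mul _

section Periodic
variable {q : ℕ} [NeZero q]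

lemma norm_tailSum_le {Φ : ZMod q → ℂ} (hΦ : ∑ j, Φ j = 0) (hΦ1 : ∀ j, ‖Φ j‖ ≤ 1) (N : ℕ) (t : ℝ) :
    ‖tailSum (fun n => Φ n) N t‖ ≤ q := by
  rw [tailSum_eq]
  rcases le_total (⌊t⌋₊ + 1) (N + 1) with h | h
  · rw [Finset.Ico_eq_empty (by omega)]; simp
  · have := norm_sum_Ico_le hΦ hΦ1 (⌊t⌋₊ - N) (N + 1)
    rwa [show N + 1 + (⌊t⌋₊ - N) = ⌊t⌋₊ + 1 by omega] at this

lemma LFunction_eq_sum_add_dirichletTail {Φ : ZMod q → ℂ} (hΦ : ∑ j, Φ j = 0)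
    (hΦ1 : ∀ j, ‖Φ j‖ ≤ 1) (N : ℕ) {s : ℂ} (hs : 0 < s.re) :
    ZMod.LFunction Φ s = ∑ n ∈ Finset.Icc 1 N, Φ n * (n : ℂ) ^ (-s)
      + s * dirichletTail (tailSum (fun n => Φ n) N) s := by
  refine eqOn_of_eqOn_one_lt_re (U := {s | 0 < s.re})
    (G := fun s => ∑ n ∈ Finset.Icc 1 N, Φ n * (n : ℂ) ^ (-s)
      + s * dirichletTail (tailSum (fun n => Φ n) N) s)
    (isOpen_lt continuous_const continuous_re) (convex_halfSpace_re_gt 0)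
    (ZMod.differentiable_LFunction_of_sum_zero hΦ).differentiableOn ?_ (z := 2) (by simp) (by simp)
    ?_ hs
  · refine (differentiable_sum_cpow _ N).differentiableOn.add ?_
    intro s hs
    exact (differentiableAt_id.mul (differentiableAt_dirichletTail (measurable_tailSum _ N)
      (norm_tailSum_le hΦ hΦ1 N) hs)).differentiableWithinAt
  · intro s hs
    rw [ZMod.LFunction_eq_LSeries Φ hs]
    exact LSeries_eq_sum_add_dirichletTail (ZMod.LSeriesSummable_of_one_lt_re Φ hs) hs
      (fun n => hΦ1 _) N

end Periodic

/-- The fractional part, cut off below `N`. -/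
noncomputable def fractTail (N : ℕ) (t : ℝ) : ℂ := (Ici (N : ℝ)).indicator
    (fun t => ((Int.fract t : ℝ) : ℂ)) t

lemma norm_fractTail_le (N : ℕ) (t : ℝ) : ‖fractTail N t‖ ≤ 1 := by
  refine (norm_indicator_le_norm_self _ _).trans ?_
  rw [norm_real, Real.norm_of_nonneg (Int.fract_nonneg t)]
  exact (Int.fract_lt_one t).le

lemma measurable_fractTail (N : ℕ) : Measurable (fractTail N) :=
  (measurable_ofReal.comp measurable_fract).indicator measurableSet_Ici

lemma fractTail_eq_zero {N : ℕ} {t : ℝ} (ht : t < N) : fractTail N t = 0 :=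
  indicator_of_notMem (by simpa using ht) _

lemma integrableOn_mul_cpow {h : ℝ → ℂ} {H : ℝ} (hm : Measurable h)
    (hH : ∀ t, ‖h t‖ ≤ H) {s : ℂ} (hs : 0 < s.re) :
    IntegrableOn (fun t : ℝ => h t * (t : ℂ) ^ (-(s + 1))) (Ioi 1) := by
  have h1 : IntegrableOn (fun t : ℝ => (t : ℂ) ^ (-(s + 1))) (Ioi 1) :=
    integrableOn_Ioi_cpow_of_lt (by simpa using hs) one_pos
  exact Integrable.bdd_mul h1 hm.aestronglyMeasurable (ae_of_all _ hH)

lemma dirichletTail_tailSum_one {N : ℕ} (hN : 1 ≤ N) {s : ℂ} (hs : 1 < s.re) :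
    s * dirichletTail (tailSum 1 N) s =
      (N : ℂ) ^ (1 - s) / (s - 1) - s * dirichletTail (fractTail N) s := by
  have hN0 : (0 : ℝ) < N := by exact_mod_cast hN
  have hNc : (N : ℂ) ≠ 0 := by exact_mod_cast (by omega : N ≠ 0)
  have hs0 : s ≠ 0 := fun h => by simp [h] at hs; linarith
  have hs1 : s - 1 ≠ 0 := fun h => by
    have : s = 1 := sub_eq_zero.1 h
    simp [this] at hs
  have hI1 : IntegrableOn (fun t : ℝ => (t : ℂ) ^ (-s)) (Ioi (N : ℝ)) :=
    integrableOn_Ioi_cpow_of_lt (by simpa using hs) hN0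
  have hI2 : IntegrableOn (fun t : ℝ => (N : ℂ) * (t : ℂ) ^ (-(s + 1))) (Ioi (N : ℝ)) :=
    (integrableOn_Ioi_cpow_of_lt (by simp; linarith) hN0).const_mul _
  have hmain : ∫ t in Ioi (N : ℝ), ((t : ℂ) ^ (-s) - (N : ℂ) * (t : ℂ) ^ (-(s + 1)))
      = (N : ℂ) ^ (1 - s) / (s - 1) - (N : ℂ) ^ (1 - s) / s := by
    rw [integral_sub hI1 hI2, integral_const_mul,
      integral_Ioi_cpow_of_lt (by simpa using hs) hN0,
      integral_Ioi_cpow_of_lt (by simp; linarith) hN0]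
    have e1 : -s + 1 = 1 - s := by ring
    have e2 : -(s + 1) + 1 = -s := by ring
    have e3 : (1 - s) = -(s - 1) := by ring
    have e4 : (N : ℂ) ^ (1 - s) = N * (N : ℂ) ^ (-s) := by
      rw [sub_eq_add_neg, cpow_add _ _ hNc, cpow_one]
    rw [e1, e2, ofReal_natCast, show (N : ℂ) * (-(N : ℂ) ^ (-s) / -s) = N * (N : ℂ) ^ (-s) / s by
      rw [neg_div_neg_eq, mul_div_assoc], ← e4]
    congr 1
    rw [e3, neg_div_neg_eq]
  have hEq : dirichletTail (tailSum 1 N) s + dirichletTail (fractTail N) s =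
      (N : ℂ) ^ (1 - s) / (s - 1) - (N : ℂ) ^ (1 - s) / s := by
    rw [← hmain]
    set g : ℝ → ℂ := (Ioi (N : ℝ)).indicator
      fun t : ℝ => (t : ℂ) ^ (-s) - (N : ℂ) * (t : ℂ) ^ (-(s + 1)) with hg
    have hgi : Integrable g := (integrable_indicator_iff measurableSet_Ioi).2 (hI1.sub hI2)
    have hN1 : Ioi (N : ℝ) ⊆ Ioi 1 := Ioi_subset_Ioi (by exact_mod_cast hN)
    have h1 : ∫ t in Ioi (N : ℝ), ((t : ℂ) ^ (-s) - (N : ℂ) * (t : ℂ) ^ (-(s + 1)))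
        = ∫ t in Ioi (1 : ℝ), g t := by
      rw [hg, setIntegral_indicator measurableSet_Ioi, inter_eq_self_of_subset_right hN1]
    rw [h1, ← eq_sub_iff_add_eq, dirichletTail, dirichletTail, ← integral_sub hgi.integrableOn
      (integrableOn_mul_cpow (measurable_fractTail N) (norm_fractTail_le N) (by linarith))]
    refine setIntegral_congr_fun measurableSet_Ioi fun t ht => ?_
    have ht0 : (0 : ℝ) < t := one_pos.trans ht
    have htc : (t : ℂ) ≠ 0 := by exact_mod_cast ht0.ne'
    rcases lt_trichotomy t N with h | h | h
    · have : t ∉ Ioi (N : ℝ) := by simpa using h.le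
      simp only [hg, tailSum_eq_zero _ _ h, fractTail_eq_zero h, indicator_of_notMem this]
      simp
    · have : t ∉ Ioi (N : ℝ) := by simpa using h.le
      simp only [hg, indicator_of_notMem this]
      rw [tailSum_eq, h]
      simp [fractTail]
    · have h2 : t ∈ Ioi (N : ℝ) := h
      have h3 : N ≤ ⌊t⌋₊ := Nat.le_floor h.le
      have h4 : tailSum 1 N t = (t : ℂ) - N - ((Int.fract t : ℝ) : ℂ) := by
        rw [tailSum_eq]
        simp only [Pi.one_apply, Finset.sum_const, Nat.card_Ico, nsmul_eq_mul, mul_one]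
        have h5 : ((⌊t⌋₊ : ℕ) : ℝ) = t - Int.fract t := by
          rw [natCast_floor_eq_intCast_floor ht0.le]
          exact (Int.self_sub_fract t).symm
        have h6 : ((⌊t⌋₊ + 1 - (N + 1) : ℕ) : ℝ) = t - N - Int.fract t := by
          rw [Nat.add_sub_add_right, Nat.cast_sub h3, h5]; ring
        exact_mod_cast congrArg ((↑) : ℝ → ℂ) h6
      have h7 : fractTail N t = ((Int.fract t : ℝ) : ℂ) := indicator_of_mem (by exact h.le) _
      simp only [hg, indicator_of_mem h2, h4, h7]
      have h8 : (t : ℂ) ^ (-s) = t * (t : ℂ) ^ (-(s + 1)) := by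
        have : -s = 1 + (-(s + 1)) := by ring
        conv_lhs => rw [this, cpow_add _ _ htc, cpow_one]
      rw [h8]; ring
  have : s * dirichletTail (tailSum 1 N) s =
      s * ((N : ℂ) ^ (1 - s) / (s - 1) - (N : ℂ) ^ (1 - s) / s)
      - s * dirichletTail (fractTail N) s := by rw [← hEq]; ring
  rw [this]
  congr 1
  field_simp
  ring

lemma riemannZeta_eq_sum_add {N : ℕ} (hN : 1 ≤ N) {s : ℂ} (hs : 0 < s.re) (him : s.im ≠ 0) :
    riemannZeta s = ∑ n ∈ Finset.Icc 1 N, (n : ℂ) ^ (-s) + (N : ℂ) ^ (1 - s) / (s - 1)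
      - s * dirichletTail (fractTail N) s := by
  have hNc : (N : ℂ) ≠ 0 := by exact_mod_cast (by omega : N ≠ 0)
  have key : ∀ U : Set ℂ, IsOpen U → Convex ℝ U → (∀ z ∈ U, 0 < z.re ∧ z.im ≠ 0) →
      ∀ z ∈ U, 1 < z.re → EqOn riemannZeta (fun s => ∑ n ∈ Finset.Icc 1 N, (n : ℂ) ^ (-s)
        + (N : ℂ) ^ (1 - s) / (s - 1) - s * dirichletTail (fractTail N) s) U := by
    intro U hU hc hU0 z hz hz1
    have hne : ∀ s ∈ U, s - 1 ≠ 0 := fun s hs h => (hU0 s hs).2 (by simp [sub_eq_zero.1 h])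
    refine eqOn_of_eqOn_one_lt_re hU hc ?_ ?_ hz hz1 ?_
    · exact fun s hs => (differentiableAt_riemannZeta
        (sub_ne_zero.1 (hne s hs))).differentiableWithinAt
    · intro s hs
      refine DifferentiableAt.differentiableWithinAt ?_
      refine DifferentiableAt.sub (DifferentiableAt.add ?_ ?_) ?_
      · simpa using (differentiable_sum_cpow 1 N) s
      · refine DifferentiableAt.div ?_ (by fun_prop) (hne s hs)
        exact ((differentiableAt_const _).sub differentiableAt_id).const_cpow (Or.inl hNc)
      · exact differentiableAt_id.mul (differentiableAt_dirichletTail (measurable_fractTail N)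
          (norm_fractTail_le N) (hU0 s hs).1)
    · intro s hs
      rw [← LSeries_one_eq_riemannZeta hs, LSeries_eq_sum_add_dirichletTail
        (LSeriesSummable_one_iff.2 hs) hs (fun n => by simp) N, dirichletTail_tailSum_one hN hs]
      simp only [Pi.one_apply, one_mul]
      ring
  rcases lt_or_gt_of_ne him with h | h
  · refine key ({s | 0 < s.re} ∩ {s | s.im < 0}) ?_ ?_ ?_ (2 - I) ?_ ?_ ⟨hs, h⟩
    · exact (isOpen_lt continuous_const continuous_re).inter
        (isOpen_lt continuous_im continuous_const)
    · exact (convex_halfSpace_re_gt 0).inter (convex_halfSpace_im_lt 0)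
    · exact fun z hz => ⟨hz.1, ne_of_lt hz.2⟩
    · simp
    · simp
  · refine key ({s | 0 < s.re} ∩ {s | 0 < s.im}) ?_ ?_ ?_ (2 + I) ?_ ?_ ⟨hs, h⟩
    · exact (isOpen_lt continuous_const continuous_re).inter
        (isOpen_lt continuous_const continuous_im)
    · exact (convex_halfSpace_re_gt 0).inter (convex_halfSpace_im_gt 0)
    · exact fun z hz => ⟨hz.1, ne_of_gt hz.2⟩
    · simp
    · simp

end SiegelWalfisz

namespace SiegelWalfisz
open Complex MeasureTheory Set Filter Topology

lemma norm_sum_cpow_le {Φ : ℕ → ℂ} (hΦ : ∀ n, ‖Φ n‖ ≤ 1) {δ : ℝ} (hδ : 0 < δ) {N : ℕ} (hN : 1 ≤ N)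
    {s : ℂ} (hs : 1 - δ ≤ s.re) :
    ‖∑ n ∈ Finset.Icc 1 N, Φ n * (n : ℂ) ^ (-s)‖ ≤ (1 + 1 / δ) * (N : ℝ) ^ (2 * δ) := by
  have hN1 : (1 : ℝ) ≤ N := by exact_mod_cast hN
  have h1 : ∀ n ∈ Finset.Icc 1 N, ‖Φ n * (n : ℂ) ^ (-s)‖ ≤ (N : ℝ) ^ δ * (n : ℝ)⁻¹ := by
    intro n hn
    obtain ⟨hn1, hnN⟩ := Finset.mem_Icc.1 hn
    have hn0 : (0 : ℝ) < n := by exact_mod_cast hn1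
    rw [norm_mul, norm_natCast_cpow_of_pos hn1]
    calc ‖Φ n‖ * (n : ℝ) ^ (-s).re ≤ 1 * (n : ℝ) ^ (δ - 1) := by
          gcongr
          · exact hΦ n
          · exact_mod_cast hn1
          · simp; linarith
      _ = (n : ℝ) ^ δ * (n : ℝ)⁻¹ := by
          rw [one_mul, Real.rpow_sub hn0, Real.rpow_one, div_eq_mul_inv]
      _ ≤ _ := by gcongr
  refine (norm_sum_le_of_le _ h1).trans ?_
  rw [← Finset.mul_sum]
  have h2 : ∑ n ∈ Finset.Icc 1 N, (n : ℝ)⁻¹ ≤ 1 + Real.log N := by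
    have := harmonic_le_one_add_log N
    rw [harmonic_eq_sum_Icc] at this
    push_cast at this
    exact this
  have h3 : Real.log N ≤ (N : ℝ) ^ δ / δ := Real.log_le_rpow_div (by positivity) hδ
  have h4 : 1 ≤ (N : ℝ) ^ δ := Real.one_le_rpow hN1 hδ.le
  calc (N : ℝ) ^ δ * ∑ n ∈ Finset.Icc 1 N, (n : ℝ)⁻¹ ≤ (N : ℝ) ^ δ *
      ((N : ℝ) ^ δ + (N : ℝ) ^ δ / δ) := by
        gcongr; linarith
    _ = (1 + 1 / δ) * ((N : ℝ) ^ δ * (N : ℝ) ^ δ) := by ring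
    _ = _ := by rw [← Real.rpow_add (by positivity), two_mul]

lemma ceil_rpow_le {τ δ : ℝ} (hτ : 1 ≤ τ) (hδ : 0 < δ) (hδ2 : δ ≤ 1 / 2) :
    (⌈τ⌉₊ : ℝ) ^ (2 * δ) ≤ 2 * τ ^ (2 * δ) := by
  have h1 : (⌈τ⌉₊ : ℝ) ≤ 2 * τ := by
    have := (Nat.ceil_lt_add_one (by linarith : 0 ≤ τ)).le
    linarith
  calc (⌈τ⌉₊ : ℝ) ^ (2 * δ) ≤ (2 * τ) ^ (2 * δ) := by gcongr
    _ = 2 ^ (2 * δ) * τ ^ (2 * δ) := Real.mul_rpow (by norm_num) (by linarith)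
    _ ≤ 2 ^ (1 : ℝ) * τ ^ (2 * δ) := by
        gcongr
        · norm_num
        · linarith
    _ = _ := by simp

lemma norm_mul_dirichletTail_le {h : ℝ → ℂ} {q : ℝ} (hq : 1 ≤ q) {δ : ℝ} (hδ : 0 < δ)
    (hδ2 : δ ≤ 1 / 2) {s : ℂ} (hs : 1 - δ ≤ s.re) (hs3 : s.re ≤ 3)
    (hH : ∀ t, ‖h t‖ ≤ q) (h0 : ∀ t < (⌈q * (|s.im| + 2)⌉₊ : ℝ), h t = 0) :
    ‖s * dirichletTail h s‖ ≤ 4 * (q * (|s.im| + 2)) ^ (2 * δ) := by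
  set τ := q * (|s.im| + 2) with hτ
  have hτ1 : 1 ≤ τ := by nlinarith [abs_nonneg s.im]
  have hτ0 : 0 < τ := by linarith
  have hN : 1 ≤ ⌈τ⌉₊ := Nat.one_le_ceil_iff.2 hτ0
  have hre : 1 / 2 ≤ s.re := by linarith
  have h1 := norm_dirichletTail_le hN hH h0 (s := s) (by linarith)
  have h2 : ‖s‖ * q ≤ 2 * τ := by
    have := norm_le_abs_re_add_abs_im s
    rw [abs_of_nonneg (by linarith : 0 ≤ s.re)] at this
    rw [hτ]
    nlinarith [abs_nonneg s.im]
  rw [norm_mul]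
  have h3 : ((⌈τ⌉₊ : ℕ) : ℝ) ^ (-s.re) ≤ τ ^ (δ - 1) :=
    (Real.rpow_le_rpow_of_nonpos hτ0 (Nat.le_ceil τ) (by linarith)).trans
      (Real.rpow_le_rpow_of_exponent_le hτ1 (by linarith))
  calc ‖s‖ * ‖dirichletTail h s‖ ≤ ‖s‖ * (q * ((⌈τ⌉₊ : ℕ) : ℝ) ^ (-s.re) / s.re) := by gcongr
    _ = (‖s‖ * q) * ((⌈τ⌉₊ : ℕ) : ℝ) ^ (-s.re) / s.re := by ring
    _ ≤ (2 * τ) * τ ^ (δ - 1) / (1 / 2) := by gcongr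
    _ = 4 * τ ^ δ := by rw [Real.rpow_sub hτ0, Real.rpow_one]; field_simp; norm_num
    _ ≤ _ := by
        gcongr
        linarith

/-- Convexity-type bound near the line `Re s = 1` for periodic functions of mean zero. -/
lemma norm_LFunction_le {q : ℕ} [NeZero q] {Φ : ZMod q → ℂ} (hΦ : ∑ j, Φ j = 0)
    (hΦ1 : ∀ j, ‖Φ j‖ ≤ 1) {δ : ℝ} (hδ : 0 < δ) (hδ2 : δ ≤ 1 / 2) {s : ℂ} (hs : 1 - δ ≤ s.re)
    (hs3 : s.re ≤ 3) :
    ‖ZMod.LFunction Φ s‖ ≤ (6 + 2 / δ) * ((q : ℝ) * (|s.im| + 2)) ^ (2 * δ) := by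
  have hq : (1 : ℝ) ≤ q := by exact_mod_cast NeZero.one_le
  set τ := (q : ℝ) * (|s.im| + 2) with hτ
  have hτ1 : 1 ≤ τ := by nlinarith [abs_nonneg s.im]
  have hτ0 : 0 < τ := by linarith
  have hN : 1 ≤ ⌈τ⌉₊ := Nat.one_le_ceil_iff.2 hτ0
  rw [LFunction_eq_sum_add_dirichletTail hΦ hΦ1 ⌈τ⌉₊ (by linarith : 0 < s.re)]
  have h1 := norm_sum_cpow_le (Φ := fun n => Φ n) (fun n => hΦ1 _) hδ hN hs
  have h2 := norm_mul_dirichletTail_le hq hδ hδ2 hs hs3 (norm_tailSum_le hΦ hΦ1 ⌈τ⌉₊)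
    (fun t ht => tailSum_eq_zero _ _ ht)
  have h3 := ceil_rpow_le hτ1 hδ hδ2
  refine (norm_add_le _ _).trans ?_
  have h4 : (1 + 1 / δ) * ((⌈τ⌉₊ : ℕ) : ℝ) ^ (2 * δ) ≤ (1 + 1 / δ) * (2 * τ ^ (2 * δ)) := by gcongr
  have h5 : (6 + 2 / δ) * τ ^ (2 * δ) = (1 + 1 / δ) * (2 * τ ^ (2 * δ)) + 4 * τ ^ (2 * δ) := by ring
  rw [h5]
  linarith

lemma norm_riemannZeta_le {δ : ℝ} (hδ : 0 < δ) (hδ2 : δ ≤ 1 / 2) {s : ℂ} (hs : 1 - δ ≤ s.re)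
    (hs3 : s.re ≤ 3) (him : s.im ≠ 0) :
    ‖riemannZeta s‖ ≤ (6 + 2 / δ) * (1 + 1 / |s.im|) * (|s.im| + 2) ^ (2 * δ) := by
  set τ := |s.im| + 2 with hτ
  have hτ1 : 1 ≤ τ := by nlinarith [abs_nonneg s.im]
  have hτ0 : 0 < τ := by linarith
  have hN : 1 ≤ ⌈τ⌉₊ := Nat.one_le_ceil_iff.2 hτ0
  have him' : 0 < |s.im| := abs_pos.2 him
  rw [riemannZeta_eq_sum_add hN (by linarith : 0 < s.re) him]
  have h1 := norm_sum_cpow_le (Φ := fun n => 1) (fun n => by simp) hδ hN hs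
  simp only [one_mul] at h1
  have h2 := norm_mul_dirichletTail_le le_rfl hδ hδ2 hs hs3 (norm_fractTail_le ⌈τ⌉₊)
    (fun t ht => fractTail_eq_zero (by rwa [one_mul] at ht))
  rw [one_mul] at h2
  have h3 := ceil_rpow_le hτ1 hδ hδ2
  have h4 : (1 + 1 / δ) * ((⌈τ⌉₊ : ℕ) : ℝ) ^ (2 * δ) ≤ (1 + 1 / δ) * (2 * τ ^ (2 * δ)) := by gcongr
  have h6 : ‖((⌈τ⌉₊ : ℕ) : ℂ) ^ (1 - s) / (s - 1)‖ ≤ (2 * τ ^ (2 * δ)) / |s.im| := by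
    rw [norm_div, norm_natCast_cpow_of_pos (by omega)]
    have h7 : |s.im| ≤ ‖s - 1‖ := by simpa using abs_im_le_norm (s - 1)
    gcongr
    refine le_trans ?_ h3
    apply Real.rpow_le_rpow_of_exponent_le
    · exact_mod_cast hN
    · simp; linarith
  refine (norm_sub_le _ _).trans ((add_le_add_left (norm_add_le _ _) _).trans ?_)
  have h8 : 0 ≤ (4 + 2 / δ) * (1 / |s.im|) * τ ^ (2 * δ) := by positivity
  have h5 : (6 + 2 / δ) * (1 + 1 / |s.im|) * τ ^ (2 * δ) = (1 + 1 / δ) * (2 * τ ^ (2 * δ)) +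
      4 * τ ^ (2 * δ)
    + (2 * τ ^ (2 * δ)) / |s.im| + (4 + 2 / δ) * (1 / |s.im|) * τ ^ (2 * δ) := by ring
  rw [h5]
  linarith

lemma norm_LFunctionTrivChar_le {q : ℕ} [NeZero q] {δ : ℝ} (hδ : 0 < δ) (hδ2 : δ ≤ 1 / 2) {s : ℂ}
    (hs : 1 < s.re) (hs3 : s.re ≤ 3) (him : s.im ≠ 0) :
    ‖DirichletCharacter.LFunctionTrivChar q s‖
      ≤ (12 + 4 / δ) * (1 + 1 / |s.im|) * ((q : ℝ) * (|s.im| + 2)) ^ (2 * δ) := by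
  classical
  have hq : (1 : ℝ) ≤ q := by exact_mod_cast NeZero.one_le
  have him' : 0 < |s.im| := abs_pos.2 him
  set c : ℝ := (Nat.totient q : ℝ) / q with hc
  have hc0 : 0 ≤ c := by positivity
  have hc1 : c ≤ 1 := by
    rw [hc, div_le_one (by linarith)]
    exact_mod_cast Nat.totient_le q
  set Φ : ZMod q → ℂ := fun j => (1 : DirichletCharacter ℂ q) j - c with hΦ
  have hsum : ∑ j, Φ j = 0 := by
    simp only [hΦ, Finset.sum_sub_distrib]
    rw [MulChar.sum_one_eq_card_units, ZMod.card_units_eq_totient]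
    simp [ZMod.card, hc]
    field_simp
    simp
  have hΦ1 : ∀ j, ‖Φ j‖ ≤ 1 := by
    intro j
    by_cases hj : IsUnit j
    · simp only [hΦ, MulChar.one_apply hj]
      rw [← ofReal_one, ← ofReal_sub, norm_real, Real.norm_eq_abs, abs_le]
      constructor <;> linarith
    · simp only [hΦ, MulChar.map_nonunit _ hj]
      rw [zero_sub, norm_neg, norm_real, Real.norm_eq_abs, abs_le]
      constructor <;> linarith
  have hL : DirichletCharacter.LFunctionTrivChar q s = ZMod.LFunction Φ s + c * riemannZeta s := by
    rw [ZMod.LFunction_eq_LSeries Φ hs, ← LSeries_one_eq_riemannZeta hs]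
    have h1 : DirichletCharacter.LFunctionTrivChar q s
      = LSeries (fun n => (1 : DirichletCharacter ℂ q) n) s :=
          DirichletCharacter.LFunction_eq_LSeries _ hs
    rw [h1, ← LSeries_smul (1 : ℕ → ℂ) (c : ℂ) s, ← LSeries_add]
    · congr 1
      ext n
      simp [hΦ]
    · exact ZMod.LSeriesSummable_of_one_lt_re Φ hs
    · exact (LSeriesSummable_one_iff.2 hs).smul _
  rw [hL]
  have b1 := norm_LFunction_le hsum hΦ1 hδ hδ2 (s := s) (by linarith) hs3
  have b2 := norm_riemannZeta_le hδ hδ2 (s := s) (by linarith) hs3 him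
  have b3 : ‖(c : ℂ) * riemannZeta s‖ ≤ ‖riemannZeta s‖ := by
    rw [norm_mul, norm_real, Real.norm_of_nonneg hc0]
    exact mul_le_of_le_one_left (norm_nonneg _) hc1
  set τ := (q : ℝ) * (|s.im| + 2) with hτ
  have hτ' : |s.im| + 2 ≤ τ := by nlinarith
  have b4 : (6 + 2 / δ) * (1 + 1 / |s.im|) * (|s.im| + 2) ^ (2 * δ)
      ≤ (6 + 2 / δ) * (1 + 1 / |s.im|) * τ ^ (2 * δ) := by gcongr
  have b5 : (6 + 2 / δ) * τ ^ (2 * δ) ≤ (6 + 2 / δ) * (1 + 1 / |s.im|) * τ ^ (2 * δ) := by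
    gcongr
    have : 0 ≤ 1 / |s.im| := by positivity
    exact le_mul_of_one_le_right (by positivity) (by linarith)
  have b6 : (12 + 4 / δ) * (1 + 1 / |s.im|) * τ ^ (2 * δ)
    = (6 + 2 / δ) * (1 + 1 / |s.im|) * τ ^ (2 * δ) + (6 + 2 / δ) * (1 + 1 / |s.im|) *
        τ ^ (2 * δ) := by ring
  refine (norm_add_le _ _).trans ?_
  rw [b6]
  linarith

end SiegelWalfisz

namespace SiegelWalfisz
open Complex MeasureTheory Set Filter Topology DirichletCharacter

lemma tsum_rpow_le {σ : ℝ} (hσ : 1 < σ) : ∑' n : ℕ, 1 / (n + 1 : ℝ) ^ σ ≤ 1 + 1 / (σ - 1) := by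
  have h := ZetaAsymptotics.zeta_limit_aux1 hσ
  have h2 : 0 ≤ σ * ZetaAsymptotics.termTSum σ :=
    mul_nonneg (by linarith) (tsum_nonneg fun n => ZetaAsymptotics.term_nonneg _ _)
  linarith

lemma norm_LSeries_le {a : ℕ → ℂ} (ha : ∀ n, ‖a n‖ ≤ 1) {s : ℂ} (hs : 1 < s.re) :
    ‖LSeries a s‖ ≤ 1 + 1 / (s.re - 1) := by
  refine le_trans ?_ (tsum_rpow_le hs)
  have hsum : Summable fun n : ℕ => 1 / (n : ℝ) ^ s.re := Real.summable_one_div_nat_rpow.2 hs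
  have h1 : ∑' n : ℕ, 1 / (n + 1 : ℝ) ^ s.re = ∑' n : ℕ, 1 / (n : ℝ) ^ s.re := by
    rw [hsum.tsum_eq_zero_add]
    simp [Real.zero_rpow (by linarith : s.re ≠ 0)]
  rw [h1, LSeries]
  refine tsum_of_norm_bounded hsum.hasSum fun n => ?_
  rcases Nat.eq_zero_or_pos n with rfl | hn
  · simp [Real.zero_rpow (by linarith : s.re ≠ 0)]
  · rw [LSeries.term_of_ne_zero hn.ne', norm_div, norm_natCast_cpow_of_pos hn]
    gcongr
    exact ha n

section
variable {q : ℕ} [NeZero q]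

lemma norm_LFunction_le_of_one_lt (χ : DirichletCharacter ℂ q) {s : ℂ} (hs : 1 < s.re) :
    ‖LFunction χ s‖ ≤ 1 + 1 / (s.re - 1) := by
  rw [LFunction_eq_LSeries χ hs]
  exact norm_LSeries_le (fun n => χ.norm_le_one _) hs

lemma le_norm_LFunction_of_one_lt (χ : DirichletCharacter ℂ q) {s : ℂ} (hs : 1 < s.re) :
    (s.re - 1) / s.re ≤ ‖LFunction χ s‖ := by
  have h := LSeries.mul_mu_eq_one χ hs
  rw [← LFunction_eq_LSeries χ hs] at h
  have h2 : ‖LSeries ((fun n : ℕ => χ (n : ZMod q)) * fun n : ℕ =>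
      ((ArithmeticFunction.moebius n : ℤ) : ℂ)) s‖
      ≤ 1 + 1 / (s.re - 1) := by
    refine norm_LSeries_le (fun n => ?_) hs
    rw [Pi.mul_apply, norm_mul]
    refine mul_le_one₀ (χ.norm_le_one _) (norm_nonneg _) ?_
    rw [norm_intCast]
    exact_mod_cast ArithmeticFunction.abs_moebius_le_one
  have h3 := congrArg norm h
  rw [norm_mul, norm_one] at h3
  have h4 : 1 ≤ ‖LFunction χ s‖ * (1 + 1 / (s.re - 1)) := by
    exact h3.symm.le.trans (by gcongr)
  have hx : 0 < s.re - 1 := by linarith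
  rw [div_le_iff₀ (by linarith)]
  have h5 : ‖LFunction χ s‖ * s.re = (‖LFunction χ s‖ * (1 + 1 / (s.re - 1))) * (s.re - 1) := by
    field_simp; ring
  rw [h5]
  exact le_mul_of_one_le_left hx.le h4

/-- A lower bound on the segment `1 + x + iy` from a lower bound `x ^ (3 / 4)` and smoothness. -/
lemma lower_of_lipschitz {f : ℝ → ℝ} {M : ℝ} (hM : 1 ≤ M)
    (hlip : ∀ x ∈ Icc (0 : ℝ) 1, ∀ y ∈ Icc (0 : ℝ) 1, f y - f x ≤ M * |y - x|)
    (hlow : ∀ x ∈ Ioc (0 : ℝ) 1, x ^ (3 / 4 : ℝ) / M ≤ f x) {x : ℝ} (hx : x ∈ Ioc (0 : ℝ) 1) :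
    1 / (16 * M ^ 7) ≤ f x := by
  have hM0 : 0 < M := by linarith
  set x0 : ℝ := 1 / (16 * M ^ 8) with hx0
  have hM8 : 1 ≤ M ^ 8 := one_le_pow₀ hM
  have hx0pos : 0 < x0 := by positivity
  have hx01 : x0 ≤ 1 := by rw [hx0, div_le_one (by positivity)]; linarith
  have hpow : x0 ^ (3 / 4 : ℝ) = 1 / (8 * M ^ 6) := by
    have : x0 = (1 / (2 * M ^ 2)) ^ (4 : ℝ) := by
      rw [hx0]; norm_cast; field_simp; norm_num
    rw [this, ← Real.rpow_mul (by positivity)]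
    norm_num
    field_simp
    norm_num
  have h1 := hlow x0 ⟨hx0pos, hx01⟩
  rw [hpow] at h1
  have h2 : 1 / (8 * M ^ 6) / M = 2 * (1 / (16 * M ^ 7)) := by field_simp; norm_num
  have hpos : 0 < 1 / (16 * M ^ 7) := by positivity
  rcases le_total x x0 with h | h
  · have h3 := hlip x ⟨hx.1.le, hx.2⟩ x0 ⟨hx0pos.le, hx01⟩
    have h4 : M * |x0 - x| ≤ M * x0 := by
      gcongr; rw [abs_of_nonneg (by linarith)]; linarith [hx.1]
    have h5 : M * x0 = 1 / (16 * M ^ 7) := by rw [hx0]; field_simp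
    linarith
  · have h3 := hlow x hx
    have h4 : x0 ^ (3 / 4 : ℝ) / M ≤ x ^ (3 / 4 : ℝ) / M := by gcongr
    rw [hpow] at h4
    linarith

lemma norm_sub_le_of_deriv {f : ℂ → ℂ} {M : ℝ} {s : Set ℂ} (hs : Convex ℝ s)
    (hd : ∀ z ∈ s, DifferentiableAt ℂ f z) (hM : ∀ z ∈ s, ‖deriv f z‖ ≤ M) {z w : ℂ} (hz : z ∈ s)
    (hw : w ∈ s) : ‖f w‖ - ‖f z‖ ≤ M * ‖w - z‖ :=
  (norm_sub_norm_le _ _).trans (hs.norm_image_sub_le_of_norm_deriv_le hd hM hz hw)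

/-- Quantitative non-vanishing near `Re s = 1` from the `3-4-1` inequality. -/
lemma lower_of_three_four_one (χ : DirichletCharacter ℂ q) {y M : ℝ} (hM : 1 ≤ M)
    (h2 : ∀ x ∈ Ioc (0 : ℝ) 1, ‖LFunction (χ ^ 2) (1 + x + 2 * I * y)‖ ≤ M)
    (hd : ∀ x ∈ Icc (0 : ℝ) 1, DifferentiableAt ℂ (LFunction χ) (1 + x + I * y))
    (hd' : ∀ x ∈ Icc (0 : ℝ) 1, ‖deriv (LFunction χ) (1 + x + I * y)‖ ≤ M) {x : ℝ}
    (hx : x ∈ Ioc (0 : ℝ) 1) :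
    1 / (16 * (8 * M) ^ 7) ≤ ‖LFunction χ (1 + x + I * y)‖ := by
  refine lower_of_lipschitz (f := fun x : ℝ => ‖LFunction χ (1 + x + I * y)‖) (by linarith) ?_ ?_ hx
  · intro u hu v hv
    set S : Set ℂ := (fun x : ℝ => (1 + x + I * y : ℂ)) '' Icc 0 1
    have hS : Convex ℝ S := by
      rintro _ ⟨a, ha, rfl⟩ _ ⟨b, hb, rfl⟩ α β hα hβ hαβ
      refine ⟨α * a + β * b, ?_, ?_⟩
      · exact convex_Icc 0 1 ha hb hα hβ hαβ
      · have : (α : ℂ) + β = 1 := by exact_mod_cast hαβ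
        simp only [ofReal_add, ofReal_mul, real_smul]
        linear_combination (-1 - I * y) * this
    have h := norm_sub_le_of_deriv (M := M) hS (f := LFunction χ) (by rintro _ ⟨a, ha, rfl⟩; exact hd a ha)
      (by rintro _ ⟨a, ha, rfl⟩; exact hd' a ha) ⟨u, hu, rfl⟩ ⟨v, hv, rfl⟩
    refine h.trans ?_
    have e : ((1 + v + I * y : ℂ)) - (1 + u + I * y) = ((v - u : ℝ) : ℂ) := by push_cast; ring
    simp only [e, norm_real, Real.norm_eq_abs]
    gcongr
    linarith
  · intro x hx
    have h := norm_LFunction_product_ge_one χ hx.1 y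
    rw [norm_mul, norm_mul, norm_pow, norm_pow] at h
    have hT : ‖LFunctionTrivChar q (1 + x)‖ ≤ 2 / x := by
      refine (norm_LFunction_le_of_one_lt (1 : DirichletCharacter ℂ q) (s := 1 + x)
          (by simpa using hx.1)).trans ?_
      have hx0 := hx.1
      simp only [add_re, one_re, ofReal_re, add_sub_cancel_left]
      rw [← sub_nonneg]
      have : 2 / x - (1 + 1 / x) = (1 - x) / x := by field_simp; ring
      rw [this]
      exact div_nonneg (by linarith [hx.2]) hx0.le
    set F := ‖LFunction χ (1 + x + I * y)‖ with hF
    have hF0 : 0 ≤ F := norm_nonneg _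
    have h3 : 1 ≤ (2 / x) ^ 3 * F ^ 4 * M := by
      refine le_trans h ?_
      gcongr ?_ ^ 3 * F ^ 4 * ?_
      · have := hx.1
        positivity
      · exact h2 x hx
    have hx0 := hx.1
    have h4 : x ^ 3 ≤ 8 * M * F ^ 4 := by
      have : (2 / x) ^ 3 * F ^ 4 * M = (8 * M * F ^ 4) / x ^ 3 := by field_simp; ring
      rwa [this, le_div_iff₀ (by positivity), one_mul] at h3
    have h5 : x ^ 3 ≤ (8 * M * F) ^ 4 := by
      refine h4.trans ?_
      rw [mul_pow]
      gcongr
      exact le_self_pow₀ (by linarith) (by norm_num)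
    rw [div_le_iff₀ (by linarith)]
    have h6 : x ^ (3 / 4 : ℝ) = (x ^ 3) ^ (1 / 4 : ℝ) := by
      rw [← Real.rpow_natCast, ← Real.rpow_mul hx0.le]; norm_num
    have h7 : 8 * M * F = ((8 * M * F) ^ 4) ^ (1 / 4 : ℝ) := by
      rw [← Real.rpow_natCast, ← Real.rpow_mul (by positivity)]; norm_num
    rw [h6, mul_comm F, h7]
    gcongr

end

/-- Bound for `f` on a ball around `s` in terms of `Re s` close to 1. -/
lemma re_im_of_mem_ball {s z : ℂ} {r : ℝ} (hz : z ∈ Metric.ball s r) :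
    |z.re - s.re| < r ∧ |z.im - s.im| < r := by
  have h := mem_ball_iff_norm.1 hz
  exact ⟨(by simpa using (abs_re_le_norm (z - s)).trans_lt h),
    (by simpa using (abs_im_le_norm (z - s)).trans_lt h)⟩

lemma norm_LFunction_le_ball {q : ℕ} [NeZero q] {χ : DirichletCharacter ℂ q} (hχ : χ ≠ 1) {δ : ℝ}
    (hδ : 0 < δ) (hδ2 : δ ≤ 1 / 2) {s z : ℂ} (hs : 1 ≤ s.re) (hs2 : s.re ≤ 2)
    (hz : z ∈ Metric.ball s δ) :
    ‖LFunction χ z‖ ≤ (12 + 4 / δ) * ((q : ℝ) * (|s.im| + 2)) ^ (2 * δ) := by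
  obtain ⟨h1, h2⟩ := re_im_of_mem_ball hz
  rw [abs_lt] at h1
  have h3 : |z.im| ≤ |s.im| + 1 := by
    have := abs_sub_abs_le_abs_sub z.im s.im
    linarith
  refine (norm_LFunction_le (MulChar.sum_eq_zero_of_ne_one hχ) (fun j => χ.norm_le_one j) hδ hδ2
    (s := z) (by linarith) (by linarith)).trans ?_
  have : (q : ℝ) * (|z.im| + 2) ≤ 2 * ((q : ℝ) * (|s.im| + 2)) := by
    have hq : (0 : ℝ) ≤ q := by positivity
    nlinarith [abs_nonneg s.im]
  calc (6 + 2 / δ) * ((q : ℝ) * (|z.im| + 2)) ^ (2 * δ)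
      ≤ (6 + 2 / δ) * (2 * ((q : ℝ) * (|s.im| + 2))) ^ (2 * δ) := by gcongr
    _ = (6 + 2 / δ) * (2 ^ (2 * δ) * ((q : ℝ) * (|s.im| + 2)) ^ (2 * δ)) := by
        rw [Real.mul_rpow (by norm_num) (by positivity)]
    _ ≤ (6 + 2 / δ) * (2 ^ (1 : ℝ) * ((q : ℝ) * (|s.im| + 2)) ^ (2 * δ)) := by
        gcongr
        · norm_num
        · linarith
    _ = _ := by rw [Real.rpow_one]; ring

lemma norm_riemannZeta_le_ball {δ : ℝ} (hδ : 0 < δ) (hδ2 : δ ≤ 1 / 2) {s z : ℂ} (hs : 1 ≤ s.re)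
    (hs2 : s.re ≤ 2) (him : 1 ≤ |s.im|) (hz : z ∈ Metric.ball s δ) :
    ‖riemannZeta z‖ ≤ (36 + 12 / δ) * (|s.im| + 2) ^ (2 * δ) := by
  obtain ⟨h1, h2⟩ := re_im_of_mem_ball hz
  rw [abs_lt] at h1
  have h3 : |z.im| ≤ |s.im| + 1 := by
    have := abs_sub_abs_le_abs_sub z.im s.im
    linarith
  have h4 : 1 / 2 ≤ |z.im| := by
    have := abs_sub_abs_le_abs_sub s.im z.im
    rw [abs_sub_comm] at this
    linarith
  refine (norm_riemannZeta_le hδ hδ2 (s := z) (by linarith) (by linarith)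
    (abs_pos.1 (by linarith))).trans ?_
  have h5 : 1 / |z.im| ≤ 2 := by
    rw [div_le_iff₀ (by linarith)]; linarith
  calc (6 + 2 / δ) * (1 + 1 / |z.im|) * (|z.im| + 2) ^ (2 * δ)
      ≤ (6 + 2 / δ) * (1 + 2) * (2 * (|s.im| + 2)) ^ (2 * δ) := by
        gcongr
        linarith [abs_nonneg s.im]
    _ = (6 + 2 / δ) * (1 + 2) * (2 ^ (2 * δ) * (|s.im| + 2) ^ (2 * δ)) := by
        rw [Real.mul_rpow (by norm_num) (by positivity)]
    _ ≤ (6 + 2 / δ) * (1 + 2) * (2 ^ (1 : ℝ) * (|s.im| + 2) ^ (2 * δ)) := by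
        gcongr
        · norm_num
        · linarith
    _ = _ := by rw [Real.rpow_one]; ring

lemma norm_deriv_LFunction_le {q : ℕ} [NeZero q] {χ : DirichletCharacter ℂ q} (hχ : χ ≠ 1) {δ : ℝ}
    (hδ : 0 < δ) (hδ2 : δ ≤ 1 / 2) {s : ℂ} (hs : 1 ≤ s.re) (hs2 : s.re ≤ 2) :
    ‖deriv (LFunction χ) s‖ ≤ 4 * ((12 + 4 / δ) * ((q : ℝ) * (|s.im| + 2)) ^ (2 * δ)) / δ :=
  norm_deriv_le_of_ball hδ (differentiable_LFunction hχ).differentiableOn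
    (fun z hz => norm_LFunction_le_ball hχ hδ hδ2 hs hs2 hz) (Metric.mem_ball_self (by positivity))

lemma norm_deriv_riemannZeta_le {δ : ℝ} (hδ : 0 < δ) (hδ2 : δ ≤ 1 / 2) {s : ℂ} (hs : 1 ≤ s.re)
    (hs2 : s.re ≤ 2) (him : 1 ≤ |s.im|) :
    ‖deriv riemannZeta s‖ ≤ 4 * ((36 + 12 / δ) * (|s.im| + 2) ^ (2 * δ)) / δ := by
  refine norm_deriv_le_of_ball hδ (fun z hz => ?_)
    (fun z hz => norm_riemannZeta_le_ball hδ hδ2 hs hs2 him hz)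
        (Metric.mem_ball_self (by positivity))
  refine (differentiableAt_riemannZeta ?_).differentiableWithinAt
  rintro rfl
  have := (re_im_of_mem_ball hz).2
  simp at this
  linarith

end SiegelWalfisz

namespace SiegelWalfisz
open Complex Set Filter Topology
open scoped ComplexOrder

/-- If `-F' / F` is a Dirichlet series with nonnegative coefficients, `F` is completely monotone. -/
lemma iteratedDeriv_alternating_of_deriv_eq {F : ℂ → ℂ} {h : ℕ → ℂ} (hh : 0 ≤ h)
    (hsum : LSeries.abscissaOfAbsConv h ≤ 1) (hF : DifferentiableOn ℂ F {s | 1 < s.re})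
    (hd : ∀ s : ℂ, 1 < s.re → deriv F s = -(LSeries h s * F s)) (h2 : 0 ≤ F 2) (m : ℕ) :
    0 ≤ (-1) ^ m * iteratedDeriv m F 2 := by
  have hopen : IsOpen {s : ℂ | 1 < s.re} := isOpen_lt continuous_const continuous_re
  have hmem : (2 : ℂ) ∈ {s : ℂ | 1 < s.re} := by simp
  have hlt : LSeries.abscissaOfAbsConv h < (2 : ℝ) :=
    hsum.trans_lt (by rw [← EReal.coe_one, EReal.coe_lt_coe_iff]; norm_num)
  have hHan : AnalyticAt ℂ (LSeries h) 2 :=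
    LSeries_analyticOnNhd h 2 (by simpa using hlt)
  have hFan : AnalyticAt ℂ F 2 := hF.analyticAt (hopen.mem_nhds hmem)
  induction m using Nat.strong_induction_on with
  | _ m ih =>
    rcases m with _ | m
    · simpa using h2
    · have heq : deriv F =ᶠ[𝓝 2] -(LSeries h * F) :=
        eventuallyEq_of_mem (hopen.mem_nhds hmem) fun s hs => hd s hs
      rw [iteratedDeriv_succ', heq.iteratedDeriv_eq, iteratedDeriv_neg,
        iteratedDeriv_mul hHan.contDiffAt hFan.contDiffAt, mul_neg, Finset.mul_sum,
        ← Finset.sum_neg_distrib]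
      refine Finset.sum_nonneg fun i hi => ?_
      have hi' : i ≤ m := by simpa [Nat.lt_succ_iff] using hi
      have h1 : 0 ≤ (-1) ^ i * iteratedDeriv i (LSeries h) 2 := by
        have := LSeries.iteratedDeriv_alternating hh hlt i
        simpa using this
      have h3 := ih (m - i) (by omega)
      have e : -((-1 : ℂ) ^ (m + 1) * ((m.choose i : ℂ) * iteratedDeriv i (LSeries h) 2
          * iteratedDeriv (m - i) F 2)) = (m.choose i : ℂ) *
          (((-1) ^ i * iteratedDeriv i (LSeries h) 2) * ((-1) ^ (m - i) * iteratedDeriv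
              (m - i) F 2)) := by
        have : (-1 : ℂ) ^ (m + 1) = -((-1) ^ i * (-1) ^ (m - i)) := by
          rw [← pow_add, pow_succ, show i + (m - i) = m by omega]; ring
        rw [this]; ring
      rw [e]
      exact mul_nonneg (by positivity) (mul_nonneg h1 h3)

/-- Estermann's inequality: a nonnegative Dirichlet series with a simple pole at `1` which is
nonpositive at some `β < 1` close to `1` cannot have too small a residue. -/
lemma residue_lower_bound {F W : ℂ → ℂ} {lam c B β : ℝ} {M : ℕ} (hW : Differentiable ℂ W)
    (hFW : ∀ s, s ≠ 1 → F s = W s + lam / (s - 1))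
    (hmon : ∀ m : ℕ, 0 ≤ (-1) ^ m * iteratedDeriv m F 2) (hc : c ≤ (F 2).re)
    (hB : ∀ z ∈ Metric.sphere (2 : ℂ) (4 / 3), ‖W z‖ ≤ B) (hβ : 7 / 8 < β) (hβ1 : β < 1)
    (hFβ : (F β).re ≤ 0) (hM : 1 ≤ M) (hMB : 7 * B * (27 / 32) ^ M ≤ c / 2) :
    c / 2 * (1 - β) ≤ lam * (2 - β) ^ M := by
  set b : ℕ → ℝ := fun m => ((m.factorial : ℂ)⁻¹ * ((-1) ^ m * iteratedDeriv m W 2)).re with hb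
  have hB0 : 0 ≤ B := (norm_nonneg _).trans
    (hB (2 + (4 / 3 : ℝ)) (by simp))
  have hbB : ∀ m, |b m| ≤ B * (3 / 4) ^ m := by
    intro m
    refine (abs_re_le_norm _).trans ?_
    have h1 := norm_iteratedDeriv_le_of_forall_mem_sphere_norm_le (c := (2 : ℂ)) (R := 4 / 3) m
      (by norm_num) hW.diffContOnCl hB
    rw [norm_mul, norm_mul, norm_pow, norm_neg, norm_one, one_pow, one_mul, norm_inv, norm_natCast]
    calc (m.factorial : ℝ)⁻¹ * ‖iteratedDeriv m W 2‖
        ≤ (m.factorial : ℝ)⁻¹ * (m.factorial * B / (4 / 3) ^ m) := by gcongr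
      _ = B * (3 / 4) ^ m := by
          have : (m.factorial : ℝ) ≠ 0 := by positivity
          rw [show (3 / 4 : ℝ) = (4 / 3)⁻¹ by norm_num, inv_pow]
          field_simp
  have hiter : ∀ m : ℕ, iteratedDeriv m F 2 = iteratedDeriv m W 2 +
      lam * ((-1) ^ m * m.factorial) := by
    intro m
    have heq : F =ᶠ[𝓝 2] fun s => W s + lam * (1 * s - 1)⁻¹ := by
      filter_upwards [isOpen_ne.mem_nhds (by norm_num : (2 : ℂ) ≠ 1)] with s hs
      rw [hFW s hs, one_mul, div_eq_mul_inv]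
    have hinv : ContDiffAt ℂ m (fun s : ℂ => (1 * s - 1)⁻¹) 2 := by
      refine ContDiffAt.inv (by fun_prop) (by norm_num)
    rw [heq.iteratedDeriv_eq, iteratedDeriv_fun_add hW.contDiff.contDiffAt
      (contDiffAt_const.mul hinv), iteratedDeriv_const_mul_field]
    congr 2
    rw [iteratedDeriv_eq_iterate, iter_deriv_inv_linear_sub]
    norm_num
  have hbl : ∀ m, -lam ≤ b m := by
    intro m
    have h1 := (Complex.le_def.1 (hmon m)).1
    rw [hiter m] at h1
    have h2 : ((-1 : ℂ) ^ m * (iteratedDeriv m W 2 + lam * ((-1) ^ m * m.factorial)))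
        = (m.factorial : ℂ) * ((m.factorial : ℂ)⁻¹ * ((-1) ^ m * iteratedDeriv m W 2) + lam) := by
      have h3 : (m.factorial : ℂ) ≠ 0 := by exact_mod_cast m.factorial_ne_zero
      have h4 : (-1 : ℂ) ^ m * (-1) ^ m = 1 := by rw [← mul_pow]; simp
      field_simp
      linear_combination (lam * m.factorial : ℂ) * h4
    rw [h2, ← ofReal_natCast, re_ofReal_mul, add_re, ofReal_re] at h1
    have h5 : (0 : ℝ) < m.factorial := by positivity
    have h6 : 0 ≤ b m + lam := by
      by_contra hneg
      push Not at hneg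
      have := mul_neg_of_pos_of_neg h5 hneg
      simp only [hb, ofReal_natCast] at this h1
      simp only [zero_re] at h1
      linarith
    linarith
  have hb0 : c - lam ≤ b 0 := by
    have h1 := hiter 0
    simp only [iteratedDeriv_zero, pow_zero, Nat.factorial_zero, Nat.cast_one, mul_one] at h1
    have : b 0 = (W 2).re := by simp [hb]
    rw [this]
    rw [h1, add_re, ofReal_re] at hc
    linarith
  set u : ℝ := 2 - β with hu
  have hu1 : 1 < u := by linarith
  have hu2 : u < 9 / 8 := by linarith
  have hsum : HasSum (fun m => b m * u ^ m) (W β).re := by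
    have h := Complex.hasSum_re (hasSum_taylorSeries_of_entire hW 2 (β : ℂ))
    refine h.congr_fun ?_ |> fun h => h
    intro m
    have e : (m.factorial : ℂ)⁻¹ • ((β : ℂ) - 2) ^ m • iteratedDeriv m W 2
        = ((m.factorial : ℂ)⁻¹ * ((-1) ^ m * iteratedDeriv m W 2)) * ((u ^ m : ℝ) : ℂ) := by
      have : (β : ℂ) - 2 = (-1) * (u : ℂ) := by rw [hu]; push_cast; ring
      rw [this, mul_pow]
      simp only [smul_eq_mul]
      push_cast
      ring
    rw [e, re_mul_ofReal]
  have hr : 0 ≤ (27 / 32 : ℝ) ^ M := by positivity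
  have htail : -(B * (27 / 32) ^ M * (32 / 5)) ≤ ∑' m, b (m + M) * u ^ (m + M) := by
    have hgeo : HasSum (fun m : ℕ => B * (27 / 32 : ℝ) ^ M * (27 / 32) ^ m)
        (B * (27 / 32) ^ M * (32 / 5)) := by
      have := (hasSum_geometric_of_lt_one (r := (27 / 32 : ℝ)) (by norm_num) (by norm_num)).mul_left
        (B * (27 / 32) ^ M)
      convert! this using 2
      norm_num
    have hle : ∀ m, ‖b (m + M) * u ^ (m + M)‖ ≤ B * (27 / 32 : ℝ) ^ M * (27 / 32) ^ m := by
      intro m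
      rw [norm_mul, Real.norm_eq_abs, norm_pow, Real.norm_eq_abs, abs_of_pos (by linarith : 0 < u)]
      calc |b (m + M)| * u ^ (m + M) ≤ B * (3 / 4) ^ (m + M) * (9 / 8) ^ (m + M) := by
            gcongr
            exact hbB _
        _ = B * (27 / 32) ^ (m + M) := by rw [mul_assoc, ← mul_pow]; norm_num
        _ = _ := by rw [pow_add]; ring
    have := tsum_of_norm_bounded hgeo hle
    rw [Real.norm_eq_abs] at this
    linarith [neg_abs_le (∑' m, b (m + M) * u ^ (m + M))]
  have hhead : c - lam * ((u ^ M - 1) / (u - 1)) ≤ ∑ m ∈ Finset.range M, b m * u ^ m := by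
    rw [← geom_sum_eq hu1.ne' M]
    obtain ⟨k, rfl⟩ : ∃ k, M = k + 1 := ⟨M - 1, by omega⟩
    rw [Finset.sum_range_succ', Finset.sum_range_succ', mul_add, Finset.mul_sum]
    have : ∑ i ∈ Finset.range k, -(lam * u ^ (i + 1)) ≤ ∑ i ∈ Finset.range k,
        b (i + 1) * u ^ (i + 1) := by
      refine Finset.sum_le_sum fun i _ => ?_
      rw [← neg_mul]
      gcongr
      exact hbl _
    rw [Finset.sum_neg_distrib] at this
    simp only [pow_zero, mul_one]
    linarith
  have htot := hsum.summable.sum_add_tsum_nat_add M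
  rw [hsum.tsum_eq] at htot
  have hβne : (β : ℂ) ≠ 1 := by exact_mod_cast hβ1.ne
  rw [hFW _ hβne, add_re] at hFβ
  have hre : ((lam : ℂ) / ((β : ℂ) - 1)).re = -(lam / (u - 1)) := by
    rw [← ofReal_one, ← ofReal_sub, ← ofReal_div, ofReal_re, hu,
      show β - 1 = -(2 - β - 1) by ring, div_neg]
  rw [hre] at hFβ
  have h7 : lam * ((u ^ M - 1) / (u - 1)) + lam / (u - 1) = lam * u ^ M / (u - 1) := by ring
  have h8 : B * (27 / 32 : ℝ) ^ M * (32 / 5) ≤ c / 2 := by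
    have : 0 ≤ B * (27 / 32 : ℝ) ^ M := by positivity
    linarith
  have h9 : c / 2 ≤ lam * u ^ M / (u - 1) := by linarith
  rw [le_div_iff₀ (by linarith)] at h9
  have : 1 - β = u - 1 := by rw [hu]; ring
  rwa [this]

end SiegelWalfisz

namespace SiegelWalfisz
open Complex Set Filter Topology DirichletCharacter
open scoped ComplexConjugate

section EulerFactors

lemma prod_one_add_inv_le (S : Finset ℕ) (hS : ∀ n ∈ S, 1 ≤ n) :
    ∏ n ∈ S, (1 + (n : ℝ)⁻¹) ≤ S.card + 1 := by
  induction S using Finset.induction_on_max with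
  | empty => simp
  | insert a s hmax ih =>
    have ha : a ∉ s := fun h => lt_irrefl _ (hmax a h)
    rw [Finset.prod_insert ha, Finset.card_insert_of_notMem ha]
    have hcard : s.card + 1 ≤ a := by
      have h1 : s ⊆ Finset.Ico 1 a := fun n hn =>
        Finset.mem_Ico.2 ⟨hS n (Finset.mem_insert_of_mem hn), hmax n hn⟩
      have h2 := Finset.card_le_card h1
      have h3 := hS a (Finset.mem_insert_self _ _)
      rw [Nat.card_Ico] at h2
      omega
    have ih' := ih fun n hn => hS n (Finset.mem_insert_of_mem hn)
    have ha0 : (0 : ℝ) < a := by exact_mod_cast (by omega : 0 < a)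
    have hcard' : (s.card : ℝ) + 1 ≤ a := by exact_mod_cast hcard
    calc (1 + (a : ℝ)⁻¹) * ∏ n ∈ s, (1 + (n : ℝ)⁻¹) ≤ (1 + (a : ℝ)⁻¹) * (s.card + 1) := by gcongr
      _ = (s.card + 1) + (s.card + 1) / a := by ring
      _ ≤ (s.card + 1) + 1 := by gcongr; rw [div_le_one ha0]; exact hcard'
      _ = _ := by push_cast; ring

lemma card_primeFactors_add_one_le {n : ℕ} (hn : n ≠ 0) {η : ℝ} (hη : 0 < η) :
    (n.primeFactors.card : ℝ) + 1 ≤ (1 + 2 / η) * (n : ℝ) ^ η := by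
  have hn1 : (1 : ℝ) ≤ n := by exact_mod_cast Nat.one_le_iff_ne_zero.2 hn
  have h1 : 2 ^ n.primeFactors.card ≤ n :=
    (Finset.pow_card_le_prod _ _ _ fun p hp => (Nat.prime_of_mem_primeFactors hp).two_le).trans
      (Nat.le_of_dvd (by omega) (Nat.prod_primeFactors_dvd n))
  have h2 : (n.primeFactors.card : ℝ) * Real.log 2 ≤ Real.log n := by
    rw [← Real.log_pow]
    apply Real.log_le_log (by positivity)
    exact_mod_cast h1
  have h3 : Real.log n ≤ (n : ℝ) ^ η / η := Real.log_le_rpow_div (by positivity) hη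
  have h4 : 1 ≤ (n : ℝ) ^ η := Real.one_le_rpow hn1 hη.le
  have h5 := Real.log_two_gt_d9
  have h6 : (n.primeFactors.card : ℝ) * (1 / 2) ≤ n.primeFactors.card * Real.log 2 := by
    gcongr; linarith
  have h7 : (1 + 2 / η) * (n : ℝ) ^ η = (n : ℝ) ^ η + 2 * ((n : ℝ) ^ η / η) := by ring
  rw [h7]
  linarith

lemma inv_le_prod_one_sub_inv (n : ℕ) :
    ((n.primeFactors.card : ℝ) + 1)⁻¹ ≤ ∏ p ∈ n.primeFactors, (1 - (p : ℝ)⁻¹) := by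
  have h1 : ∏ p ∈ n.primeFactors, (1 - (p : ℝ)⁻¹)
      = (∏ k ∈ (n.primeFactors.image fun p : ℕ => p - 1), (1 + (k : ℝ)⁻¹))⁻¹ := by
    rw [Finset.prod_image, ← Finset.prod_inv_distrib]
    · refine Finset.prod_congr rfl fun p hp => ?_
      have h2 := (Nat.prime_of_mem_primeFactors hp).two_le
      have h3 : (2 : ℝ) ≤ p := by exact_mod_cast h2
      rw [Nat.cast_sub (by omega), Nat.cast_one]
      have : (p : ℝ) - 1 ≠ 0 := by linarith
      have : (p : ℝ) ≠ 0 := by linarith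
      rw [show (1 : ℝ) + ((p : ℝ) - 1)⁻¹ = p / (p - 1) by field_simp; ring]
      rw [inv_div]
      field_simp
    · intro a ha b hb hab
      have := (Nat.prime_of_mem_primeFactors ha).two_le
      have := (Nat.prime_of_mem_primeFactors hb).two_le
      have : a - 1 = b - 1 := hab
      omega
  rw [h1]
  have h2 : ∀ k ∈ (n.primeFactors.image fun p : ℕ => p - 1), 1 ≤ k := by
    intro k hk
    obtain ⟨p, hp, rfl⟩ := Finset.mem_image.1 hk
    have := (Nat.prime_of_mem_primeFactors hp).two_le
    omega
  have h3 : (0 : ℝ) < ∏ k ∈ (n.primeFactors.image fun p : ℕ => p - 1), (1 + (k : ℝ)⁻¹) :=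
    Finset.prod_pos fun k hk => by positivity
  gcongr
  refine (prod_one_add_inv_le _ h2).trans ?_
  exact add_le_add_left (by exact_mod_cast Finset.card_image_le) _

variable {q : ℕ} (χ : DirichletCharacter ℂ q) (Q : ℕ)

lemma norm_prod_euler_le :
    ‖∏ p ∈ Q.primeFactors, (1 - χ p * (p : ℂ) ^ (-(1 : ℂ)))‖ ≤ Q.primeFactors.card + 1 := by
  rw [norm_prod]
  refine le_trans ?_ (prod_one_add_inv_le _ fun p hp => (Nat.prime_of_mem_primeFactors hp).one_le)
  refine Finset.prod_le_prod (fun _ _ => norm_nonneg _) fun p hp => ?_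
  refine (norm_sub_le _ _).trans ?_
  rw [norm_one, norm_mul, cpow_neg_one, norm_inv, norm_natCast]
  gcongr
  exact mul_le_of_le_one_left (by positivity) (χ.norm_le_one _)

lemma le_norm_prod_euler :
    ((Q.primeFactors.card : ℝ) + 1)⁻¹ ≤ ‖∏ p ∈ Q.primeFactors,
        (1 - χ p * (p : ℂ) ^ (-(1 : ℂ)))‖ := by
  rw [norm_prod]
  refine (inv_le_prod_one_sub_inv Q).trans ?_
  refine Finset.prod_le_prod (fun p hp => ?_) fun p hp => ?_
  · have h2 : (1 : ℝ) ≤ p := by exact_mod_cast (Nat.prime_of_mem_primeFactors hp).one_le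
    simpa using inv_le_one_of_one_le₀ h2
  · refine le_trans ?_ (norm_sub_norm_le _ _)
    rw [norm_one, norm_mul, cpow_neg_one, norm_inv, norm_natCast]
    gcongr
    exact mul_le_of_le_one_left (by positivity) (χ.norm_le_one _)

end EulerFactors

section Quadratic
variable {q : ℕ} [NeZero q] {χ : DirichletCharacter ℂ q}

lemma apply_of_sq_eq_one (h2 : χ ^ 2 = 1) (a : ZMod q) : χ a = 0 ∨ χ a = 1 ∨ χ a = -1 := by
  by_cases ha : IsUnit a
  · right
    have : χ a ^ 2 = 1 := by
      rw [← MulChar.pow_apply' _ two_ne_zero, h2, MulChar.one_apply ha]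
    exact mul_self_eq_one_iff.1 (by rw [← sq]; exact this)
  · exact Or.inl (MulChar.map_nonunit _ ha)

lemma conj_apply_of_sq_eq_one (h2 : χ ^ 2 = 1) (a : ZMod q) : conj (χ a) = χ a := by
  rcases apply_of_sq_eq_one h2 a with h | h | h <;> simp [h]

lemma LFunction_conj_of_sq_eq_one (h1 : χ ≠ 1) (h2 : χ ^ 2 = 1) (s : ℂ) :
    LFunction χ (conj s) = conj (LFunction χ s) := by
  have hg : Differentiable ℂ fun z => conj (LFunction χ (conj z)) := fun z =>
    differentiableAt_conj_conj_iff.mpr (differentiable_LFunction h1 _)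
  have heq : (fun z => conj (LFunction χ (conj z))) = LFunction χ := by
    refine AnalyticOnNhd.eq_of_eventuallyEq (z₀ := (2 : ℂ)) (fun z _ => hg.analyticAt z)
      (fun z _ => (differentiable_LFunction h1).analyticAt z) ?_
    refine eventuallyEq_of_mem ((isOpen_lt continuous_const continuous_re).mem_nhds
      (by norm_num : (1 : ℝ) < (2 : ℂ).re)) fun z (hz : 1 < z.re) => ?_
    have hz' : 1 < (conj z).re := by simpa using hz
    rw [LFunction_eq_LSeries χ hz, LFunction_eq_LSeries χ hz', LSeries, LSeries, conj_tsum]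
    refine tsum_congr fun n => ?_
    rcases Nat.eq_zero_or_pos n with rfl | hn
    · simp
    · rw [LSeries.term_of_ne_zero hn.ne', LSeries.term_of_ne_zero hn.ne', map_div₀,
        conj_apply_of_sq_eq_one h2, ← conj_cpow _ _ (by rw [natCast_arg]; positivity), conj_natCast]
  have := congrFun heq s
  rw [← this, Complex.conj_conj]

lemma ofReal_re_LFunction (h1 : χ ≠ 1) (h2 : χ ^ 2 = 1) (x : ℝ) :
    ((LFunction χ x).re : ℂ) = LFunction χ x := by
  rw [← Complex.conj_eq_iff_re, ← LFunction_conj_of_sq_eq_one h1 h2, conj_ofReal]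

lemma re_LFunction_three (χ : DirichletCharacter ℂ q) : 1 / 2 ≤ (LFunction χ (3 : ℝ)).re := by
  have h3 : (1 : ℝ) < ((3 : ℝ) : ℂ).re := by norm_num
  rw [LFunction_eq_LSeries χ h3]
  have hs : LSeriesSummable (fun n => χ n) ((3 : ℝ) : ℂ) := ZMod.LSeriesSummable_of_one_lt_re χ h3
  have hsum : Summable fun n : ℕ => 1 / ((n : ℝ)) ^ (3 : ℝ) := Real.summable_one_div_nat_rpow.2
      (by norm_num)
  have e1 : LSeries (fun n => χ n) ((3 : ℝ) : ℂ)
      = 1 + ∑' n : ℕ, LSeries.term (fun n => χ n) ((3 : ℝ) : ℂ) (n + 2) := by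
    rw [LSeries, ← hs.sum_add_tsum_nat_add 2]
    simp [Finset.sum_range_succ, LSeries.term_def]
  have e2 : ∑' n : ℕ, 1 / ((n + 1 : ℝ)) ^ (3 : ℝ) = 1 + ∑' n : ℕ,
      1 / (((n + 2 : ℕ) : ℝ)) ^ (3 : ℝ) := by
    have h := ((summable_nat_add_iff 1).2 hsum).tsum_eq_zero_add
    simp only [Nat.cast_add, Nat.cast_one] at h ⊢
    rw [h]
    norm_num
    refine tsum_congr fun n => ?_
    norm_num [add_assoc]
  have e3 : ‖∑' n : ℕ, LSeries.term (fun n => χ n) ((3 : ℝ) : ℂ) (n + 2)‖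
      ≤ ∑' n : ℕ, 1 / (((n + 2 : ℕ) : ℝ)) ^ (3 : ℝ) := by
    refine tsum_of_norm_bounded ((summable_nat_add_iff 2).2 hsum).hasSum fun n => ?_
    rw [LSeries.term_of_ne_zero (by omega), norm_div, norm_natCast_cpow_of_pos (by omega),
        ofReal_re]
    gcongr
    exact χ.norm_le_one _
  have e4 := tsum_rpow_le (σ := 3) (by norm_num)
  have e5 := abs_re_le_norm (∑' n : ℕ, LSeries.term (fun n => χ n) ((3 : ℝ) : ℂ) (n + 2))
  rw [e1, add_re, one_re]
  have e6 := neg_abs_le (∑' n : ℕ, LSeries.term (fun n => χ n) ((3 : ℝ) : ℂ) (n + 2)).re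
  have e7 : ∑' n : ℕ, 1 / (((n + 2 : ℕ) : ℝ)) ^ (3 : ℝ) ≤ 1 / 2 := by
    rw [e2] at e4
    linarith
  linarith

lemma re_LFunction_pos (h1 : χ ≠ 1) (h2 : χ ^ 2 = 1) {b : ℝ} (hb : b < 3)
    (hne : ∀ x : ℝ, b < x → LFunction χ x ≠ 0) {x : ℝ} (hx : b < x) : 0 < (LFunction χ x).re := by
  by_contra hneg
  push Not at hneg
  have hcont : Continuous fun x : ℝ => (LFunction χ x).re :=
    continuous_re.comp ((differentiable_LFunction h1).continuous.comp continuous_ofReal)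
  have h3 := re_LFunction_three χ
  have := isPreconnected_Ioi.intermediate_value₂ (s := Ioi b) (a := x) (b := (3 : ℝ)) hx hb
    hcont.continuousOn (continuousOn_const (c := (0 : ℝ))) hneg (by linarith)
  obtain ⟨y, hy, hy0⟩ := this
  apply hne y hy
  rw [← ofReal_re_LFunction h1 h2, hy0, ofReal_zero]

lemma re_LFunction_pos_of_one_lt (h1 : χ ≠ 1) (h2 : χ ^ 2 = 1) {x : ℝ} (hx : 1 < x) :
    0 < (LFunction χ x).re :=
  re_LFunction_pos h1 h2 (b := 1) (by norm_num)
    (fun y hy => LFunction_ne_zero_of_one_le_re χ (.inl h1) (by simpa using hy.le)) hx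

end Quadratic
end SiegelWalfisz

namespace SiegelWalfisz
open Complex Set Filter Topology DirichletCharacter
open scoped ComplexOrder

section
variable {Q : ℕ} [NeZero Q] {ψ₁ ψ₂ : DirichletCharacter ℂ Q}

/-- The auxiliary product of Siegel's argument. -/
noncomputable def siegelProduct (ψ₁ ψ₂ : DirichletCharacter ℂ Q) (s : ℂ) : ℂ :=
  LFunction ψ₁ s * LFunction ψ₂ s * LFunction (ψ₁ * ψ₂) s

lemma differentiable_siegelProduct (h₁ : ψ₁ ≠ 1) (h₂ : ψ₂ ≠ 1) (h₃ : ψ₁ * ψ₂ ≠ 1) :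
    Differentiable ℂ (siegelProduct ψ₁ ψ₂) :=
  ((differentiable_LFunction h₁).mul (differentiable_LFunction h₂)).mul
      (differentiable_LFunction h₃)

lemma mul_sq_eq_one {M : Type*} [CommMonoid M] {a b : M} (ha : a ^ 2 = 1) (hb : b ^ 2 = 1) :
    (a * b) ^ 2 = 1 := by
  rw [mul_pow, ha, hb, one_mul]

lemma siegelProduct_ofReal (h₁ : ψ₁ ≠ 1) (h₂ : ψ₂ ≠ 1) (h₃ : ψ₁ * ψ₂ ≠ 1) (hs₁ : ψ₁ ^ 2 = 1)
    (hs₂ : ψ₂ ^ 2 = 1) (x : ℝ) : siegelProduct ψ₁ ψ₂ x =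
      (((LFunction ψ₁ x).re * (LFunction ψ₂ x).re * (LFunction (ψ₁ * ψ₂) x).re : ℝ) : ℂ) := by
  push_cast
  rw [ofReal_re_LFunction h₁ hs₁, ofReal_re_LFunction h₂ hs₂,
    ofReal_re_LFunction h₃ (mul_sq_eq_one hs₁ hs₂), siegelProduct]

lemma half_le_re_LFunction_two {χ : DirichletCharacter ℂ Q} (h1 : χ ≠ 1) (h2 : χ ^ 2 = 1) :
    1 / 2 ≤ (LFunction χ ((2 : ℝ) : ℂ)).re := by
  have hpos := re_LFunction_pos_of_one_lt h1 h2 (x := 2) (by norm_num)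
  have h := le_norm_LFunction_of_one_lt χ (s := ((2 : ℝ) : ℂ)) (by norm_num)
  rw [← ofReal_re_LFunction h1 h2 2, norm_real, Real.norm_eq_abs, abs_of_pos hpos] at h
  norm_num at h ⊢
  exact h

lemma one_eighth_le_zeta_mul_siegelProduct (h₁ : ψ₁ ≠ 1) (h₂ : ψ₂ ≠ 1) (h₃ : ψ₁ * ψ₂ ≠ 1)
    (hs₁ : ψ₁ ^ 2 = 1) (hs₂ : ψ₂ ^ 2 = 1) :
    ∃ r : ℝ, 1 / 8 ≤ r ∧ riemannZeta 2 * siegelProduct ψ₁ ψ₂ 2 = r := by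
  have e := siegelProduct_ofReal h₁ h₂ h₃ hs₁ hs₂ 2
  have a₁ := half_le_re_LFunction_two h₁ hs₁
  have a₂ := half_le_re_LFunction_two h₂ hs₂
  have a₃ := half_le_re_LFunction_two h₃ (mul_sq_eq_one hs₁ hs₂)
  refine ⟨Real.pi ^ 2 / 6 * ((LFunction ψ₁ ((2 : ℝ) : ℂ)).re * (LFunction ψ₂ ((2 : ℝ) : ℂ)).re
    * (LFunction (ψ₁ * ψ₂) ((2 : ℝ) : ℂ)).re), ?_, ?_⟩
  · have hpi : 1 ≤ Real.pi ^ 2 / 6 := by nlinarith [Real.pi_gt_three]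
    calc (1 / 8 : ℝ) = 1 * ((1 / 2) * (1 / 2) * (1 / 2)) := by norm_num
      _ ≤ _ := by gcongr
  · rw [riemannZeta_two, ofReal_mul, ← e]
    push_cast
    rfl

lemma siegelProduct_bound (h₁ : ψ₁ ≠ 1) (h₂ : ψ₂ ≠ 1) (h₃ : ψ₁ * ψ₂ ≠ 1) {z : ℂ}
    (hz : 1 / 2 ≤ z.re) (hi : |z.im| ≤ 4 / 3) : ‖siegelProduct ψ₁ ψ₂ z‖ ≤ (40 * Q : ℝ) ^ 3 := by
  have hQ : (1 : ℝ) ≤ Q := by exact_mod_cast NeZero.one_le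
  have key : ∀ χ : DirichletCharacter ℂ Q, χ ≠ 1 → ‖LFunction χ z‖ ≤ 40 * Q := by
    intro χ hχ
    rcases le_total z.re 3 with h | h
    · refine (norm_LFunction_le (Φ := χ) (MulChar.sum_eq_zero_of_ne_one hχ)
        (fun j => χ.norm_le_one j) (δ := 1 / 2) (by norm_num) le_rfl (by linarith) h).trans ?_
      norm_num
      nlinarith [abs_nonneg z.im]
    · refine (norm_LFunction_le_of_one_lt χ (by linarith)).trans ?_
      have : 1 / (z.re - 1) ≤ 1 := by rw [div_le_one (by linarith)]; linarith
      linarith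
  rw [siegelProduct, norm_mul, norm_mul]
  calc _ ≤ (40 * Q : ℝ) * (40 * Q) * (40 * Q) := by
        gcongr
        exacts [key _ h₁, key _ h₂, key _ h₃]
    _ = _ := by ring

open ArithmeticFunction in
lemma zeta_mul_siegelProduct_alternating (h₁ : ψ₁ ≠ 1) (h₂ : ψ₂ ≠ 1) (h₃ : ψ₁ * ψ₂ ≠ 1)
    (hs₁ : ψ₁ ^ 2 = 1) (hs₂ : ψ₂ ^ 2 = 1) (m : ℕ) :
    0 ≤ (-1) ^ m * iteratedDeriv m (fun s => riemannZeta s * siegelProduct ψ₁ ψ₂ s) 2 := by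
  have hsq := mul_sq_eq_one hs₁ hs₂
  set ψ₃ := ψ₁ * ψ₂ with hψ₃
  let T : DirichletCharacter ℂ Q → ℕ → ℂ := fun χ => (fun n : ℕ => χ n) * fun n : ℕ => (Λ n : ℂ)
  let h : ℕ → ℂ := ((fun n : ℕ => (Λ n : ℂ)) + T ψ₁) + (T ψ₂ + T ψ₃)
  have hdiff : ∀ s : ℂ, 1 < s.re → DifferentiableAt ℂ riemannZeta s := fun s hs =>
    differentiableAt_riemannZeta (by rintro rfl; simp at hs)
  have hsum : ∀ s : ℂ, 1 < s.re → LSeriesSummable h s := fun s hs =>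
    ((LSeriesSummable_vonMangoldt hs).add (LSeriesSummable_twist_vonMangoldt ψ₁ hs)).add
      ((LSeriesSummable_twist_vonMangoldt ψ₂ hs).add (LSeriesSummable_twist_vonMangoldt ψ₃ hs))
  refine iteratedDeriv_alternating_of_deriv_eq (h := h) ?_ ?_ ?_ ?_ ?_ m
  · intro n
    have hL : (0 : ℝ) ≤ Λ n := vonMangoldt_nonneg
    have e : h n = (Λ n : ℂ) * ((1 + ψ₁ n) * (1 + ψ₂ n)) := by
      simp only [h, T, hψ₃, Pi.add_apply, Pi.mul_apply, MulChar.mul_apply]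
      ring
    rw [Pi.zero_apply, e]
    refine mul_nonneg (Complex.zero_le_real.2 hL) (mul_nonneg ?_ ?_)
    · rcases apply_of_sq_eq_one hs₁ (n : ZMod Q) with h | h | h <;> rw [h] <;> norm_num
    · rcases apply_of_sq_eq_one hs₂ (n : ZMod Q) with h | h | h <;> rw [h] <;> norm_num
  · exact LSeries.abscissaOfAbsConv_le_of_forall_lt_LSeriesSummable fun y hy =>
      hsum y (by simpa using hy)
  · intro s hs
    exact ((hdiff s hs).mul (differentiable_siegelProduct h₁ h₂ h₃ s)).differentiableWithinAt
  · intro s hs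
    have hz := riemannZeta_ne_zero_of_one_lt_re hs
    have n₁ := LFunction_ne_zero_of_one_le_re ψ₁ (.inl h₁) hs.le
    have n₂ := LFunction_ne_zero_of_one_le_re ψ₂ (.inl h₂) hs.le
    have n₃ := LFunction_ne_zero_of_one_le_re ψ₃ (.inl h₃) hs.le
    have hT : ∀ χ : DirichletCharacter ℂ Q, LSeries (T χ) s =
        -deriv (LFunction χ) s / LFunction χ s := by
      intro χ
      rw [LSeries_twist_vonMangoldt_eq χ hs, deriv_LFunction_eq_deriv_LSeries χ hs,
        LFunction_eq_LSeries χ hs]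
    have hL : LSeries h s = (-deriv riemannZeta s / riemannZeta s +
        -deriv (LFunction ψ₁) s / LFunction ψ₁ s)
        + (-deriv (LFunction ψ₂) s / LFunction ψ₂ s +
            -deriv (LFunction ψ₃) s / LFunction ψ₃ s) := by
      rw [LSeries_add ((LSeriesSummable_vonMangoldt hs).add
          (LSeriesSummable_twist_vonMangoldt ψ₁ hs))
        ((LSeriesSummable_twist_vonMangoldt ψ₂ hs).add (LSeriesSummable_twist_vonMangoldt ψ₃ hs)),
        LSeries_add (LSeriesSummable_vonMangoldt hs) (LSeriesSummable_twist_vonMangoldt ψ₁ hs),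
        LSeries_add (LSeriesSummable_twist_vonMangoldt ψ₂ hs)
            (LSeriesSummable_twist_vonMangoldt ψ₃ hs),
        hT, hT, hT, LSeries_vonMangoldt_eq_deriv_riemannZeta_div hs]
    have hd := ((hdiff s hs).hasDerivAt.mul
      ((((differentiable_LFunction h₁) s).hasDerivAt.mul
          ((differentiable_LFunction h₂) s).hasDerivAt).mul
        ((differentiable_LFunction h₃) s).hasDerivAt)).deriv
    have e : (fun s => riemannZeta s * siegelProduct ψ₁ ψ₂ s)
      = riemannZeta * ((LFunction ψ₁ * LFunction ψ₂) * LFunction ψ₃) := rfl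
    rw [e, hd, hL]
    simp only [Pi.mul_apply, siegelProduct, ← hψ₃]
    field_simp
    ring
  · obtain ⟨r, hr, e⟩ := one_eighth_le_zeta_mul_siegelProduct h₁ h₂ h₃ hs₁ hs₂
    rw [e]
    exact_mod_cast (by linarith : (0 : ℝ) ≤ r)

end

lemma exists_le_siegelProduct_one : ∃ c : ℝ, 0 < c ∧ ∀ (Q : ℕ) [NeZero Q]
    (ψ₁ ψ₂ : DirichletCharacter ℂ Q), ψ₁ ≠ 1 → ψ₂ ≠ 1 → ψ₁ * ψ₂ ≠ 1 → ψ₁ ^ 2 = 1 → ψ₂ ^ 2 = 1 →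
    ∀ β : ℝ, 7 / 8 < β → β < 1 → (riemannZeta β * siegelProduct ψ₁ ψ₂ β).re ≤ 0 →
    c * (1 - β) * (Q : ℝ) ^ (-(24 * (1 - β))) ≤ ‖siegelProduct ψ₁ ψ₂ 1‖ := by
  obtain ⟨Z, hZ⟩ := (isCompact_sphere (2 : ℂ) (4 / 3)).exists_bound_of_continuousOn
    differentiable_riemannZeta₀.continuous.continuousOn
  have hZ0 : 0 ≤ Z := (norm_nonneg _).trans (hZ (2 + (4 / 3 : ℝ)) (by simp))
  set C : ℝ := 112 * ((Z + 6) * 40 ^ 3) * Real.exp 2 with hC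
  have hC1 : 1 ≤ C := by
    have := Real.add_one_le_exp 2
    nlinarith
  refine ⟨1 / (16 * C), by positivity, ?_⟩
  intro Q _ ψ₁ ψ₂ h₁ h₂ h₃ hs₁ hs₂ β hβ hβ1 hF
  have hQ : (1 : ℝ) ≤ Q := by exact_mod_cast NeZero.one_le
  set P := siegelProduct ψ₁ ψ₂ with hP
  have hPd : Differentiable ℂ P := differentiable_siegelProduct h₁ h₂ h₃
  set W : ℂ → ℂ := fun s => riemannZeta₀ s * P s + dslope P 1 s with hW
  have hWd : Differentiable ℂ W := by
    refine (differentiable_riemannZeta₀.mul hPd).add ?_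
    rw [← differentiableOn_univ]
    exact (Complex.differentiableOn_dslope univ_mem).2 hPd.differentiableOn
  set lam := (P 1).re with hlam
  have hlamP : (lam : ℂ) = P 1 := by
    have := siegelProduct_ofReal h₁ h₂ h₃ hs₁ hs₂ 1
    rw [ofReal_one] at this
    rw [hlam, hP, this, ofReal_re]
  set B : ℝ := (Z + 6) * (40 * Q) ^ 3 with hB
  have hB1 : 1 ≤ 112 * B := by
    have : 1 ≤ (40 * (Q : ℝ)) ^ 3 := one_le_pow₀ (by linarith)
    nlinarith
  set k := ⌈Real.log (112 * B)⌉₊ with hk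
  have hWB : ∀ z ∈ Metric.sphere (2 : ℂ) (4 / 3), ‖W z‖ ≤ B := by
    intro z hz
    have hz' : ‖z - 2‖ = 4 / 3 := by simpa [dist_eq_norm] using hz
    have hre := (abs_re_le_norm (z - 2)).trans hz'.le
    have him := (abs_im_le_norm (z - 2)).trans hz'.le
    rw [sub_re, abs_le] at hre
    have hre2 : (2 : ℂ).re = 2 := rfl
    have him2 : (2 : ℂ).im = 0 := rfl
    rw [hre2] at hre
    rw [sub_im, him2, sub_zero] at him
    have hPz := siegelProduct_bound h₁ h₂ h₃ (z := z) (by linarith) him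
    have hP1 := siegelProduct_bound h₁ h₂ h₃ (z := 1) (by norm_num) (by norm_num)
    have hz1 : 1 / 3 ≤ ‖z - 1‖ := by
      have : z - 2 = (z - 1) - 1 := by ring
      have h4 := norm_sub_le (z - 1) 1
      rw [← this, hz', norm_one] at h4
      linarith
    have hne : z ≠ 1 := by rintro rfl; norm_num at hz1
    calc ‖W z‖ ≤ ‖riemannZeta₀ z * P z‖ + ‖dslope P 1 z‖ := norm_add_le _ _
      _ ≤ Z * (40 * Q) ^ 3 + 3 * ((40 * Q) ^ 3 + (40 * Q) ^ 3) := by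
          rw [norm_mul, dslope_of_ne _ hne, slope_def_field, norm_div]
          gcongr
          · exact hZ z hz
          · rw [div_le_iff₀ (by linarith)]
            calc ‖P z - P 1‖ ≤ (40 * Q) ^ 3 + (40 * Q) ^ 3 := (norm_sub_le _ _).trans (add_le_add hPz hP1)
              _ ≤ 3 * ((40 * Q) ^ 3 + (40 * Q) ^ 3) * (1 / 3) := by linarith
              _ ≤ _ := by gcongr
      _ = B := by rw [hB]; ring
  obtain ⟨r, hr, e⟩ := one_eighth_le_zeta_mul_siegelProduct h₁ h₂ h₃ hs₁ hs₂
  have hMB : 7 * B * (27 / 32) ^ (8 * k + 8) ≤ (1 / 8 : ℝ) / 2 := by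
    have e1 : (27 / 32 : ℝ) ^ 8 ≤ Real.exp (-1) := by
      rw [Real.exp_neg, le_inv_comm₀ (by positivity) (by positivity)]
      have := Real.exp_one_lt_d9
      norm_num
      linarith
    have e2 : (27 / 32 : ℝ) ^ (8 * k + 8) ≤ (112 * B)⁻¹ := by
      calc (27 / 32 : ℝ) ^ (8 * k + 8) = ((27 / 32) ^ 8) ^ (k + 1) := by rw [← pow_mul]; ring_nf
        _ ≤ Real.exp (-1) ^ (k + 1) := by gcongr
        _ = Real.exp (-((k + 1 : ℕ) : ℝ)) := by rw [← Real.exp_nat_mul]; ring_nf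
        _ ≤ Real.exp (-Real.log (112 * B)) := by
          gcongr
          push_cast
          exact (Nat.le_ceil _).trans (by linarith)
        _ = _ := by rw [Real.exp_neg, Real.exp_log (by linarith)]
    calc 7 * B * (27 / 32) ^ (8 * k + 8) ≤ 7 * B * (112 * B)⁻¹ := by gcongr
      _ = _ := by
        have : B ≠ 0 := by rintro h; rw [h] at hB1; norm_num at hB1
        field_simp; norm_num
  have hfin := residue_lower_bound (F := fun s => riemannZeta s * P s) (lam := lam) (c := 1 / 8) hWd
    (fun s hs => by
      simp only [hW]
      rw [dslope_of_ne _ hs, slope_def_field, riemannZeta_eq_inv_sub_add hs, hlamP]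
      ring)
    (zeta_mul_siegelProduct_alternating h₁ h₂ h₃ hs₁ hs₂)
    (by simp only [hP]; rw [e, ofReal_re]; exact hr) hWB hβ hβ1 hF (by omega) hMB
  have hpow : (2 - β) ^ (8 * k + 8) ≤ C * (Q : ℝ) ^ (24 * (1 - β)) := by
    have hkle : (k : ℝ) ≤ Real.log (112 * B) + 1 := (Nat.ceil_lt_add_one (Real.log_nonneg hB1)).le
    have hx : 0 ≤ 8 * (1 - β) := by linarith
    have hCB : C * (Q : ℝ) ^ 3 = 112 * B * Real.exp 2 := by rw [hC, hB]; ring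
    calc (2 - β) ^ (8 * k + 8) ≤ Real.exp (1 - β) ^ (8 * k + 8) := by
          gcongr
          · linarith
          · linarith [Real.add_one_le_exp (1 - β)]
      _ = Real.exp (8 * (1 - β) * (k + 1)) := by
          rw [← Real.exp_nat_mul]; push_cast; ring_nf
      _ ≤ Real.exp (8 * (1 - β) * (Real.log (112 * B) + 2)) := 
          Real.exp_le_exp.2 (mul_le_mul_of_nonneg_left (by linarith) hx)
      _ = (C * (Q : ℝ) ^ 3) ^ (8 * (1 - β)) := by
          rw [hCB, Real.rpow_def_of_pos (by positivity),
            Real.log_mul (x := 112 * B) (by positivity) (by positivity), Real.log_exp, mul_comm]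
      _ = C ^ (8 * (1 - β)) * (Q : ℝ) ^ (24 * (1 - β)) := by
          rw [Real.mul_rpow (by positivity) (by positivity), ← Real.rpow_natCast,
            ← Real.rpow_mul (by positivity)]
          congr 2
          push_cast; ring
      _ ≤ C ^ (1 : ℝ) * (Q : ℝ) ^ (24 * (1 - β)) := by
          gcongr
          linarith
      _ = _ := by rw [Real.rpow_one]
  have hlam0 : 0 < lam := by
    by_contra hneg
    push Not at hneg
    have : 0 ≤ (2 - β) ^ (8 * k + 8) := pow_nonneg (by linarith) _
    nlinarith
  rw [← hlamP, norm_real, Real.norm_eq_abs, abs_of_pos hlam0, Real.rpow_neg (by positivity)]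
  have hQp : 0 < (Q : ℝ) ^ (24 * (1 - β)) := by positivity
  have := hfin.trans (mul_le_mul_of_nonneg_left hpow hlam0.le)
  rw [← div_eq_mul_inv, div_le_iff₀ hQp, mul_comm, mul_one_div, div_le_iff₀ (by positivity)]
  nlinarith

end SiegelWalfisz

namespace SiegelWalfisz
open Complex Set Filter Topology DirichletCharacter

lemma exists_re_riemannZeta_nonpos {κ : ℝ} (hκ : 0 < κ) :
    ∃ β : ℝ, 1 - κ < β ∧ β < 1 ∧ (riemannZeta β).re ≤ 0 := by
  have h1 : Tendsto (fun x : ℝ => (x : ℂ)) (𝓝[<] 1) (𝓝[≠] 1) := by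
    refine tendsto_nhdsWithin_iff.2 ⟨?_, ?_⟩
    · have := (continuous_ofReal.tendsto (1 : ℝ))
      rw [ofReal_one] at this
      exact this.mono_left nhdsWithin_le_nhds
    · filter_upwards [self_mem_nhdsWithin] with x (hx : x < 1)
      simpa using hx.ne
  have h2 := (continuous_re.tendsto _).comp (riemannZeta_residue_one.comp h1)
  have h3 := h2.eventually_const_lt (u := 0) (by simp)
  have h4 : ∀ᶠ x : ℝ in 𝓝[<] 1, x ∈ Ioo (1 - κ) 1 := Ioo_mem_nhdsLT (by linarith)
  obtain ⟨β, hβ, hβm⟩ := (h3.and h4).exists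
  refine ⟨β, hβm.1, hβm.2, ?_⟩
  have e : (((β : ℂ) - 1) * riemannZeta β).re = (β - 1) * (riemannZeta β).re := by
    simp [mul_re]
  simp only [Function.comp] at hβ
  rw [e] at hβ
  by_contra hneg
  push Not at hneg
  have := hβm.2
  nlinarith

lemma exists_quadratic_character : ∃ χ : DirichletCharacter ℂ 4, χ ≠ 1 ∧ χ ^ 2 = 1 := by
  refine ⟨ZMod.χ₄.ringHomComp (Int.castRingHom ℂ), ?_, ?_⟩
  · intro h
    have h3 : IsUnit (3 : ZMod 4) := by decide
    have := congrArg (fun f : MulChar (ZMod 4) ℂ => f 3) h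
    simp only [MulChar.one_apply h3, MulChar.ringHomComp_apply] at this
    rw [show ZMod.χ₄ 3 = -1 by decide] at this
    norm_num at this
  · exact (ZMod.isQuadratic_χ₄.comp _).sq_eq_one

/-- A reference character and a point just below `1` at which the auxiliary function of Siegel's
argument is nonpositive, whatever the second character is. -/
lemma exists_siegel_reference {κ : ℝ} (hκ : 0 < κ) :
    ∃ q₁ : ℕ, ∃ _ : NeZero q₁, ∃ χ₁ : DirichletCharacter ℂ q₁, ∃ β : ℝ, χ₁ ≠ 1 ∧ χ₁ ^ 2 = 1 ∧
      1 - κ < β ∧ β < 1 ∧ ∀ (Q : ℕ) [NeZero Q] (hQ : q₁ ∣ Q) (ψ : DirichletCharacter ℂ Q),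
        ψ ≠ 1 → ψ ^ 2 = 1 → changeLevel hQ χ₁ * ψ ≠ 1 →
        (riemannZeta β * siegelProduct (changeLevel hQ χ₁) ψ β).re ≤ 0 := by
  by_cases hex : ∃ q₁ : ℕ, ∃ _ : NeZero q₁, ∃ χ₁ : DirichletCharacter ℂ q₁, ∃ β : ℝ, χ₁ ≠ 1 ∧
      χ₁ ^ 2 = 1 ∧ 1 - κ < β ∧ β < 1 ∧ LFunction χ₁ β = 0
  · obtain ⟨q₁, hq₁, χ₁, β, h1, h2, hβ, hβ1, h0⟩ := hex
    refine ⟨q₁, hq₁, χ₁, β, h1, h2, hβ, hβ1, fun Q _ hQ ψ _ _ _ => ?_⟩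
    rw [siegelProduct, LFunction_changeLevel hQ χ₁ (.inl h1), h0]
    simp
  · obtain ⟨β, hβ, hβ1, hz⟩ := exists_re_riemannZeta_nonpos hκ
    obtain ⟨χ₁, h1, h2⟩ := exists_quadratic_character
    refine ⟨4, inferInstance, χ₁, β, h1, h2, hβ, hβ1, fun Q _ hQ ψ hψ1 hψ2 h3 => ?_⟩
    have hpos : ∀ χ : DirichletCharacter ℂ Q, χ ≠ 1 → χ ^ 2 = 1 → 0 ≤ (LFunction χ β).re := by
      intro χ hχ hχ2
      refine (re_LFunction_pos hχ hχ2 (b := 1 - κ) (by linarith) (fun x hx h0 => ?_) hβ).le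
      rcases lt_or_ge x 1 with hx1 | hx1
      · exact hex ⟨Q, inferInstance, χ, x, hχ, hχ2, hx, hx1, h0⟩
      · exact LFunction_ne_zero_of_one_le_re χ (.inl hχ) (by simpa using hx1) h0
    have hc1 : changeLevel hQ χ₁ ≠ 1 := fun h => h1 ((changeLevel_eq_one_iff hQ).1 h)
    have hc2 : changeLevel hQ χ₁ ^ 2 = 1 := by rw [← map_pow, h2, map_one]
    rw [siegelProduct_ofReal hc1 hψ1 h3 hc2 hψ2, re_mul_ofReal]
    exact mul_nonpos_of_nonpos_of_nonneg hz
      (mul_nonneg (mul_nonneg (hpos _ hc1 hc2) (hpos _ hψ1 hψ2))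
          (hpos _ h3 (mul_sq_eq_one hc2 hψ2)))

lemma norm_LFunction_one_le {Q : ℕ} [NeZero Q] {χ : DirichletCharacter ℂ Q} (hχ : χ ≠ 1) {κ : ℝ}
    (hκ : 0 < κ) (hκ1 : κ ≤ 1) : ‖LFunction χ 1‖ ≤ (12 + 8 / κ) * (Q : ℝ) ^ κ := by
  have h := norm_LFunction_le (Φ := χ) (MulChar.sum_eq_zero_of_ne_one hχ)
    (fun j => χ.norm_le_one j) (δ := κ / 2) (by linarith) (by linarith) (s := 1)
    (by simp; linarith) (by norm_num)
  refine h.trans ?_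
  have e : (2 : ℝ) ^ κ ≤ 2 := by
    calc (2 : ℝ) ^ κ ≤ 2 ^ (1 : ℝ) := Real.rpow_le_rpow_of_exponent_le (by norm_num) hκ1
      _ = 2 := Real.rpow_one 2
  rw [one_im, abs_zero, zero_add, show 2 * (κ / 2) = κ by ring,
    Real.mul_rpow (by positivity) (by norm_num)]
  calc (6 + 2 / (κ / 2)) * ((Q : ℝ) ^ κ * 2 ^ κ) ≤ (6 + 2 / (κ / 2)) *
      ((Q : ℝ) ^ κ * 2) := by gcongr
    _ = _ := by field_simp; ring

/-- **Siegel's theorem** on `L(1, χ)` for quadratic characters. -/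
theorem siegel {ε : ℝ} (hε : 0 < ε) : ∃ c : ℝ, 0 < c ∧ ∀ (q : ℕ) [NeZero q]
    (χ : DirichletCharacter ℂ q), χ ≠ 1 → χ ^ 2 = 1 → c * (q : ℝ) ^ (-ε) ≤ ‖LFunction χ 1‖ := by
  obtain ⟨κ, hκ, hκε, hκ1⟩ : ∃ κ : ℝ, 0 < κ ∧ 27 * κ ≤ ε ∧ κ ≤ 1 / 8 :=
    ⟨min (ε / 27) (1 / 8), by positivity,
      by linarith [min_le_left (ε / 27) (1 / 8)], min_le_right _ _⟩
  obtain ⟨c₀, hc₀, hres⟩ := exists_le_siegelProduct_one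
  obtain ⟨q₁, hq₁, χ₁, β, h1, h2, hβ, hβ1, hF⟩ := exists_siegel_reference hκ
  have hL1 : 0 < ‖LFunction χ₁ 1‖ := norm_pos_iff.2 (LFunction_apply_one_ne_zero h1)
  set D : ℝ := 12 + 8 / κ with hD
  set E : ℝ := 1 + 2 / κ with hE
  have hD0 : 0 < D := by positivity
  have hE0 : 0 < E := by positivity
  have hb : 0 < 1 - β := by linarith
  have hq₁1 : (1 : ℝ) ≤ q₁ := by exact_mod_cast NeZero.one_le
  refine ⟨min (c₀ * (1 - β) / (D ^ 2 * E)) (‖LFunction χ₁ 1‖ / E ^ 2) * (q₁ : ℝ) ^ (-(27 * κ)),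
    by positivity, fun q _ χ hχ hχ2 => ?_⟩
  have hq1 : (1 : ℝ) ≤ q := by exact_mod_cast NeZero.one_le
  have hQne : NeZero (q₁ * q) := ⟨mul_ne_zero (NeZero.ne _) (NeZero.ne _)⟩
  set Q := q₁ * q with hQ
  have hd₁ : q₁ ∣ Q := dvd_mul_right _ _
  have hd₂ : q ∣ Q := dvd_mul_left _ _
  have hQ1 : (1 : ℝ) ≤ Q := by exact_mod_cast NeZero.one_le
  set m := min (c₀ * (1 - β) / (D ^ 2 * E)) (‖LFunction χ₁ 1‖ / E ^ 2) with hm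
  have hm0 : 0 < m := by positivity
  suffices hmain : m * (Q : ℝ) ^ (-(27 * κ)) ≤ ‖LFunction χ 1‖ by
    refine le_trans ?_ hmain
    rw [hQ, Nat.cast_mul, Real.mul_rpow (by positivity) (by positivity), mul_assoc]
    gcongr
  set ψ₁ := changeLevel hd₁ χ₁ with hψ₁
  set ψ₂ := changeLevel hd₂ χ with hψ₂
  have n1 : ψ₁ ≠ 1 := fun h => h1 ((changeLevel_eq_one_iff hd₁).1 h)
  have n2 : ψ₂ ≠ 1 := fun h => hχ ((changeLevel_eq_one_iff hd₂).1 h)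
  have s1 : ψ₁ ^ 2 = 1 := by rw [hψ₁, ← map_pow, h2, map_one]
  have s2 : ψ₂ ^ 2 = 1 := by rw [hψ₂, ← map_pow, hχ2, map_one]
  have hω := card_primeFactors_add_one_le (n := Q) (NeZero.ne _) hκ
  rw [← hE] at hω
  have hω0 : (0 : ℝ) < Q.primeFactors.card + 1 := by positivity
  set N := ‖LFunction χ 1‖ with hN
  have hψ₂N : ‖LFunction ψ₂ 1‖ ≤ N * (E * (Q : ℝ) ^ κ) := by
    rw [hψ₂, LFunction_changeLevel hd₂ χ (.inl hχ), norm_mul]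
    gcongr
    exact (norm_prod_euler_le χ Q).trans hω
  have hQκ : 0 < (Q : ℝ) ^ κ := by positivity
  by_cases h3 : ψ₁ * ψ₂ = 1
  · have heq : ψ₁ = ψ₂ := by
      have : ψ₁ * ψ₂ = ψ₁ * ψ₁ := by rw [h3, ← sq, s1]
      exact (mul_left_cancel this).symm
    have hlow : ‖LFunction χ₁ 1‖ ≤ ‖LFunction ψ₁ 1‖ * (E * (Q : ℝ) ^ κ) := by
      rw [hψ₁, LFunction_changeLevel hd₁ χ₁ (.inl h1), norm_mul, mul_assoc]
      refine le_mul_of_one_le_right (norm_nonneg _) ?_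
      calc (1 : ℝ) = ((Q.primeFactors.card : ℝ) + 1)⁻¹ * (Q.primeFactors.card + 1) :=
            (inv_mul_cancel₀ hω0.ne').symm
        _ ≤ _ := by gcongr; exact le_norm_prod_euler χ₁ Q
    rw [heq] at hlow
    have h4 : ‖LFunction χ₁ 1‖ ≤ N * (E ^ 2 * (Q : ℝ) ^ (2 * κ)) := by
      rw [two_mul κ, Real.rpow_add (by positivity)]
      calc _ ≤ N * (E * (Q : ℝ) ^ κ) * (E * (Q : ℝ) ^ κ) := hlow.trans (by gcongr)
        _ = _ := by ring
    calc m * (Q : ℝ) ^ (-(27 * κ)) ≤ ‖LFunction χ₁ 1‖ / E ^ 2 * (Q : ℝ) ^ (-(2 * κ)) := by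
          gcongr
          · exact min_le_right _ _
          · norm_num
      _ ≤ N := by
          rw [Real.rpow_neg (by positivity), ← div_eq_mul_inv, div_div, div_le_iff₀ (by positivity)]
          exact h4
  · have h4 := hres Q ψ₁ ψ₂ n1 n2 h3 s1 s2 β (by linarith) hβ1 (hF Q hd₁ ψ₂ n2 s2 h3)
    rw [siegelProduct, norm_mul, norm_mul] at h4
    have b1 := norm_LFunction_one_le n1 hκ (by linarith)
    have b3 := norm_LFunction_one_le h3 hκ (by linarith)
    have h5 : c₀ * (1 - β) * (Q : ℝ) ^ (-(24 * κ)) ≤ N * (D ^ 2 * E * (Q : ℝ) ^ (3 * κ)) := by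
      calc c₀ * (1 - β) * (Q : ℝ) ^ (-(24 * κ)) ≤ c₀ * (1 - β) * (Q : ℝ) ^ (-(24 * (1 - β))) := by
            gcongr
            linarith
        _ ≤ D * (Q : ℝ) ^ κ * (N * (E * (Q : ℝ) ^ κ)) * (D * (Q : ℝ) ^ κ) := h4.trans (by gcongr)
        _ = N * (D ^ 2 * E * ((Q : ℝ) ^ κ) ^ 3) := by ring
        _ = _ := by
            rw [← Real.rpow_natCast (_ ^ κ), ← Real.rpow_mul (by positivity), mul_comm κ]; norm_num
    calc m * (Q : ℝ) ^ (-(27 * κ)) ≤ c₀ * (1 - β) / (D ^ 2 * E) * (Q : ℝ) ^ (-(27 * κ)) := by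
          gcongr
          exact min_le_left _ _
      _ = c₀ * (1 - β) * (Q : ℝ) ^ (-(24 * κ)) / (D ^ 2 * E * (Q : ℝ) ^ (3 * κ)) := by
          rw [show -(27 * κ) = -(24 * κ) - 3 * κ by ring, Real.rpow_sub (by positivity)]
          field_simp
      _ ≤ N := by rw [div_le_iff₀ (by positivity)]; exact h5

end SiegelWalfisz

namespace SiegelWalfisz
open Complex Set Filter Topology DirichletCharacter

section
variable {q : ℕ} [NeZero q]

lemma two_le_conductor_size (q : ℕ) [NeZero q] (y : ℝ) : (2 : ℝ) ≤ q * (|y| + 2) := by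
  have hq : (1 : ℝ) ≤ q := by exact_mod_cast NeZero.one_le
  nlinarith [abs_nonneg y]

lemma le_norm_LFunction_of_three_four_one {χ : DirichletCharacter ℂ q} (hχ : χ ≠ 1) {η C x y : ℝ}
    (hη : 0 < η) (hη1 : η ≤ 1) (hC : 1 ≤ C) (hx : x ∈ Ioc (0 : ℝ) 1)
    (h2 : ∀ x ∈ Ioc (0 : ℝ) 1,
      ‖LFunction (χ ^ 2) (1 + x + 2 * I * y)‖ ≤ C * ((q : ℝ) * (|y| + 2)) ^ (3 * η))
    (hCη : 4 * (12 + 8 / η) / (η / 2) ≤ C) :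
    (16 * (8 * C) ^ 7)⁻¹ * ((q : ℝ) * (|y| + 2)) ^ (-(21 * η)) ≤ ‖LFunction χ (1 + x + I * y)‖ := by
  have hτ := two_le_conductor_size q y
  set τ := (q : ℝ) * (|y| + 2) with hτd
  have hτη : 1 ≤ τ ^ (3 * η) := Real.one_le_rpow (by linarith) (by positivity)
  have h := lower_of_three_four_one χ (y := y) (M := C * τ ^ (3 * η)) (by nlinarith) h2
    (fun x _ => differentiable_LFunction hχ _) (fun x hx => ?_) hx
  · refine le_trans (le_of_eq ?_) h
    have e : τ ^ (21 * η) = (τ ^ (3 * η)) ^ 7 := by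
      rw [← Real.rpow_natCast, ← Real.rpow_mul (by positivity)]; norm_num; ring_nf
    rw [one_div, Real.rpow_neg (by positivity), ← mul_inv, e]
    ring
  · refine (norm_deriv_LFunction_le hχ (δ := η / 2) (by linarith) (by linarith)
      (by simpa using hx.1) (by simp; linarith [hx.2])).trans ?_
    have e : ((1 : ℂ) + x + I * y).im = y := by simp
    rw [e, ← hτd, show 2 * (η / 2) = η by ring]
    calc 4 * ((12 + 4 / (η / 2)) * τ ^ η) / (η / 2) = 4 * (12 + 8 / η) / (η / 2) * τ ^ η := by
          field_simp; ring
      _ ≤ C * τ ^ (3 * η) := by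
          gcongr
          · linarith
          · linarith

end

/-- Lower bound for Dirichlet `L`-functions just to the right of the line `re s = 1`. -/
theorem exists_le_norm_LFunction {ε : ℝ} (hε : 0 < ε) : ∃ c : ℝ, 0 < c ∧ ∀ (q : ℕ) [NeZero q]
    (χ : DirichletCharacter ℂ q), χ ≠ 1 → ∀ s : ℂ, 1 < s.re → s.re ≤ 2 →
    c * ((q : ℝ) * (|s.im| + 2)) ^ (-ε) ≤ ‖LFunction χ s‖ := by
  obtain ⟨η, hη, hηε, hη1⟩ : ∃ η : ℝ, 0 < η ∧ 21 * η ≤ ε ∧ η ≤ 1 :=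
    ⟨min (ε / 21) 1, by positivity, by linarith [min_le_left (ε / 21) 1], min_le_right _ _⟩
  obtain ⟨c₁, hc₁, hS⟩ := siegel hη
  set C₀ : ℝ := 4 * (12 + 8 / η) / (η / 2) with hC₀
  have hC₀1 : 24 + 16 / η ≤ C₀ := by
    rw [hC₀, le_div_iff₀ (by positivity)]
    have h0 : 0 < 8 / η := by positivity
    have h1 : 16 / η * η = 16 := by field_simp
    nlinarith
  have h16 : 0 < 16 / η := by positivity
  set κ : ℝ := c₁ / (4 * C₀) with hκ
  have hκ0 : 0 < κ := by positivity
  set C : ℝ := C₀ * (1 + 1 / κ) with hC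
  have hCC₀ : C₀ ≤ C := by
    rw [hC]; exact le_mul_of_one_le_right (by linarith) (by linarith [one_div_pos.2 hκ0])
  refine ⟨min (min (κ / 2) (c₁ / 2)) (16 * (8 * C) ^ 7)⁻¹, by positivity, ?_⟩
  intro q _ χ hχ s hs1 hs2
  have hq : (1 : ℝ) ≤ q := by exact_mod_cast NeZero.one_le
  obtain ⟨x, y, rfl⟩ : ∃ x y : ℝ, s = 1 + x + I * y := ⟨s.re - 1, s.im, by
    apply Complex.ext <;> simp⟩
  have him : ((1 : ℂ) + x + I * y).im = y := by simp
  have hre : ((1 : ℂ) + x + I * y).re = 1 + x := by simp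
  rw [hre] at hs1 hs2
  rw [him]
  have hx : x ∈ Ioc (0 : ℝ) 1 := ⟨by linarith, by linarith⟩
  have hτ := two_le_conductor_size q y
  set τ := (q : ℝ) * (|y| + 2) with hτd
  have hτ1 : 1 ≤ τ := by linarith
  set m := min (min (κ / 2) (c₁ / 2)) (16 * (8 * C) ^ 7)⁻¹ with hm
  have hm0 : 0 < m := by positivity
  have hmκ : m ≤ κ / 2 := (min_le_left _ _).trans (min_le_left _ _)
  have hmc : m ≤ c₁ / 2 := (min_le_left _ _).trans (min_le_right _ _)
  have hmC : m ≤ (16 * (8 * C) ^ 7)⁻¹ := min_le_right _ _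
  have hdouble : ((q : ℝ) * (|2 * y| + 2)) ^ η ≤ 2 * τ ^ η := by
    calc ((q : ℝ) * (|2 * y| + 2)) ^ η ≤ (2 * τ) ^ η := by
          refine Real.rpow_le_rpow (by positivity) ?_ hη.le
          rw [abs_mul, abs_two, hτd]
          nlinarith [abs_nonneg y]
      _ = 2 ^ η * τ ^ η := Real.mul_rpow (by norm_num) (by positivity)
      _ ≤ 2 ^ (1 : ℝ) * τ ^ η := by gcongr; norm_num
      _ = _ := by rw [Real.rpow_one]
  have h341 : (∀ x ∈ Ioc (0 : ℝ) 1, ‖LFunction (χ ^ 2) (1 + x + 2 * I * y)‖ ≤ C * τ ^ (3 * η)) →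
      m * τ ^ (-ε) ≤ ‖LFunction χ (1 + x + I * y)‖ := by
    intro h
    refine le_trans ?_ (le_norm_LFunction_of_three_four_one hχ hη hη1 (by linarith) hx h hCC₀)
    gcongr
  have him2 : ∀ x : ℝ, ((1 : ℂ) + x + 2 * I * y).im = 2 * y := fun x => by simp
  have hre2 : ∀ x : ℝ, ((1 : ℂ) + x + 2 * I * y).re = 1 + x := fun x => by simp
  by_cases hχ2 : χ ^ 2 = 1
  swap
  · refine h341 fun x hx => ?_
    refine (norm_LFunction_le_ball hχ2 (δ := η / 2) (by linarith) (by linarith)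
      (s := 1 + x + 2 * I * y) (by rw [hre2]; linarith [hx.1]) (by rw [hre2]; linarith [hx.2])
      (Metric.mem_ball_self (by linarith))).trans ?_
    rw [him2, show 2 * (η / 2) = η by ring]
    calc (12 + 4 / (η / 2)) * ((q : ℝ) * (|2 * y| + 2)) ^ η ≤ (12 + 4 / (η / 2)) * (2 * τ ^ η) := by
          gcongr
      _ = (24 + 16 / η) * τ ^ η := by field_simp; ring
      _ ≤ C * τ ^ (3 * η) := by
          gcongr
          · linarith
          · linarith
  by_cases hy : κ * τ ^ (-(2 * η)) ≤ |y|
  · refine h341 fun x hx => ?_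
    have hy0 : 0 < |y| := lt_of_lt_of_le (by positivity) hy
    have hyn : y ≠ 0 := abs_pos.1 hy0
    rw [hχ2]
    refine (norm_LFunctionTrivChar_le (δ := η / 2) (by linarith) (by linarith)
        (by rw [hre2]; linarith [hx.1])
      (by rw [hre2]; linarith [hx.2]) (by rw [him2]; simpa using hyn)).trans ?_
    rw [him2, show 2 * (η / 2) = η by ring]
    have h1 : 1 + 1 / |2 * y| ≤ (1 + 1 / κ) * τ ^ (2 * η) := by
      have e1 : 1 ≤ τ ^ (2 * η) := Real.one_le_rpow hτ1 (by positivity)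
      have e2 : 1 / |2 * y| ≤ 1 / κ * τ ^ (2 * η) := by
        rw [abs_mul, abs_two, div_le_iff₀ (by positivity)]
        rw [Real.rpow_neg (by positivity), ← div_eq_mul_inv, div_le_iff₀ (by positivity)] at hy
        rw [div_mul_eq_mul_div, one_mul, div_mul_eq_mul_div, le_div_iff₀ hκ0]
        nlinarith
      linarith
    calc (12 + 4 / (η / 2)) * (1 + 1 / |2 * y|) * ((q : ℝ) * (|2 * y| + 2)) ^ η
        ≤ (12 + 4 / (η / 2)) * ((1 + 1 / κ) * τ ^ (2 * η)) * (2 * τ ^ η) := by gcongr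
      _ = (24 + 16 / η) * (1 + 1 / κ) * (τ ^ (2 * η) * τ ^ η) := by field_simp; ring
      _ ≤ C₀ * (1 + 1 / κ) * (τ ^ (2 * η) * τ ^ η) := by gcongr
      _ = C * τ ^ (3 * η) := by rw [← Real.rpow_add (by positivity), hC]; ring_nf
  push Not at hy
  by_cases hxκ : κ * τ ^ (-(2 * η)) ≤ x
  · refine le_trans ?_ (le_norm_LFunction_of_one_lt χ (by rw [hre]; linarith))
    rw [hre, le_div_iff₀ (by linarith)]
    have e : τ ^ (-ε) ≤ τ ^ (-(2 * η)) := Real.rpow_le_rpow_of_exponent_le hτ1 (by linarith)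
    have e' : 0 < τ ^ (-ε) := by positivity
    calc m * τ ^ (-ε) * (1 + x) ≤ κ / 2 * τ ^ (-(2 * η)) * 2 := by gcongr
      _ ≤ _ := by linarith
  push Not at hxκ
  have hconv : Convex ℝ (Icc (1 : ℝ) 2 ×ℂ Icc (-|y|) |y|) := 
    ((convex_Icc 1 2).linear_preimage Complex.reLm).inter
      ((convex_Icc (-|y|) |y|).linear_preimage Complex.imLm)
  have hlip := norm_sub_le_of_deriv (f := LFunction χ) (M := C₀ * τ ^ η) hconv
    (fun z _ => differentiable_LFunction hχ z) (fun z hz => ?_)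
    (z := 1 + x + I * y) (w := 1) ?_ ?_
  · have hn : ‖(1 : ℂ) - (1 + x + I * y)‖ ≤ 2 * (κ * τ ^ (-(2 * η))) := by
      calc ‖(1 : ℂ) - (1 + x + I * y)‖ = ‖(x : ℂ) + I * y‖ := by rw [← norm_neg]; ring_nf
        _ ≤ ‖(x : ℂ)‖ + ‖I * y‖ := norm_add_le _ _
        _ = |x| + |y| := by simp
        _ ≤ _ := by rw [abs_of_pos hx.1]; linarith
    have hS' := hS q χ hχ hχ2
    have hqτ : τ ^ (-η) ≤ (q : ℝ) ^ (-η) := by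
      refine Real.rpow_le_rpow_of_nonpos (by linarith) ?_ (by linarith)
      rw [hτd]; nlinarith [abs_nonneg y]
    have hb : C₀ * τ ^ η * ‖(1 : ℂ) - (1 + x + I * y)‖ ≤ c₁ / 2 * τ ^ (-η) := by
      calc C₀ * τ ^ η * ‖(1 : ℂ) - (1 + x + I * y)‖ ≤ C₀ * τ ^ η *
          (2 * (κ * τ ^ (-(2 * η)))) := by gcongr
        _ = 2 * C₀ * κ * (τ ^ η * τ ^ (-(2 * η))) := by ring
        _ = c₁ / 2 * τ ^ (-η) := by
          have e : 2 * C₀ * κ = c₁ / 2 := by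
            have : C₀ ≠ 0 := by linarith
            rw [hκ]; field_simp; ring
          rw [← Real.rpow_add (by positivity), e, show η + -(2 * η) = -η by ring]
    have e1 : c₁ * τ ^ (-η) ≤ c₁ * (q : ℝ) ^ (-η) := by gcongr
    calc m * τ ^ (-ε) ≤ c₁ / 2 * τ ^ (-η) := by
          gcongr
          linarith
      _ ≤ _ := by linarith
  · refine (norm_deriv_LFunction_le hχ (δ := η / 2) (by linarith)
        (by linarith) hz.1.1 hz.1.2).trans ?_
    rw [show 2 * (η / 2) = η by ring]
    have hzi : |z.im| ≤ |y| := abs_le.2 hz.2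
    calc 4 * ((12 + 4 / (η / 2)) * ((q : ℝ) * (|z.im| + 2)) ^ η) / (η / 2)
        = C₀ * ((q : ℝ) * (|z.im| + 2)) ^ η := by rw [hC₀]; field_simp; ring
      _ ≤ C₀ * τ ^ η := by rw [hτd]; gcongr
  · rw [mem_reProdIm, him, hre]
    exact ⟨⟨hs1.le, hs2⟩, neg_abs_le y, le_abs_self y⟩
  · rw [mem_reProdIm]
    simp

end SiegelWalfisz

namespace SiegelWalfisz
open Complex Set Filter Topology DirichletCharacter

lemma exists_le_norm_riemannZeta {ε : ℝ} (hε : 0 < ε) : ∃ c : ℝ, 0 < c ∧ ∀ s : ℂ, 1 < s.re →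
    s.re ≤ 2 → 1 ≤ |s.im| → c * (|s.im| + 2) ^ (-ε) ≤ ‖riemannZeta s‖ := by
  obtain ⟨η, hη, hηε, hη1⟩ : ∃ η : ℝ, 0 < η ∧ 7 * η ≤ ε ∧ η ≤ 1 :=
    ⟨min (ε / 7) 1, by positivity, by linarith [min_le_left (ε / 7) 1], min_le_right _ _⟩
  set C : ℝ := 2 * (4 * (36 + 24 / η) / (η / 2)) with hC
  have hC1 : 2 * (36 + 24 / η) ≤ C := by
    have : 36 + 24 / η ≤ 4 * (36 + 24 / η) / (η / 2) := by
      rw [le_div_iff₀ (by positivity)]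
      have h1 : 24 / η * η = 24 := by field_simp
      have h0 : 0 < 24 / η := by positivity
      nlinarith
    linarith
  have h24 : 0 < 24 / η := by positivity
  refine ⟨(16 * (8 * C) ^ 7)⁻¹, by positivity, fun s hs1 hs2 him => ?_⟩
  obtain ⟨x, y, rfl⟩ : ∃ x y : ℝ, s = 1 + x + I * y := ⟨s.re - 1, s.im, by
    apply Complex.ext <;> simp⟩
  have hi : ((1 : ℂ) + x + I * y).im = y := by simp
  have hre : ((1 : ℂ) + x + I * y).re = 1 + x := by simp
  rw [hre] at hs1 hs2
  rw [hi] at him ⊢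
  set τ := |y| + 2 with hτ
  have hτ1 : 1 ≤ τ := by linarith
  have hτη : 1 ≤ τ ^ η := Real.one_le_rpow hτ1 hη.le
  have h := lower_of_three_four_one (q := 1) 1 (y := y) (M := C * τ ^ η) (by nlinarith)
    (fun x hx => ?_) (fun x _ => ?_) (fun x hx => ?_) (x := x) ⟨by linarith, by linarith⟩
  · rw [LFunction_modOne_eq] at h
    refine le_trans ?_ h
    have e : (τ ^ η) ^ 7 = τ ^ (7 * η) := by
      rw [← Real.rpow_natCast, ← Real.rpow_mul (by positivity)]; norm_num; ring_nf
    have e2 : 1 / (16 * (8 * (C * τ ^ η)) ^ 7) = (16 * (8 * C) ^ 7)⁻¹ * τ ^ (-(7 * η)) := by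
      rw [Real.rpow_neg (by positivity), ← e, one_div, ← mul_inv]
      ring
    rw [e2]
    exact mul_le_mul_of_nonneg_left (Real.rpow_le_rpow_of_exponent_le hτ1 (by linarith))
      (by positivity)
  · rw [LFunction_modOne_eq]
    have hi2 : ((1 : ℂ) + x + 2 * I * y).im = 2 * y := by simp
    have hre2 : ((1 : ℂ) + x + 2 * I * y).re = 1 + x := by simp
    refine (norm_riemannZeta_le_ball (δ := η / 2) (by linarith) (by linarith)
      (s := 1 + x + 2 * I * y) (by rw [hre2]; linarith [hx.1]) (by rw [hre2]; linarith [hx.2])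
      (by rw [hi2, abs_mul, abs_two]; linarith) (Metric.mem_ball_self (by linarith))).trans ?_
    rw [hi2, show 2 * (η / 2) = η by ring]
    have hd : (|2 * y| + 2) ^ η ≤ 2 * τ ^ η := by
      calc (|2 * y| + 2) ^ η ≤ (2 * τ) ^ η := by
            refine Real.rpow_le_rpow (by positivity) ?_ hη.le
            rw [abs_mul, abs_two, hτ]; linarith
        _ = 2 ^ η * τ ^ η := Real.mul_rpow (by norm_num) (by positivity)
        _ ≤ 2 ^ (1 : ℝ) * τ ^ η := by gcongr; norm_num
        _ = _ := by rw [Real.rpow_one]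
    calc (36 + 12 / (η / 2)) * (|2 * y| + 2) ^ η ≤ (36 + 12 / (η / 2)) * (2 * τ ^ η) := by gcongr
      _ = 2 * (36 + 24 / η) * τ ^ η := by field_simp; ring
      _ ≤ C * τ ^ η := by gcongr
  · rw [LFunction_modOne_eq]
    refine differentiableAt_riemannZeta fun h => ?_
    have := congrArg im h
    simp only [add_im, one_im, ofReal_im, mul_im, I_re, I_im, ofReal_re] at this
    have hy : y = 0 := by linarith
    rw [hy] at him
    norm_num at him
  · rw [LFunction_modOne_eq]
    have hi : ((1 : ℂ) + x + I * y).im = y := by simp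
    refine (norm_deriv_riemannZeta_le (δ := η / 2) (by linarith) (by linarith)
      (by simpa using hx.1) (by simp; linarith [hx.2]) (by rw [hi]; exact him)).trans ?_
    rw [hi, show 2 * (η / 2) = η by ring]
    have h0 : 0 ≤ 4 * (36 + 24 / η) / (η / 2) * τ ^ η := by positivity
    calc 4 * ((36 + 12 / (η / 2)) * τ ^ η) / (η / 2) = 4 * (36 + 24 / η) / (η / 2) * τ ^ η := by
          field_simp; ring
      _ ≤ C * τ ^ η := by rw [hC]; linarith

lemma norm_iteratedDeriv_logDeriv_le_rpow {f : ℂ → ℂ} {s : ℂ} {δ A c τ : ℝ} (hδ : 0 < δ)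
    (hτ : 0 < τ)
    (hc : 0 < c) (hf : DifferentiableOn ℂ f (Metric.ball s δ))
    (hM : ∀ z ∈ Metric.ball s δ, ‖f z‖ ≤ A * τ ^ (2 * δ)) (hfs : c * τ ^ (-δ) ≤ ‖f s‖) (k : ℕ) :
    ‖iteratedDeriv k (fun z => deriv f z / f z) s‖
      ≤ k.factorial * (16 * A / (c * δ)) ^ (k + 1) * τ ^ (3 * δ * (k + 1)) := by
  refine (norm_iteratedDeriv_logDeriv_le hδ hf hM (by positivity) hfs k).trans (le_of_eq ?_)
  have e : τ ^ (3 * δ * (k + 1)) = (τ ^ (2 * δ) * τ ^ δ) ^ (k + 1) := by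
    rw [← Real.rpow_add hτ, ← Real.rpow_natCast, ← Real.rpow_mul hτ.le]
    push_cast; ring_nf
  rw [e, Real.rpow_neg hτ.le, mul_assoc (k.factorial : ℝ), ← mul_pow]
  congr 2
  field_simp

lemma exists_radius (k : ℕ) {ε : ℝ} (hε : 0 < ε) :
    ∃ δ : ℝ, 0 < δ ∧ δ ≤ 1 / 2 ∧ 3 * δ * (k + 1) ≤ ε := by
  refine ⟨min (1 / 2) (ε / (3 * (k + 1))), by positivity, min_le_left _ _, ?_⟩
  calc 3 * min (1 / 2) (ε / (3 * (k + 1))) * (k + 1) ≤ 3 * (ε / (3 * (k + 1))) * (k + 1) := by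
        gcongr; exact min_le_right _ _
    _ = ε := by field_simp

/-- Bounds for all derivatives of `L'/L` just to the right of `re s = 1`. -/
theorem exists_norm_iteratedDeriv_logDeriv_LFunction_le (k : ℕ) {ε : ℝ} (hε : 0 < ε) :
    ∃ C : ℝ, 0 < C ∧ ∀ (q : ℕ) [NeZero q] (χ : DirichletCharacter ℂ q), χ ≠ 1 → ∀ s : ℂ, 1 < s.re →
    s.re ≤ 2 → ‖iteratedDeriv k (fun z => deriv (LFunction χ) z / LFunction χ z) s‖
      ≤ C * ((q : ℝ) * (|s.im| + 2)) ^ ε := by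
  obtain ⟨δ, hδ, hδ2, hδk⟩ := exists_radius k hε
  obtain ⟨c, hc, hlow⟩ := exists_le_norm_LFunction hδ
  refine ⟨k.factorial * (16 * (12 + 4 / δ) / (c * δ)) ^ (k + 1), by positivity, ?_⟩
  intro q _ χ hχ s hs1 hs2
  have hτ := two_le_conductor_size q s.im
  refine (norm_iteratedDeriv_logDeriv_le_rpow hδ (by linarith) hc
    (differentiable_LFunction hχ).differentiableOn
    (fun z hz => norm_LFunction_le_ball hχ hδ hδ2 hs1.le hs2 hz) (hlow q χ hχ s hs1 hs2) k).trans ?_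
  gcongr
  linarith

lemma exists_norm_iteratedDeriv_logDeriv_riemannZeta_le (k : ℕ) {ε : ℝ} (hε : 0 < ε) :
    ∃ C : ℝ, 0 < C ∧ ∀ s : ℂ, 1 < s.re → s.re ≤ 2 → 1 ≤ |s.im| →
    ‖iteratedDeriv k (fun z => deriv riemannZeta z / riemannZeta z) s‖ ≤ C * (|s.im| + 2) ^ ε ∧
    ‖iteratedDeriv k riemannZeta s‖ ≤ C * (|s.im| + 2) ^ ε := by
  obtain ⟨δ, hδ, hδ2, hδk⟩ := exists_radius k hε
  obtain ⟨c, hc, hlow⟩ := exists_le_norm_riemannZeta hδ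
  refine ⟨max (k.factorial * (16 * (36 + 12 / δ) / (c * δ)) ^ (k + 1))
    (k.factorial * (36 + 12 / δ) / (δ / 2) ^ k), by positivity, ?_⟩
  intro s hs1 hs2 him
  have hτ : 2 ≤ |s.im| + 2 := by linarith
  have hdiff : DifferentiableOn ℂ riemannZeta (Metric.ball s δ) := fun z hz => by
    refine (differentiableAt_riemannZeta fun h => ?_).differentiableWithinAt
    have := (re_im_of_mem_ball hz).2
    rw [h, one_im, zero_sub, abs_neg] at this
    linarith
  have hb : ∀ z ∈ Metric.ball s δ, ‖riemannZeta z‖ ≤ (36 + 12 / δ) * (|s.im| + 2) ^ (2 * δ) :=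
    fun z hz => norm_riemannZeta_le_ball hδ hδ2 hs1.le hs2 him hz
  constructor
  · refine (norm_iteratedDeriv_logDeriv_le_rpow hδ (by linarith) hc hdiff hb
      (hlow s hs1 hs2 him) k).trans ?_
    gcongr
    · exact le_max_left _ _
    · linarith
  · have hsub : Metric.closedBall s (δ / 2) ⊆ Metric.ball s δ :=
      Metric.closedBall_subset_ball (by linarith)
    refine (norm_iteratedDeriv_le_of_forall_mem_sphere_norm_le k (half_pos hδ)
      ((hdiff.mono hsub).diffContOnCl_ball subset_rfl)
      fun z hz => hb z (hsub (Metric.sphere_subset_closedBall hz))).trans ?_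
    calc k.factorial * ((36 + 12 / δ) * (|s.im| + 2) ^ (2 * δ)) / (δ / 2) ^ k
        = k.factorial * (36 + 12 / δ) / (δ / 2) ^ k * (|s.im| + 2) ^ (2 * δ) := by ring
      _ ≤ _ := by
        gcongr
        · exact le_max_right _ _
        · linarith
        · have : (0 : ℝ) ≤ k := by positivity
          nlinarith

/-- Bounds for all derivatives of `-ζ'/ζ - ζ` just to the right of `re s = 1`. -/
theorem exists_norm_iteratedDeriv_zeta_le (k : ℕ) {ε : ℝ} (hε : 0 < ε) :
    ∃ C : ℝ, 0 < C ∧ ∀ s : ℂ, 1 < s.re → s.re ≤ 2 →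
    ‖iteratedDeriv k (fun z => -deriv riemannZeta z / riemannZeta z - riemannZeta z) s‖
      ≤ C * (|s.im| + 2) ^ ε := by
  obtain ⟨C₁, hC₁, hbig⟩ := exists_norm_iteratedDeriv_logDeriv_riemannZeta_le k hε
  have hne : ∀ s : ℂ, 1 ≤ s.re → riemannZeta₁ s ≠ 0 := by
    intro s hs h
    by_cases h1 : s = 1
    · rw [h1] at h; simp at h
    · apply riemannZeta_ne_zero_of_one_le_re hs
      rw [riemannZeta_eq_inv_sub_mul h1, h, mul_zero]
  set H : ℂ → ℂ := fun z => -(deriv riemannZeta₁ z / riemannZeta₁ z) - riemannZeta₀ z with hH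
  have hHan : ∀ s : ℂ, 1 ≤ s.re → AnalyticAt ℂ H s := fun s hs =>
    (((differentiable_riemannZeta₁.analyticAt s).deriv.div
        (differentiable_riemannZeta₁.analyticAt s)
      (hne s hs)).neg).sub (differentiable_riemannZeta₀.analyticAt s)
  have hcompact : IsCompact (Icc (1 : ℝ) 2 ×ℂ Icc (-1 : ℝ) 1) :=
      isCompact_Icc.reProdIm isCompact_Icc
  obtain ⟨C₂, hC₂⟩ := hcompact.exists_bound_of_continuousOn (f := iteratedDeriv k H) fun s hs => by
    rw [iteratedDeriv_eq_iterate]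
    exact ((hHan s hs.1.1).iterated_deriv k).continuousAt.continuousWithinAt
  have hC₂0 : 0 ≤ C₂ := (norm_nonneg _).trans (hC₂ 1 (by rw [mem_reProdIm]; norm_num))
  have heq : ∀ s : ℂ, 1 < s.re →
      (fun z => -deriv riemannZeta z / riemannZeta z - riemannZeta z) =ᶠ[𝓝 s] H := by
    intro s hs
    filter_upwards [(isOpen_lt continuous_const continuous_re).mem_nhds hs] with z hz
    have hz1 : z ≠ 1 := by rintro rfl; simp at hz
    have hz2 : z - 1 ≠ 0 := sub_ne_zero.2 hz1
    have hz3 := hne z hz.le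
    rw [deriv_riemannZeta_eq_neg_inv_sub_sq_mul_add hz1, riemannZeta_eq_inv_sub_mul hz1]
    simp only [hH]
    have : (z - 1)⁻¹ * riemannZeta₁ z = (z - 1)⁻¹ + riemannZeta₀ z := by
      rw [← riemannZeta_eq_inv_sub_mul hz1, riemannZeta_eq_inv_sub_add hz1]
    have e : riemannZeta₀ z = (z - 1)⁻¹ * riemannZeta₁ z - (z - 1)⁻¹ := by rw [this]; ring
    rw [e]
    field_simp
    ring
  refine ⟨max (2 * C₁) C₂, by positivity, fun s hs1 hs2 => ?_⟩
  have hτ : 1 ≤ (|s.im| + 2) ^ ε := Real.one_le_rpow (by linarith [abs_nonneg s.im]) hε.le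
  rcases le_total 1 |s.im| with h | h
  · obtain ⟨h1, h2⟩ := hbig s hs1 hs2 h
    have hU : {z : ℂ | 1 < z.re} ∈ 𝓝 s := (isOpen_lt continuous_const continuous_re).mem_nhds hs1
    have hζ : AnalyticAt ℂ riemannZeta s := by
      rw [Complex.analyticAt_iff_eventually_differentiableAt]
      filter_upwards [hU] with z hz
      exact differentiableAt_riemannZeta (by rintro rfl; simp at hz)
    have hl : AnalyticAt ℂ (fun z => deriv riemannZeta z / riemannZeta z) s :=
      hζ.deriv.div hζ (riemannZeta_ne_zero_of_one_lt_re hs1)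
    have e : (fun z => -deriv riemannZeta z / riemannZeta z - riemannZeta z)
        = (-(fun z => deriv riemannZeta z / riemannZeta z)) - riemannZeta := by
      ext z; simp [neg_div]
    rw [e, iteratedDeriv_sub hl.neg.contDiffAt hζ.contDiffAt, iteratedDeriv_neg]
    calc _ ≤ C₁ * (|s.im| + 2) ^ ε + C₁ * (|s.im| + 2) ^ ε := by
          refine (norm_sub_le _ _).trans ?_
          rw [norm_neg]
          exact add_le_add h1 h2
      _ = 2 * C₁ * (|s.im| + 2) ^ ε := by ring
      _ ≤ _ := by gcongr; exact le_max_left _ _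
  · rw [(heq s hs1).iteratedDeriv_eq]
    calc _ ≤ C₂ := hC₂ s ⟨⟨hs1.le, hs2⟩, abs_le.1 h⟩
      _ ≤ max (2 * C₁) C₂ * 1 := by rw [mul_one]; exact le_max_right _ _
      _ ≤ _ := by gcongr

end SiegelWalfisz

namespace SiegelWalfisz
open Complex Set Filter Topology MeasureTheory

lemma hasMellin_one_sub {s : ℂ} (hs : 0 < s.re) :
    HasMellin (fun u : ℝ => ((max (1 - u) 0 : ℝ) : ℂ)) s (1 / (s * (s + 1))) := by
  have h1 := hasMellin_one_Ioc hs
  have h2 := hasMellin_cpow_Ioc (1 : ℂ) (s := s) (by simp; linarith)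
  have h := hasMellin_sub h1.1 h2.1
  rw [h1.2, h2.2] at h
  have hs0 : s ≠ 0 := fun h => by simp [h] at hs
  have hs1 : s + 1 ≠ 0 := fun h => by
    have := congrArg re h
    simp at this
    linarith
  have e : (1 : ℂ) / s - 1 / (s + 1) = 1 / (s * (s + 1)) := by field_simp; ring
  rw [e] at h
  have hE : EqOn (fun t : ℝ => (Ioc (0 : ℝ) 1).indicator (fun _ => (1 : ℂ)) t -
      (Ioc (0 : ℝ) 1).indicator (fun t : ℝ => (t : ℂ) ^ (1 : ℂ)) t)
      (fun u : ℝ => ((max (1 - u) 0 : ℝ) : ℂ)) (Ioi 0) := by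
    intro t ht
    by_cases h1 : t ≤ 1
    · simp [indicator, mem_Ioi.1 ht, h1]
    · have : 1 - t ≤ 0 := by linarith
      simp [indicator, h1, max_eq_right this]
  refine ⟨?_, ?_⟩
  · exact h.1.congr_fun (fun t ht => by simp only [hE ht]) measurableSet_Ioi
  · rw [← h.2]
    exact setIntegral_congr_fun measurableSet_Ioi fun t ht => by simp only [hE ht]

/-- The kernel of the smoothed Perron formula. -/
noncomputable def perronKernel (σ t : ℝ) : ℂ := 1 / ((σ + t * I) * (σ + t * I + 1))

lemma norm_perronKernel_le {σ : ℝ} (hσ : 1 ≤ σ) (t : ℝ) :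
    ‖perronKernel σ t‖ ≤ 2 * (1 + ‖t‖) ^ (-2 : ℝ) := by
  have h1 : 1 + t ^ 2 ≤ ‖(σ + t * I : ℂ) * (σ + t * I + 1)‖ := by
    have a : 1 + t ^ 2 ≤ ‖(σ + t * I : ℂ)‖ ^ 2 := by
      rw [Complex.sq_norm, normSq_apply]; simp; nlinarith
    have b : ‖(σ + t * I : ℂ)‖ ≤ ‖(σ + t * I + 1 : ℂ)‖ := by
      rw [← abs_norm, ← abs_norm (σ + t * I + 1 : ℂ), ← sq_le_sq, Complex.sq_norm, Complex.sq_norm,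
        normSq_apply, normSq_apply]
      simp; nlinarith
    rw [norm_mul]
    nlinarith [norm_nonneg (σ + t * I : ℂ)]
  rw [perronKernel, norm_div, norm_one, Real.rpow_neg (by positivity), ← div_eq_mul_inv,
    div_le_div_iff₀ (by nlinarith [sq_nonneg t]) (by positivity)]
  rw [show (2 : ℝ) = ((2 : ℕ) : ℝ) by norm_num, Real.rpow_natCast, Real.norm_eq_abs]
  push_cast
  nlinarith [sq_abs t, sq_nonneg (|t| - 1)]

lemma continuous_perronKernel {σ : ℝ} (hσ : 0 < σ) : Continuous (perronKernel σ) := by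
  refine Continuous.div (by fun_prop) (by fun_prop) fun t => mul_ne_zero ?_ ?_ <;>
  · intro h
    have := congrArg re h
    simp at this
    linarith

lemma integrable_perronKernel {σ : ℝ} (hσ : 1 ≤ σ) : Integrable (perronKernel σ) := by
  refine Integrable.mono' ((integrable_one_add_norm (E := ℝ) (r := 2) (by simp)).const_mul 2)
    (continuous_perronKernel (by linarith)).aestronglyMeasurable (ae_of_all _ fun t => ?_)
  exact norm_perronKernel_le hσ t

lemma integral_perronKernel {σ u : ℝ} (hσ : 1 ≤ σ) (hu : 0 < u) :
    ∫ t : ℝ, (u : ℂ) ^ (-(σ + t * I : ℂ)) * perronKernel σ t = 2 * Real.pi *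
        (max (1 - u) 0 : ℝ) := by
  have hm : ∀ t : ℝ, mellin (fun u : ℝ => ((max (1 - u) 0 : ℝ) : ℂ)) (σ + t * I) =
      perronKernel σ t :=
    fun t => (hasMellin_one_sub (s := σ + t * I) (by simp; linarith)).2
  have h := mellinInv_mellin_eq σ (fun u : ℝ => ((max (1 - u) 0 : ℝ) : ℂ)) hu
    (by simpa using (hasMellin_one_sub (s := σ) (by simp; linarith)).1)
    (by
      rw [VerticalIntegrable]
      simp only [hm]
      exact integrable_perronKernel hσ)
    (by fun_prop)
  rw [mellinInv] at h
  simp only [hm, smul_eq_mul] at h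
  rw [← h, real_smul, ← mul_assoc]
  push_cast
  rw [mul_one_div_cancel (by simp [Real.pi_ne_zero]), one_mul]

/-- The implied constant in the smoothed Perron bound. -/
noncomputable def perronConst : ℝ := (∫ t : ℝ, 2 * (1 + ‖t‖) ^ (-3 / 2 : ℝ)) / (2 * Real.pi) + 1

lemma perronConst_pos : 0 < perronConst := by
  have : 0 ≤ ∫ t : ℝ, 2 * (1 + ‖t‖) ^ (-3 / 2 : ℝ) := integral_nonneg fun t => by positivity
  unfold perronConst
  positivity

lemma norm_smoothed_sum_le {b : ℕ → ℂ} {σ M y : ℝ} (hσ : 1 ≤ σ) (hy : 0 < y)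
    (hb : LSeriesSummable b σ) (hM : ∀ t : ℝ, ‖LSeries b (σ + t * I)‖ ≤
        M * (1 + |t|) ^ (1 / 2 : ℝ)) :
    ‖∑ n ∈ Finset.Icc 1 ⌊y⌋₊, b n * (1 - n / y)‖ ≤ perronConst * M * y ^ σ := by
  have hM0 : 0 ≤ M := by simpa using (norm_nonneg _).trans (hM 0)
  set F : ℕ → ℝ → ℂ := fun n t => LSeries.term b (σ + t * I) n *
      ((y : ℂ) ^ (σ + t * I : ℂ) * perronKernel σ t)
    with hF
  have hnF : ∀ n t, ‖F n t‖ = ‖LSeries.term b σ n‖ * (y ^ σ * ‖perronKernel σ t‖) := by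
    intro n t
    simp only [hF, norm_mul, LSeries.norm_term_eq]
    rw [norm_cpow_eq_rpow_re_of_pos hy]
    simp
  have hFc : ∀ n, Continuous (F n) := by
    intro n
    have h1 : Continuous fun t : ℝ => (y : ℂ) ^ (σ + t * I : ℂ) :=
      Continuous.const_cpow (by fun_prop) (Or.inl (by exact_mod_cast hy.ne'))
    refine Continuous.mul ?_ (h1.mul (continuous_perronKernel (by linarith)))
    rcases eq_or_ne n 0 with rfl | hn
    · simpa using continuous_const
    · simp only [LSeries.term_of_ne_zero hn]
      refine continuous_const.div (Continuous.const_cpow (by fun_prop)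
        (Or.inl (by exact_mod_cast hn))) fun t => ?_
      simp [cpow_eq_zero_iff, hn]
  have hFi : ∀ n, Integrable (F n) := fun n => by
    refine Integrable.mono' (((integrable_perronKernel hσ).norm.const_mul (y ^ σ)).const_mul
      ‖LSeries.term b σ n‖) (hFc n).aestronglyMeasurable (ae_of_all _ fun t => (hnF n t).le)
  have hs := hasSum_integral_of_summable_integral_norm hFi (by
    simp only [hnF, integral_const_mul]
    exact hb.norm.mul_right _)
  have hval : ∀ n, ∫ t, F n t = if n = 0 then 0 else b n *
      (2 * Real.pi * (max (1 - n / y) 0 : ℝ)) := by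
    intro n
    split_ifs with hn
    · simp [hF, hn]
    · rw [← integral_perronKernel hσ (div_pos (by positivity : (0 : ℝ) < n) hy),
          ← integral_const_mul]
      congr 1 with t
      simp only [hF, LSeries.term_of_ne_zero hn]
      rw [div_eq_mul_inv (n : ℝ), ofReal_mul, mul_cpow_ofReal_nonneg (by positivity)
          (by positivity),
        ofReal_inv, inv_cpow _ _ (by rw [arg_ofReal_of_nonneg hy.le]; exact Real.pi_pos.ne),
        cpow_neg, cpow_neg, inv_inv, ofReal_natCast]
      ring
  have hfin : HasSum (fun n => ∫ t, F n t)
      (∑ n ∈ Finset.Icc 1 ⌊y⌋₊, ∫ t, F n t) := by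
    refine hasSum_sum_of_ne_finset_zero fun n hn => ?_
    rw [hval]
    split_ifs with h0
    · rfl
    · have : y < n := by
        by_contra! h
        exact hn (Finset.mem_Icc.2 ⟨Nat.one_le_iff_ne_zero.2 h0, Nat.le_floor h⟩)
      rw [max_eq_right (by rw [sub_nonpos, one_le_div hy]; exact this.le)]
      simp
  have key := hs.unique hfin
  have e1 : ∑ n ∈ Finset.Icc 1 ⌊y⌋₊, ∫ t, F n t
      = 2 * Real.pi * ∑ n ∈ Finset.Icc 1 ⌊y⌋₊, b n * (1 - n / y) := by
    rw [Finset.mul_sum]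
    refine Finset.sum_congr rfl fun n hn => ?_
    obtain ⟨h1, h2⟩ := Finset.mem_Icc.1 hn
    have : (n : ℝ) ≤ y := (Nat.le_floor_iff hy.le).1 h2
    rw [hval, if_neg (by omega), max_eq_left (by rw [sub_nonneg, div_le_one hy]; exact this)]
    push_cast
    ring
  rw [e1] at key
  have hint : Integrable fun t : ℝ => 2 * (1 + ‖t‖) ^ (-3 / 2 : ℝ) := by
    have := (integrable_one_add_norm (E := ℝ) (μ := volume) (r := 3 / 2)
        (by simp; norm_num)).const_mul 2
    simpa only [neg_div] using this
  have hle : ‖∫ t, ∑' n, F n t‖ ≤ M * y ^ σ * ∫ t : ℝ, 2 * (1 + ‖t‖) ^ (-3 / 2 : ℝ) := by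
    rw [← integral_const_mul]
    refine norm_integral_le_of_norm_le (hint.const_mul _) (ae_of_all _ fun t => ?_)
    simp only [hF, tsum_mul_right]
    rw [norm_mul, norm_mul, norm_cpow_eq_rpow_re_of_pos hy]
    have h1 := hM t
    rw [LSeries] at h1
    have h2 := norm_perronKernel_le hσ t
    have e : (1 + ‖t‖) ^ (-3 / 2 : ℝ) = (1 + |t|) ^ (1 / 2 : ℝ) * (1 + ‖t‖) ^ (-2 : ℝ) := by
      rw [Real.norm_eq_abs, ← Real.rpow_add (by positivity)]; norm_num
    rw [e]
    calc _ ≤ M * (1 + |t|) ^ (1 / 2 : ℝ) * (y ^ σ * (2 * (1 + ‖t‖) ^ (-2 : ℝ))) := by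
          simp only [add_re, ofReal_re, mul_re, I_re, I_im, ofReal_im, mul_zero, mul_one, sub_zero,
              add_zero]
          gcongr
      _ = _ := by ring
  rw [key, norm_mul] at hle
  have hpi : ‖(2 * Real.pi : ℂ)‖ = 2 * Real.pi := by
    simp [abs_of_pos Real.pi_pos]
  rw [hpi] at hle
  have h2 : ‖∑ n ∈ Finset.Icc 1 ⌊y⌋₊, b n * (1 - n / y)‖ ≤
      (M * y ^ σ * ∫ t : ℝ, 2 * (1 + ‖t‖) ^ (-3 / 2 : ℝ)) / (2 * Real.pi) := by
    rw [le_div_iff₀ (by positivity)]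
    linarith
  refine h2.trans ?_
  have h3 : 0 ≤ M * y ^ σ := by positivity
  rw [perronConst, mul_div_assoc]
  nlinarith

end SiegelWalfisz

namespace SiegelWalfisz
open Complex Set Filter Topology MeasureTheory

lemma neg_le_sum_mul_of_support {b g : ℕ → ℝ} {u h L : ℝ} {N : ℕ} (hu : 0 ≤ u) (hh : 0 ≤ h)
    (hL : 0 ≤ L) (hb : ∀ n : ℕ, 1 ≤ n → (n : ℝ) ≤ u + h → -L ≤ b n) (hg0 : ∀ n, 0 ≤ g n)
    (hgh : ∀ n, g n ≤ h) (hg1 : ∀ n : ℕ, (n : ℝ) ≤ u → g n = 0)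
    (hg2 : ∀ n : ℕ, u + h < n → g n = 0) :
    -(L * h * (h + 1)) ≤ ∑ n ∈ Finset.Icc 1 N, b n * g n := by
  have hle : ∀ n ∈ Finset.Icc 1 N, (if n ∈ Finset.Ioc ⌊u⌋₊ ⌊u + h⌋₊ then -(L * h) else 0) ≤
      b n * g n := by
    intro n hn
    have hn1 := (Finset.mem_Icc.1 hn).1
    split_ifs with hm
    · have h1 : (n : ℝ) ≤ u + h := (Nat.le_floor_iff (by linarith)).1 (Finset.mem_Ioc.1 hm).2
      have h2 := hb n hn1 h1
      nlinarith [hg0 n, hgh n, mul_le_mul_of_nonneg_left (hgh n) hL]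
    · rw [Finset.mem_Ioc, not_and_or, not_lt, not_le] at hm
      rcases hm with hm | hm
      · rw [hg1 n ((Nat.le_floor_iff hu).1 hm), mul_zero]
      · rw [hg2 n ((Nat.floor_lt (by linarith)).1 hm), mul_zero]
  refine le_trans ?_ (Finset.sum_le_sum hle)
  rw [← Finset.sum_filter, Finset.sum_const, nsmul_eq_mul]
  have hc : (((Finset.Icc 1 N).filter (· ∈ Finset.Ioc ⌊u⌋₊ ⌊u + h⌋₊)).card : ℝ) ≤ h + 1 := by
    have h1 : ((Finset.Icc 1 N).filter (· ∈ Finset.Ioc ⌊u⌋₊ ⌊u + h⌋₊)).card ≤ ⌊u + h⌋₊ - ⌊u⌋₊ := by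
      rw [← Nat.card_Ioc]
      exact Finset.card_le_card fun n hn => (Finset.mem_filter.1 hn).2
    have h2 : ⌊u⌋₊ ≤ ⌊u + h⌋₊ := Nat.floor_le_floor (by linarith)
    have h3 : (((Finset.Icc 1 N).filter (· ∈ Finset.Ioc ⌊u⌋₊ ⌊u + h⌋₊)).card : ℝ)
        ≤ (⌊u + h⌋₊ : ℝ) - ⌊u⌋₊ := by
      rw [← Nat.cast_sub h2]; exact_mod_cast h1
    linarith [Nat.floor_le (by linarith : 0 ≤ u + h), Nat.lt_floor_add_one u]
  nlinarith [mul_nonneg hL hh]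

lemma sum_mul_sub_eq_max {b : ℕ → ℝ} {y : ℝ} {N : ℕ} (hy : y < N + 1) :
    ∑ n ∈ Finset.Icc 1 ⌊y⌋₊, b n * (y - n) = ∑ n ∈ Finset.Icc 1 N, b n * max (y - n) 0 := by
  have hN : ⌊y⌋₊ ≤ N := by
    rcases le_or_gt 0 y with h | h
    · exact Nat.lt_succ_iff.1 ((Nat.floor_lt h).2 (by push_cast; exact hy))
    · simp [Nat.floor_of_nonpos h.le]
  refine Finset.sum_subset_zero_on_sdiff (Finset.Icc_subset_Icc_right hN) (fun n hn => ?_)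
    (fun n hn => ?_)
  · rw [Finset.mem_sdiff, Finset.mem_Icc, Finset.mem_Icc] at hn
    have : y < n := Nat.lt_of_floor_lt (by omega)
    rw [max_eq_right (by linarith), mul_zero]
  · obtain ⟨h1, h2⟩ := Finset.mem_Icc.1 hn
    have : (n : ℝ) ≤ y := (Nat.le_floor_iff' (by omega)).1 h2
    rw [max_eq_left (by linarith)]

lemma abs_sum_le_of_smoothed {b : ℕ → ℝ} {x h E L : ℝ} (hh : 0 < h) (hx : h ≤ x) (hL : 0 ≤ L)
    (hS : ∀ y ≤ x + h, |∑ n ∈ Finset.Icc 1 ⌊y⌋₊, b n * (y - n)| ≤ E)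
    (hb : ∀ n : ℕ, 1 ≤ n → (n : ℝ) ≤ x + h → -L ≤ b n) :
    |∑ n ∈ Finset.Icc 1 ⌊x⌋₊, b n| ≤ 2 * E / h + L * (h + 1) := by
  set N := ⌊x + h⌋₊ with hN
  have hN1 : x + h < N + 1 := Nat.lt_floor_add_one _
  have hB : ∑ n ∈ Finset.Icc 1 ⌊x⌋₊, b n = ∑ n ∈ Finset.Icc 1 N,
      b n * (if (n : ℝ) ≤ x then 1 else 0) := by
    simp only [mul_ite, mul_one, mul_zero]
    rw [← Finset.sum_filter]
    congr 1
    ext n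
    have h1 : ⌊x⌋₊ ≤ N := Nat.floor_le_floor (by linarith)
    rw [Finset.mem_filter, Finset.mem_Icc, Finset.mem_Icc, Nat.le_floor_iff (by linarith)]
    constructor
    · rintro ⟨a, b⟩
      exact ⟨⟨a, ((Nat.le_floor_iff (by linarith)).2 b).trans h1⟩, b⟩
    · rintro ⟨⟨a, _⟩, b⟩
      exact ⟨a, b⟩
  have s1 := abs_le.1 (hS (x + h) le_rfl)
  have s2 := abs_le.1 (hS x (by linarith))
  have s3 := abs_le.1 (hS (x - h) (by linarith))
  rw [sum_mul_sub_eq_max hN1] at s1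
  rw [sum_mul_sub_eq_max (N := N) (by linarith)] at s2 s3
  have up := neg_le_sum_mul_of_support (N := N) (b := b) (u := x) (h := h) (L := L)
    (g := fun n => max (x + h - n) 0 - max (x - n) 0 - h * (if (n : ℝ) ≤ x then 1 else 0))
    (by linarith) hh.le hL hb
    (fun n => by
      split_ifs <;> rcases max_cases (x + h - n) 0 with p | p <;>
        rcases max_cases (x - n) 0 with r | r <;> linarith)
    (fun n => by
      split_ifs <;> rcases max_cases (x + h - n) 0 with p | p <;>
        rcases max_cases (x - n) 0 with r | r <;> linarith)
    (fun n hn => by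
      rw [if_pos hn, max_eq_left (by linarith), max_eq_left (by linarith)]; ring)
    (fun n hn => by
      rw [if_neg (by linarith), max_eq_right (by linarith), max_eq_right (by linarith)]; ring)
  have lo := neg_le_sum_mul_of_support (N := N) (b := b) (u := x - h) (h := h) (L := L)
    (g := fun n => h * (if (n : ℝ) ≤ x then 1 else 0) - max (x - n) 0 + max (x - h - n) 0)
    (by linarith) hh.le hL (fun n h1 h2 => hb n h1 (by linarith))
    (fun n => by
      split_ifs <;> rcases max_cases (x - h - n) 0 with p | p <;>
        rcases max_cases (x - n) 0 with r | r <;> linarith)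
    (fun n => by
      split_ifs <;> rcases max_cases (x - h - n) 0 with p | p <;>
        rcases max_cases (x - n) 0 with r | r <;> linarith)
    (fun n hn => by
      rw [if_pos (by linarith), max_eq_left (by linarith), max_eq_left (by linarith)]; ring)
    (fun n hn => by
      rw [if_neg (by linarith), max_eq_right (by linarith), max_eq_right (by linarith)]; ring)
  simp only [mul_sub, mul_add, Finset.sum_sub_distrib, Finset.sum_add_distrib, mul_left_comm _ h,
    ← Finset.mul_sum] at up lo
  rw [← hB] at up lo
  have hE : (2 * E / h + L * (h + 1)) * h = 2 * E + L * h * (h + 1) := by field_simp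
  rw [abs_le]
  constructor
  · refine le_of_mul_le_mul_right ?_ hh
    linarith
  · refine le_of_mul_le_mul_right ?_ hh
    linarith

end SiegelWalfisz

namespace SiegelWalfisz
open Complex Set Filter Topology MeasureTheory

/-- Abel's inequality. -/
lemma abs_sum_range_mul_le {w g : ℕ → ℝ} {β : ℝ} {n : ℕ} (hw : ∀ i < n, 0 ≤ w i)
    (hmono : ∀ i, i + 1 < n → w (i + 1) ≤ w i)
    (hg : ∀ i ≤ n, |∑ k ∈ Finset.range i, g k| ≤ β) :
    |∑ i ∈ Finset.range n, w i * g i| ≤ β * w 0 ∨ n = 0 := by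
  rcases Nat.eq_zero_or_pos n with h | hn
  · exact Or.inr h
  left
  have h := Finset.sum_range_by_parts w g n
  simp only [smul_eq_mul] at h
  rw [h]
  have hβ : 0 ≤ β := (abs_nonneg _).trans (hg 0 (by omega))
  have h1 : |w (n - 1) * ∑ i ∈ Finset.range n, g i| ≤ w (n - 1) * β := by
    rw [abs_mul, abs_of_nonneg (hw _ (by omega))]
    exact mul_le_mul_of_nonneg_left (hg n le_rfl) (hw _ (by omega))
  have h2 : |∑ i ∈ Finset.range (n - 1), (w (i + 1) - w i) * ∑ i ∈ Finset.range (i + 1), g i|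
      ≤ ∑ i ∈ Finset.range (n - 1), (w i - w (i + 1)) * β := by
    refine (Finset.abs_sum_le_sum_abs _ _).trans (Finset.sum_le_sum fun i hi => ?_)
    have hi' := Finset.mem_range.1 hi
    have := hmono i (by omega)
    rw [abs_mul, abs_of_nonpos (by linarith), neg_sub]
    exact mul_le_mul_of_nonneg_left (hg _ (by omega)) (by linarith)
  rw [← Finset.sum_mul, Finset.sum_range_sub'] at h2
  refine (abs_sub _ _).trans ?_
  linarith

lemma abs_sum_Ioc_mul_le {w b : ℕ → ℝ} {β : ℝ} {M N : ℕ} (hβ : 0 ≤ β) (hw : ∀ n, M < n → 0 ≤ w n)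
    (hmono : ∀ n, M < n → w (n + 1) ≤ w n)
    (hb : ∀ n ≤ N, |∑ k ∈ Finset.Icc 1 n, b k| ≤ β) :
    |∑ n ∈ Finset.Ioc M N, b n * w n| ≤ 2 * β * w (M + 1) := by
  rcases le_or_gt N M with h | h
  · rw [Finset.Ioc_eq_empty (by omega)]
    have := hw (M + 1) (by omega)
    simp; positivity
  have hr : ∀ f : ℕ → ℝ, ∀ i, ∑ k ∈ Finset.range i, f (M + 1 + k)
      = ∑ k ∈ Finset.Icc 1 (M + i), f k - ∑ k ∈ Finset.Icc 1 M, f k := by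
    intro f i
    induction i with
    | zero => simp
    | succ i ih =>
      rw [Finset.sum_range_succ, ih, ← add_assoc, Finset.sum_Icc_succ_top (by omega),
        add_right_comm M 1 i]
      ring
  have hsum : ∑ n ∈ Finset.Ioc M N, b n * w n
      = ∑ i ∈ Finset.range (N - M), w (M + 1 + i) * b (M + 1 + i) := by
    have e : Finset.Ioc M N = Finset.Ico (M + 1) (N + 1) := by
      ext n
      simp only [Finset.mem_Ioc, Finset.mem_Ico]
      omega
    rw [e, Finset.sum_Ico_eq_sum_range, Nat.add_sub_add_right]
    exact Finset.sum_congr rfl fun i _ => mul_comm _ _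
  rw [hsum]
  have hg : ∀ i ≤ N - M, |∑ k ∈ Finset.range i, b (M + 1 + k)| ≤ 2 * β := by
    intro i hi
    rw [hr]
    have h1 := hb (M + i) (by omega)
    have h2 := hb M (by omega)
    exact (abs_sub _ _).trans (by linarith)
  rcases abs_sum_range_mul_le (w := fun i => w (M + 1 + i)) (g := fun i => b (M + 1 + i))
      (β := 2 * β)
    (n := N - M) (fun i _ => hw _ (by omega)) (fun i _ => hmono (M + 1 + i) (by omega))
    hg with h | h
  · simpa using h
  · omega

lemma iterate_logMul (f : ℕ → ℂ) (k n : ℕ) :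
    LSeries.logMul^[k] f n = ((Real.log n : ℝ) : ℂ) ^ k * f n := by
  induction k with
  | zero => simp
  | succ k ih =>
    rw [Function.iterate_succ_apply', LSeries.logMul, ih, natCast_log, pow_succ]
    ring

lemma one_add_log_le_rpow {δ : ℝ} (hδ : 0 < δ) {n : ℕ} (hn : n ≠ 0) :
    1 + Real.log n ≤ (1 + 1 / δ) * (n : ℝ) ^ δ := by
  have h1 : (1 : ℝ) ≤ n := by exact_mod_cast Nat.one_le_iff_ne_zero.2 hn
  have h2 := Real.log_le_rpow_div (by linarith : (0 : ℝ) ≤ n) hδ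
  have h3 := Real.one_le_rpow h1 hδ.le
  rw [add_mul, one_mul, one_div_mul_eq_div]
  linarith

lemma abscissaOfAbsConv_le_one {f : ℕ → ℂ} {A : ℝ} (hf : ∀ n : ℕ, n ≠ 0 → ‖f n‖ ≤
    A * (1 + Real.log n)) :
    LSeries.abscissaOfAbsConv f ≤ 1 := by
  have hA : 0 ≤ A := by simpa using (norm_nonneg _).trans (hf 1 one_ne_zero)
  refine LSeries.abscissaOfAbsConv_le_of_forall_lt_LSeriesSummable (x := 1) fun y hy => ?_
  refine LSeriesSummable_of_le_const_mul_rpow (x := 1 + (y - 1) / 2) (by simp; linarith)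
    ⟨A * (1 + 1 / ((y - 1) / 2)), fun n hn => (hf n hn).trans ?_⟩
  rw [mul_assoc, show 1 + (y - 1) / 2 - 1 = (y - 1) / 2 by ring]
  exact mul_le_mul_of_nonneg_left (one_add_log_le_rpow (by linarith) hn) hA

/-- Bound on the smoothed summatory function of a sequence in terms of derivatives of its
Dirichlet series near the line `re s = 1`. -/
lemma abs_sum_log_pow_mul_sub_le {f : ℕ → ℝ} {A Q : ℝ} {k : ℕ}
    (hf : ∀ n : ℕ, n ≠ 0 → |f n| ≤ A * (1 + Real.log n))
    (hF : ∀ s : ℂ, 1 < s.re → s.re ≤ 2 →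
      ‖iteratedDeriv k (LSeries fun n => (f n : ℂ)) s‖ ≤ Q * (1 + |s.im|) ^ (1 / 2 : ℝ)) {y : ℝ}
          (hy : 0 < y) :
    |∑ n ∈ Finset.Icc 1 ⌊y⌋₊, Real.log n ^ k * f n * (y - n)| ≤ 3 * perronConst * Q * y ^ 2 := by
  have hQ : 0 ≤ Q := by
    have := (norm_nonneg _).trans (hF 2 (by simp) (by simp))
    simpa using this
  have hc := perronConst_pos
  rcases lt_or_ge y 1 with hy1 | hy1
  · rw [Nat.floor_eq_zero.2 hy1]
    simp only [Finset.Icc_eq_empty_of_lt zero_lt_one, Finset.sum_empty, abs_zero]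
    positivity
  have hl : 0 ≤ Real.log y := Real.log_nonneg hy1
  set σ := 1 + 1 / (1 + Real.log y) with hσ
  have hσ0 : 0 < 1 / (1 + Real.log y) := by positivity
  have hσ1 : 1 / (1 + Real.log y) ≤ 1 := by rw [div_le_one (by positivity)]; linarith
  have habs : LSeries.abscissaOfAbsConv (fun n => (f n : ℂ)) ≤ 1 :=
    abscissaOfAbsConv_le_one (A := A) fun n hn => by simpa using hf n hn
  have hlt : ∀ s : ℂ, 1 < s.re → LSeries.abscissaOfAbsConv
      (fun n => (f n : ℂ)) < s.re := fun s hs =>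
    habs.trans_lt (by exact_mod_cast hs)
  have h := norm_smoothed_sum_le (b := LSeries.logMul^[k] fun n => (f n : ℂ)) (σ := σ) (M := Q)
      (y := y)
    (by linarith) hy
    (LSeriesSummable_of_abscissaOfAbsConv_lt_re (by
      rw [LSeries.absicssaOfAbsConv_logPowMul]
      exact hlt _ (by simp; linarith)))
    (fun t => by
      have h1 := hF (σ + t * I) (by simp; linarith) (by simp; linarith)
      rw [LSeries_iteratedDeriv _ (hlt _ (by simp; linarith))] at h1
      simpa using h1)
  have e : ∑ n ∈ Finset.Icc 1 ⌊y⌋₊, (LSeries.logMul^[k] fun n => (f n : ℂ)) n * (1 - n / y)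
      = ((∑ n ∈ Finset.Icc 1 ⌊y⌋₊, Real.log n ^ k * f n * (y - n)) / y : ℝ) := by
    rw [Finset.sum_div]
    push_cast
    refine Finset.sum_congr rfl fun n _ => ?_
    rw [iterate_logMul]
    have : (y : ℂ) ≠ 0 := by exact_mod_cast hy.ne'
    push_cast
    field_simp
  rw [e, norm_real, Real.norm_eq_abs, abs_div, abs_of_pos hy, div_le_iff₀ hy] at h
  refine h.trans ?_
  have hyσ : y ^ σ ≤ 3 * y := by
    rw [hσ, Real.rpow_add hy, Real.rpow_one, mul_comm]
    refine mul_le_mul_of_nonneg_right ?_ hy.le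
    rw [Real.rpow_def_of_pos hy]
    refine le_trans (Real.exp_le_exp.2 (?_ : Real.log y * (1 / (1 + Real.log y)) ≤ 1))
      (by linarith [Real.exp_one_lt_d9])
    rw [mul_one_div, div_le_one (by positivity)]
    linarith
  calc perronConst * Q * y ^ σ * y ≤ perronConst * Q * (3 * y) * y := by gcongr
    _ = _ := by ring

lemma one_add_log_pow_le {x : ℝ} (hx : 1 ≤ x) (j : ℕ) : (1 + Real.log x) ^ j ≤ 3 * j.factorial *
    x := by
  have h := Real.pow_div_factorial_le_exp (1 + Real.log x) (by linarith [Real.log_nonneg hx]) j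
  rw [div_le_iff₀ (by positivity), Real.exp_add, Real.exp_log (by linarith)] at h
  have : Real.exp 1 ≤ 3 := by linarith [Real.exp_one_lt_d9]
  calc _ ≤ _ := h
    _ ≤ 3 * x * j.factorial := by gcongr
    _ = _ := by ring

end SiegelWalfisz

namespace SiegelWalfisz
open Complex Set Filter Topology MeasureTheory

lemma abs_sum_log_pow_mul_le (j : ℕ) : ∃ C : ℝ, 0 < C ∧ ∀ (f : ℕ → ℝ) (Q : ℝ), 1 ≤ Q →
    (∀ n : ℕ, n ≠ 0 → -(1 + Real.log n) ≤ f n) → (∀ n : ℕ, n ≠ 0 → f n ≤ Q * (1 + Real.log n)) →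
    (∀ s : ℂ, 1 < s.re → s.re ≤ 2 →
      ‖iteratedDeriv (2 * j) (LSeries fun n => (f n : ℂ)) s‖ ≤ Q * (1 + |s.im|) ^ (1 / 2 : ℝ)) →
    ∀ x : ℝ, 1 ≤ x → |∑ n ∈ Finset.Icc 1 ⌊x⌋₊, Real.log n ^ (2 * j) * f n|
      ≤ C * Q * x * (1 + Real.log x) ^ (j + 1) := by
  have hP := perronConst_pos
  refine ⟨24 * perronConst + 2 ^ (2 * j + 1) * (1 + 3 * j.factorial), by positivity, ?_⟩
  intro f Q hQ hf1 hf2 hF x hx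
  have hl : 0 ≤ Real.log x := Real.log_nonneg hx
  set l := 1 + Real.log x with hldef
  have hl1 : 1 ≤ l := by linarith
  have hlj : 1 ≤ l ^ j := one_le_pow₀ hl1
  have hx0 : 0 < x := by linarith
  have hfabs : ∀ n : ℕ, n ≠ 0 → |f n| ≤ Q * (1 + Real.log n) := fun n hn => by
    have h0 : 0 ≤ Real.log n := Real.log_natCast_nonneg n
    rw [abs_le]
    exact ⟨by nlinarith [hf1 n hn], hf2 n hn⟩
  set h := x / l ^ j with hh
  have hh0 : 0 < h := by positivity
  have hhx : h ≤ x := div_le_self hx0.le hlj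
  have key := abs_sum_le_of_smoothed (b := fun n => Real.log n ^ (2 * j) * f n) (x := x) (h := h)
    (E := 3 * perronConst * Q * (2 * x) ^ 2) (L := (2 * l) ^ (2 * j + 1)) hh0 hhx (by positivity)
    (fun y hy => by
      rcases le_or_gt y 0 with h0 | h0
      · rw [Nat.floor_of_nonpos h0]
        simp only [Finset.Icc_eq_empty_of_lt zero_lt_one, Finset.sum_empty, abs_zero]
        positivity
      · refine (abs_sum_log_pow_mul_sub_le hfabs hF h0).trans ?_
        gcongr
        linarith)
    (fun n hn hnx => by
      have hn1 : (1 : ℝ) ≤ n := by exact_mod_cast hn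
      have h0 : 0 ≤ Real.log n := Real.log_natCast_nonneg n
      have h1 : 1 + Real.log n ≤ 2 * l := by
        have : Real.log n ≤ Real.log (2 * x) := Real.log_le_log (by linarith) (by linarith)
        rw [Real.log_mul (by norm_num) (by linarith)] at this
        linarith [Real.log_two_lt_d9]
      have h2 := hf1 n (by omega)
      have h3 : Real.log n ^ (2 * j) * (1 + Real.log n) ≤ (2 * l) ^ (2 * j + 1) := by
        rw [pow_succ]
        gcongr
        linarith
      have h4 := mul_le_mul_of_nonneg_left h2 (pow_nonneg h0 (2 * j))
      linarith)
  refine key.trans ?_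
  have hone : 1 ≤ 3 * j.factorial * h := by
    rw [hh, mul_div_assoc', one_le_div (by positivity)]
    exact one_add_log_pow_le hx j
  have e1 : 2 * (3 * perronConst * Q * (2 * x) ^ 2) / h = 24 * perronConst * Q * x * l ^ j := by
    rw [hh]; field_simp; ring
  have e2 : (2 * l) ^ (2 * j + 1) * h = 2 ^ (2 * j + 1) * x * l ^ (j + 1) := by
    rw [hh, mul_pow, show 2 * j + 1 = j + 1 + j by ring, pow_add l (j + 1) j]; field_simp
  rw [e1]
  have h5 : (2 * l) ^ (2 * j + 1) * (h + 1) ≤ (2 ^ (2 * j + 1) * (1 + 3 * j.factorial)) * Q * x *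
      l ^ (j + 1) := by
    calc (2 * l) ^ (2 * j + 1) * (h + 1) ≤ (2 * l) ^ (2 * j + 1) *
        (h + 3 * j.factorial * h) := by gcongr
      _ = (2 ^ (2 * j + 1) * (1 + 3 * j.factorial)) * 1 * x * l ^ (j + 1) := by
        rw [← one_add_mul, mul_left_comm, e2]; ring
      _ ≤ _ := by gcongr
  have h6 : 24 * perronConst * Q * x * l ^ j ≤ 24 * perronConst * Q * x * l ^ (j + 1) := by
    gcongr
    omega
  linarith

/-- A quantitative Tauberian theorem: bounds for the derivatives of the Dirichlet series of `f` near
the line `re s = 1` give cancellation in the sum of `f n / log n`. -/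
theorem exists_abs_sum_div_log_le (j : ℕ) : ∃ C : ℝ, 0 < C ∧ ∀ (f : ℕ → ℝ) (Q : ℝ), 1 ≤ Q →
    (∀ n : ℕ, n ≠ 0 → -(1 + Real.log n) ≤ f n) → (∀ n : ℕ, n ≠ 0 → f n ≤ Q * (1 + Real.log n)) →
    (∀ s : ℂ, 1 < s.re → s.re ≤ 2 →
      ‖iteratedDeriv (2 * j) (LSeries fun n => (f n : ℂ)) s‖ ≤ Q * (1 + |s.im|) ^ (1 / 2 : ℝ)) →
    ∀ x : ℝ, 2 ≤ x → |∑ n ∈ Finset.Icc 2 ⌊x⌋₊, f n / Real.log n| ≤ C * Q * x / Real.log x ^ j := by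
  obtain ⟨C, hC, hB⟩ := abs_sum_log_pow_mul_le j
  refine ⟨2 * C * 3 ^ (j + 1) * 2 ^ (2 * j + 1) +
      3 * (2 ^ j * (3 * j.factorial)), by positivity, ?_⟩
  intro f Q hQ hf1 hf2 hF x hx
  have hB := hB f Q hQ hf1 hf2 hF
  have hx0 : 0 < x := by linarith
  have hl2 : Real.log 2 ≤ Real.log x := Real.log_le_log (by norm_num) hx
  have hl2' := Real.log_two_gt_d9
  have hlx : 0 < Real.log x := by linarith
  have hs1 : 1 ≤ √x := Real.one_le_sqrt.2 (by linarith)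
  have hsx : √x * √x = x := Real.mul_self_sqrt hx0.le
  have hlogs : Real.log √x = Real.log x / 2 := Real.log_sqrt hx0.le
  set M := ⌊√x⌋₊ with hM
  set N := ⌊x⌋₊ with hN
  have hM1 : 1 ≤ M := Nat.one_le_floor_iff _ |>.2 hs1
  have hMN : M ≤ N := Nat.floor_le_floor (by nlinarith)
  have hsplit : ∑ n ∈ Finset.Icc 2 N, f n / Real.log n
      = ∑ n ∈ Finset.Icc 2 M, f n / Real.log n + ∑ n ∈ Finset.Ioc M N, f n / Real.log n := by
    rw [← Finset.sum_union]
    · congr 1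
      ext n
      simp only [Finset.mem_union, Finset.mem_Icc, Finset.mem_Ioc]
      omega
    · rw [Finset.disjoint_left]
      intro n
      simp only [Finset.mem_Icc, Finset.mem_Ioc]
      omega
  have hlogn : ∀ n : ℕ, 2 ≤ n → Real.log 2 ≤ Real.log n := fun n hn =>
    Real.log_le_log (by norm_num) (by exact_mod_cast hn)
  have hsmall : |∑ n ∈ Finset.Icc 2 M, f n / Real.log n| ≤ 3 * (2 ^ j * (3 * j.factorial)) * Q *
      x / Real.log x ^ j := by
    have h1 : |∑ n ∈ Finset.Icc 2 M, f n / Real.log n| ≤ ∑ n ∈ Finset.Icc 2 M, 3 * Q := by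
      refine (Finset.abs_sum_le_sum_abs _ _).trans (Finset.sum_le_sum fun n hn => ?_)
      have hn2 := (Finset.mem_Icc.1 hn).1
      have h0 := hlogn n hn2
      have ha := hf1 n (by omega)
      have hb := hf2 n (by omega)
      have hl : 0 < Real.log n := by linarith
      rw [abs_div, abs_of_pos hl, div_le_iff₀ hl, abs_le]
      constructor <;> nlinarith
    have h2 : ∑ n ∈ Finset.Icc 2 M, 3 * Q ≤ √x * (3 * Q) := by
      rw [Finset.sum_const, nsmul_eq_mul, Nat.card_Icc]
      have : ((M + 1 - 2 : ℕ) : ℝ) ≤ √x := by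
        refine le_trans ?_ (Nat.floor_le (Real.sqrt_nonneg x))
        exact_mod_cast (by omega : M + 1 - 2 ≤ M)
      gcongr
    refine h1.trans (h2.trans ?_)
    rw [le_div_iff₀ (by positivity)]
    have h3 := one_add_log_pow_le hs1 j
    have h4 : Real.log x ^ j ≤ 2 ^ j * (3 * j.factorial * √x) := by
      calc Real.log x ^ j ≤ (2 * (1 + Real.log √x)) ^ j := by
            gcongr
            rw [hlogs]; linarith
        _ = 2 ^ j * (1 + Real.log √x) ^ j := mul_pow _ _ _
        _ ≤ _ := by gcongr
    calc √x * (3 * Q) * Real.log x ^ j ≤ √x * (3 * Q) *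
        (2 ^ j * (3 * j.factorial * √x)) := by gcongr
      _ = 3 * (2 ^ j * (3 * j.factorial)) * Q * (√x * √x) := by ring
      _ = _ := by rw [hsx]
  have hβ : ∀ n ≤ N, |∑ k ∈ Finset.Icc 1 n, Real.log k ^ (2 * j) * f k|
      ≤ C * Q * x * (1 + Real.log x) ^ (j + 1) := by
    intro n hn
    rcases Nat.eq_zero_or_pos n with rfl | hn0
    · simp; positivity
    have hn1 : (1 : ℝ) ≤ n := by exact_mod_cast hn0
    have hnx : (n : ℝ) ≤ x := (Nat.le_floor_iff hx0.le).1 hn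
    have h := hB n hn1
    rw [Nat.floor_natCast] at h
    refine h.trans ?_
    have : 0 ≤ Real.log n := Real.log_nonneg hn1
    gcongr
  have hlarge : |∑ n ∈ Finset.Ioc M N, f n / Real.log n|
      ≤ 2 * C * 3 ^ (j + 1) * 2 ^ (2 * j + 1) * Q * x / Real.log x ^ j := by
    have e : ∑ n ∈ Finset.Ioc M N, f n / Real.log n
        = ∑ n ∈ Finset.Ioc M N, Real.log n ^ (2 * j) * f n * (Real.log n ^ (2 * j + 1))⁻¹ := by
      refine Finset.sum_congr rfl fun n hn => ?_
      have := hlogn n (by have := (Finset.mem_Ioc.1 hn).1; omega)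
      have : Real.log n ≠ 0 := by linarith
      field_simp
      ring
    have hlogM : ∀ n : ℕ, M < n → 0 < Real.log n := fun n hn => by
      linarith [hlogn n (by omega)]
    rw [e]
    refine (abs_sum_Ioc_mul_le (w := fun n => (Real.log n ^ (2 * j + 1))⁻¹) (by positivity)
      (fun n hn => by have := hlogM n hn; positivity) (fun n hn => ?_) hβ).trans ?_
    · have := hlogM n hn
      gcongr
      · exact_mod_cast (by omega : 0 < n)
      · omega
    · have hw : ((Real.log (M + 1 : ℕ)) ^ (2 * j + 1))⁻¹ ≤ ((Real.log x / 2) ^ (2 * j + 1))⁻¹ := by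
        rw [← hlogs]
        have : 0 < Real.log √x := by rw [hlogs]; linarith
        gcongr
        push_cast
        exact (Nat.lt_floor_add_one _).le
      calc 2 * (C * Q * x * (1 + Real.log x) ^ (j + 1)) * ((Real.log (M + 1 : ℕ)) ^ (2 * j + 1))⁻¹
          ≤ 2 * (C * Q * x * (3 * Real.log x) ^ (j + 1)) * ((Real.log x / 2) ^ (2 * j + 1))⁻¹ := by
            gcongr
            linarith
        _ = _ := by
          rw [mul_pow, div_pow, show 2 * j + 1 = (j + 1) + j by ring, pow_add (Real.log x)]
          field_simp
          ring
  rw [hsplit]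
  refine (abs_add_le _ _).trans ((add_le_add hsmall hlarge).trans (le_of_eq ?_))
  ring

end SiegelWalfisz

namespace SiegelWalfisz
open Complex Set Filter Topology DirichletCharacter
open ArithmeticFunction (vonMangoldt)

lemma iteratedDeriv_eq_of_eqOn_one_lt_re {F G : ℂ → ℂ} (h : ∀ s : ℂ, 1 < s.re → F s = G s) (k : ℕ)
    {s : ℂ}
    (hs : 1 < s.re) : iteratedDeriv k F s = iteratedDeriv k G s := by
  refine Filter.EventuallyEq.iteratedDeriv_eq k ?_
  filter_upwards [(isOpen_lt continuous_const continuous_re).mem_nhds hs] with z hz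
  exact h z hz

lemma add_two_rpow_le (t : ℝ) : (|t| + 2) ^ (1 / 2 : ℝ) ≤ 2 * (1 + |t|) ^ (1 / 2 : ℝ) := by
  calc (|t| + 2) ^ (1 / 2 : ℝ) ≤ (2 * (1 + |t|)) ^ (1 / 2 : ℝ) := by
        refine Real.rpow_le_rpow (by positivity) ?_ (by norm_num)
        linarith [abs_nonneg t]
    _ = 2 ^ (1 / 2 : ℝ) * (1 + |t|) ^ (1 / 2 : ℝ) := Real.mul_rpow (by norm_num) (by positivity)
    _ ≤ 2 ^ (1 : ℝ) * (1 + |t|) ^ (1 / 2 : ℝ) := by gcongr <;> norm_num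
    _ = _ := by rw [Real.rpow_one]

/-- The prime number theorem for `Λ` with weights `1 / log n`. -/
theorem exists_abs_sum_vonMangoldt_sub_one_le (j : ℕ) : ∃ C : ℝ, 0 < C ∧ ∀ x : ℝ, 2 ≤ x →
    |∑ n ∈ Finset.Icc 2 ⌊x⌋₊, (vonMangoldt n - 1) / Real.log n| ≤ C * x / Real.log x ^ j := by
  obtain ⟨C, hC, hT⟩ := exists_abs_sum_div_log_le j
  obtain ⟨C1, hC1, hz⟩ := exists_norm_iteratedDeriv_zeta_le (2 * j) (ε := 1 / 2) (by norm_num)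
  refine ⟨C * max 1 (2 * C1), by positivity, fun x hx => ?_⟩
  refine hT (fun n => vonMangoldt n - 1) (max 1 (2 * C1)) (le_max_left _ _) (fun n hn => ?_)
      (fun n hn => ?_)
    (fun s hs1 hs2 => ?_) x hx
  · have := Real.log_natCast_nonneg n
    have := ArithmeticFunction.vonMangoldt_nonneg (n := n)
    linarith
  · have h1 := Real.log_natCast_nonneg n
    have h2 := ArithmeticFunction.vonMangoldt_le_log (n := n)
    nlinarith [le_max_left 1 (2 * C1)]
  · rw [iteratedDeriv_eq_of_eqOn_one_lt_re
      (G := fun z => -deriv riemannZeta z / riemannZeta z - riemannZeta z) (fun z hz => ?_) _ hs1]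
    · refine (hz s hs1 hs2).trans ?_
      calc C1 * (|s.im| + 2) ^ (1 / 2 : ℝ) ≤ C1 * (2 * (1 + |s.im|) ^ (1 / 2 : ℝ)) := by
            gcongr; exact add_two_rpow_le _
        _ = 2 * C1 * (1 + |s.im|) ^ (1 / 2 : ℝ) := by ring
        _ ≤ _ := by gcongr; exact le_max_right _ _
    · have e : (fun n => ((vonMangoldt n - 1 : ℝ) : ℂ)) = (fun n => (vonMangoldt n : ℂ)) - 1 := by
        ext n; simp
      rw [e, LSeries_sub (ArithmeticFunction.LSeriesSummable_vonMangoldt hz)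
        (LSeriesSummable_one_iff.2 hz), LSeries_one_eq_riemannZeta hz,
        ArithmeticFunction.LSeries_vonMangoldt_eq_deriv_riemannZeta_div hz]

open Classical in
/-- The difference between the indicator of `n ≡ 1 mod q`, scaled by `φ q`, and that of `(n, q) = 1`,
weighted by `Λ`. -/
noncomputable def progressionDiff (q n : ℕ) : ℝ :=
  ((if (n : ZMod q) = 1 then (q.totient : ℝ) else 0) - (if IsUnit (n : ZMod q) then 1 else 0)) *
      vonMangoldt n

lemma progressionDiff_eq (q : ℕ) [NeZero q] (n : ℕ) : (progressionDiff q n : ℂ)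
    = ∑ χ ∈ (Finset.univ.erase (1 : DirichletCharacter ℂ q)), χ n * vonMangoldt n := by
  rw [← Finset.sum_mul, Finset.sum_erase_eq_sub (Finset.mem_univ _),
    DirichletCharacter.sum_characters_eq ℂ (n : ZMod q)]
  have : (1 : DirichletCharacter ℂ q) n = (if IsUnit (n : ZMod q) then 1 else 0) := by
    split_ifs with h
    · exact MulChar.one_apply h
    · exact MulChar.map_nonunit _ h
  rw [this, progressionDiff]
  split_ifs <;> simp

lemma LSeries_progressionDiff (q : ℕ) [NeZero q] {s : ℂ} (hs : 1 < s.re) :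
    LSeries (fun n => (progressionDiff q n : ℂ)) s
      = ∑ χ ∈ (Finset.univ.erase (1 : DirichletCharacter ℂ q)),
          -(deriv (LFunction χ) s / LFunction χ s) := by
  have e : (fun n => (progressionDiff q n : ℂ)) =
      ∑ χ ∈ (Finset.univ.erase (1 : DirichletCharacter ℂ q)),
      ((fun n : ℕ => χ n) * fun n => (vonMangoldt n : ℂ)) := by
    ext n
    rw [progressionDiff_eq, Finset.sum_apply]
    rfl
  rw [e, LSeries_sum fun χ _ => LSeriesSummable_twist_vonMangoldt χ hs]
  refine Finset.sum_congr rfl fun χ _ => ?_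
  rw [LSeries_twist_vonMangoldt_eq χ hs, deriv_LFunction_eq_deriv_LSeries χ hs,
    LFunction_eq_LSeries χ hs, neg_div]

lemma analyticAt_logDeriv_LFunction {q : ℕ} [NeZero q] {χ : DirichletCharacter ℂ q} (hχ : χ ≠ 1)
    {s : ℂ}
    (hs : 1 < s.re) : AnalyticAt ℂ (fun z => deriv (LFunction χ) z / LFunction χ z) s :=
  ((differentiable_LFunction hχ).analyticAt s).deriv.div
      ((differentiable_LFunction hχ).analyticAt s)
    (LFunction_ne_zero_of_one_le_re χ (.inl hχ) hs.le)

theorem exists_abs_sum_progressionDiff_le (j : ℕ) : ∃ C : ℝ, 0 < C ∧ ∀ (q : ℕ) [NeZero q] (x : ℝ),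
    2 ≤ x →
    |∑ n ∈ Finset.Icc 2 ⌊x⌋₊, progressionDiff q n / Real.log n| ≤
        C * q ^ 2 * x / Real.log x ^ j := by
  obtain ⟨C, hC, hT⟩ := exists_abs_sum_div_log_le j
  obtain ⟨C1, hC1, hz⟩ := exists_norm_iteratedDeriv_logDeriv_LFunction_le (2 * j) (ε := 1 / 2)
      (by norm_num)
  refine ⟨C * max 1 (2 * C1), by positivity, fun q _ x hx => ?_⟩
  have hq : (1 : ℝ) ≤ q := by exact_mod_cast NeZero.one_le
  have hφ : (q.totient : ℝ) ≤ q := by exact_mod_cast Nat.totient_le q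
  set m := max 1 (2 * C1) with hm
  have hm1 : 1 ≤ m := le_max_left _ _
  have hqm : (q : ℝ) ≤ m * q ^ 2 := by nlinarith
  rw [mul_assoc C m]
  refine hT (progressionDiff q) (m * q ^ 2) (by nlinarith) (fun n hn => ?_) (fun n hn => ?_)
    (fun s hs1 hs2 => ?_) x hx
  · have h1 := Real.log_natCast_nonneg n
    have h2 := ArithmeticFunction.vonMangoldt_le_log (n := n)
    have h3 := ArithmeticFunction.vonMangoldt_nonneg (n := n)
    have h4 : (0 : ℝ) ≤ q.totient * vonMangoldt n := by positivity
    rw [progressionDiff]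
    split_ifs <;> linarith
  · have h1 := Real.log_natCast_nonneg n
    have h2 := ArithmeticFunction.vonMangoldt_le_log (n := n)
    have h3 := ArithmeticFunction.vonMangoldt_nonneg (n := n)
    have h4 : progressionDiff q n ≤ q * vonMangoldt n := by
      rw [progressionDiff]
      refine mul_le_mul_of_nonneg_right ?_ h3
      split_ifs <;> linarith
    calc _ ≤ q * vonMangoldt n := h4
      _ ≤ q * (1 + Real.log n) := by gcongr; linarith
      _ ≤ _ := by gcongr
  · rw [iteratedDeriv_eq_of_eqOn_one_lt_re (fun z hz => LSeries_progressionDiff q hz) _ hs1,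
      iteratedDeriv_fun_sum (f := fun χ z => -(deriv (LFunction χ) z / LFunction χ z)) fun χ hχ =>
        (analyticAt_logDeriv_LFunction (Finset.ne_of_mem_erase hχ) hs1).neg.contDiffAt]
    have hcard : ((Finset.univ.erase (1 : DirichletCharacter ℂ q)).card : ℝ) ≤ q := by
      have h1 : (Finset.univ.erase (1 : DirichletCharacter ℂ q)).card ≤ q.totient := by
        rw [← card_eq_totient_of_hasEnoughRootsOfUnity ℂ q, Nat.card_eq_fintype_card]
        exact Finset.card_le_univ _
      exact le_trans (by exact_mod_cast h1) hφ
    have hterm : ∀ χ ∈ (Finset.univ.erase (1 : DirichletCharacter ℂ q)),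
        ‖iteratedDeriv (2 * j) (fun z => -(deriv (LFunction χ) z / LFunction χ z)) s‖
          ≤ m * q * (1 + |s.im|) ^ (1 / 2 : ℝ) := by
      intro χ hχ
      rw [iteratedDeriv_fun_neg, norm_neg]
      refine (hz q χ (Finset.ne_of_mem_erase hχ) s hs1 hs2).trans ?_
      rw [Real.mul_rpow (by positivity) (by positivity)]
      have h1 : (q : ℝ) ^ (1 / 2 : ℝ) ≤ q := by
        calc (q : ℝ) ^ (1 / 2 : ℝ) ≤ (q : ℝ) ^ (1 : ℝ) := by gcongr; norm_num
          _ = q := Real.rpow_one _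
      calc C1 * ((q : ℝ) ^ (1 / 2 : ℝ) * (|s.im| + 2) ^ (1 / 2 : ℝ))
          ≤ C1 * (q * (2 * (1 + |s.im|) ^ (1 / 2 : ℝ))) := by gcongr; exact add_two_rpow_le _
        _ = 2 * C1 * q * (1 + |s.im|) ^ (1 / 2 : ℝ) := by ring
        _ ≤ _ := by gcongr; exact le_max_right _ _
    refine (norm_sum_le_of_le _ hterm).trans ?_
    rw [Finset.sum_const, nsmul_eq_mul]
    calc _ ≤ (q : ℝ) * (m * q * (1 + |s.im|) ^ (1 / 2 : ℝ)) := by gcongr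
      _ = _ := by ring

end SiegelWalfisz

namespace SiegelWalfisz
open Set Filter Topology MeasureTheory
open ArithmeticFunction (vonMangoldt)

lemma exists_sqrt_mul_log_le (j : ℕ) : ∃ C : ℝ, 0 < C ∧ ∀ x : ℝ, 2 ≤ x →
    √x * Real.log x ≤ C * (x / Real.log x ^ j) := by
  refine ⟨2 ^ (j + 1) * (3 * (j + 1).factorial), by positivity, fun x hx => ?_⟩
  have hlx : 0 < Real.log x := Real.log_pos (by linarith)
  have hs1 : 1 ≤ √x := Real.one_le_sqrt.2 (by linarith)
  have hsx : √x * √x = x := Real.mul_self_sqrt (by linarith)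
  have hlogs : Real.log √x = Real.log x / 2 := Real.log_sqrt (by linarith)
  have h3 := one_add_log_pow_le hs1 (j + 1)
  rw [mul_div_assoc', le_div_iff₀ (by positivity)]
  calc √x * Real.log x * Real.log x ^ j = √x * Real.log x ^ (j + 1) := by ring
    _ ≤ √x * (2 * (1 + Real.log √x)) ^ (j + 1) := by
        gcongr
        rw [hlogs]; linarith
    _ = √x * (2 ^ (j + 1) * (1 + Real.log √x) ^ (j + 1)) := by rw [mul_pow]
    _ ≤ √x * (2 ^ (j + 1) * (3 * (j + 1).factorial * √x)) := by gcongr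
    _ = 2 ^ (j + 1) * (3 * (j + 1).factorial) * (√x * √x) := by ring
    _ = _ := by rw [hsx]

lemma log_two_le_log_natCast {n : ℕ} (hn : 2 ≤ n) : Real.log 2 ≤ Real.log n :=
  Real.log_le_log (by norm_num) (by exact_mod_cast hn)

lemma antitoneOn_one_div_log : AntitoneOn (fun t : ℝ => 1 / Real.log t) (Ici 2) := by
  intro a ha b hb hab
  have ha' : (2 : ℝ) ≤ a := ha
  have : 0 < Real.log a := Real.log_pos (by linarith)
  have := Real.log_le_log (by linarith) hab
  exact one_div_le_one_div_of_le (by assumption) this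

lemma one_div_log_le_two {t : ℝ} (ht : 2 ≤ t) : 1 / Real.log t ≤ 2 := by
  have h := Real.log_le_log (by norm_num) ht
  have h2 := Real.log_two_gt_d9
  rw [div_le_iff₀ (by linarith)]
  linarith

lemma abs_sum_one_div_log_sub_integral_le {x : ℝ} (hx : 2 ≤ x) :
    |∑ n ∈ Finset.Icc 2 ⌊x⌋₊, 1 / Real.log n - ∫ t in (2 : ℝ)..x, 1 / Real.log t| ≤ 4 := by
  set N := ⌊x⌋₊ with hN
  have hN2 : 2 ≤ N := Nat.le_floor (by exact_mod_cast hx)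
  have hN2' : (2 : ℝ) ≤ N := by exact_mod_cast hN2
  have hNx : (N : ℝ) ≤ x := Nat.floor_le (by linarith)
  have hxN : x < N + 1 := Nat.lt_floor_add_one x
  have hii : ∀ a b : ℝ, 2 ≤ a → a ≤ b → IntervalIntegrable
      (fun t : ℝ => 1 / Real.log t) volume a b :=
    fun a b ha hab => (antitoneOn_one_div_log.mono (by
      rw [uIcc_of_le hab]; exact fun t ht => ha.trans ht.1)).intervalIntegrable
  have hpos : ∀ t : ℝ, 2 ≤ t → 0 ≤ 1 / Real.log t := fun t ht =>
    (one_div_pos.2 (Real.log_pos (by linarith))).le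
  have hanti : AntitoneOn (fun t : ℝ => 1 / Real.log t) (Icc ((2 : ℕ) : ℝ) N) :=
    antitoneOn_one_div_log.mono fun t ht => by simpa using ht.1
  have h1 := hanti.integral_le_sum_Ico hN2
  have h2 := hanti.sum_le_integral_Ico hN2
  rw [Nat.cast_ofNat] at h1 h2
  have h3 : ∫ t in (2 : ℝ)..x, 1 / Real.log t
      = (∫ t in (2 : ℝ)..N, 1 / Real.log t) + ∫ t in (N : ℝ)..x, 1 / Real.log t :=
    (intervalIntegral.integral_add_adjacent_intervals (hii _ _ le_rfl hN2') (hii _ _ hN2' hNx)).symm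
  have h4 : 0 ≤ ∫ t in (N : ℝ)..x, 1 / Real.log t :=
    intervalIntegral.integral_nonneg hNx fun t ht => hpos t (hN2'.trans ht.1)
  have h5 : ∫ t in (N : ℝ)..x, 1 / Real.log t ≤ 2 := by
    have h := intervalIntegral.integral_mono_on hNx (hii _ _ hN2' hNx)
      (intervalIntegrable_const (c := (2 : ℝ))) fun t ht => one_div_log_le_two (hN2'.trans ht.1)
    rw [intervalIntegral.integral_const, smul_eq_mul] at h
    linarith
  have e1 : ∑ n ∈ Finset.Icc 2 N, 1 / Real.log n
      = ∑ n ∈ Finset.Ico 2 N, 1 / Real.log n + 1 / Real.log N := by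
    exact (Finset.sum_Ico_add_eq_sum_Icc hN2).symm
  have e2 : ∑ n ∈ Finset.Icc 2 N, 1 / Real.log n
      = 1 / Real.log 2 + ∑ n ∈ Finset.Ico 2 N, 1 / Real.log (n + 1 : ℕ) := by
    have := Finset.sum_Ioc_add_eq_sum_Icc (f := fun n : ℕ => 1 / Real.log n) hN2
    rw [← this, add_comm, Nat.cast_ofNat]
    congr 1
    have e : Finset.Ioc 2 N = Finset.Ico (2 + 1) (N + 1) := by
      ext n
      simp only [Finset.mem_Ioc, Finset.mem_Ico]
      omega
    rw [e, ← Finset.sum_Ico_add']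
  have h6 := hpos N hN2'
  have h7 := one_div_log_le_two (le_refl (2 : ℝ))
  rw [abs_le]
  constructor <;> linarith

lemma sum_not_prime_vonMangoldt_div_log_le {x : ℝ} (hx : 2 ≤ x) :
    ∑ n ∈ Finset.Icc 2 ⌊x⌋₊, (if n.Prime then 0 else vonMangoldt n / Real.log n) ≤
        4 * (√x * Real.log x) := by
  have h1 := Chebyshev.psi_sub_theta_le (x := x) (by linarith)
  rw [Chebyshev.psi_sub_theta_eq_sum_not_prime, Finset.sum_filter] at h1
  have h2 : ∑ n ∈ Finset.Icc 2 ⌊x⌋₊, (if n.Prime then 0 else vonMangoldt n / Real.log n)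
      ≤ ∑ n ∈ Finset.Icc 2 ⌊x⌋₊, 2 * (if ¬ n.Prime then vonMangoldt n else 0) := by
    refine Finset.sum_le_sum fun n hn => ?_
    have h := one_div_log_le_two (t := n) (by exact_mod_cast (Finset.mem_Icc.1 hn).1)
    by_cases hp : n.Prime
    · simp [hp]
    · simp only [hp, if_false, not_false_eq_true, if_true]
      rw [div_eq_mul_one_div, mul_comm]
      exact mul_le_mul_of_nonneg_right h ArithmeticFunction.vonMangoldt_nonneg
  have h3 : ∑ n ∈ Finset.Icc 2 ⌊x⌋₊, (if ¬ n.Prime then vonMangoldt n else 0)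
      ≤ ∑ n ∈ Finset.Ioc 0 ⌊x⌋₊, (if ¬ n.Prime then vonMangoldt n else 0) := by
    refine Finset.sum_le_sum_of_subset_of_nonneg (fun n => ?_) fun n _ _ => ?_
    · simp only [Finset.mem_Icc, Finset.mem_Ioc]
      omega
    · have := ArithmeticFunction.vonMangoldt_nonneg (n := n)
      split_ifs <;> simp [this]
  rw [← Finset.mul_sum] at h2
  linarith

/-- Number of primes `p ≤ x` with `p ≡ 1 mod q`. -/
noncomputable def primeCountOne (q : ℕ) (x : ℝ) : ℕ := ((Finset.Icc 1 ⌊x⌋₊).filter fun p =>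
    p.Prime ∧ q ∣ p - 1).card

lemma natCast_eq_one_iff_dvd {q p : ℕ} (hp : 1 ≤ p) : (p : ZMod q) = 1 ↔ q ∣ p - 1 := by
  rw [← Nat.modEq_iff_dvd' hp, ← Nat.cast_one, ZMod.natCast_eq_natCast_iff]
  exact ⟨Nat.ModEq.symm, Nat.ModEq.symm⟩

/-- A form of the Siegel-Walfisz theorem for the residue class `1`. -/
theorem exists_abs_totient_mul_primeCountOne_sub_le (j : ℕ) : ∃ C : ℝ, 0 < C ∧ ∀ (q : ℕ) [NeZero q]
    (x : ℝ),
    2 ≤ x → |q.totient * primeCountOne q x - ∫ t in (2 : ℝ)..x, 1 / Real.log t|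
      ≤ C * q ^ 2 * (x / Real.log x ^ j) := by
  classical
  obtain ⟨C1, hC1, h1⟩ := exists_abs_sum_progressionDiff_le j
  obtain ⟨C2, hC2, h2⟩ := exists_abs_sum_vonMangoldt_sub_one_le j
  obtain ⟨C3, hC3, h3⟩ := exists_sqrt_mul_log_le j
  refine ⟨C1 + C2 + 20 * C3, by positivity, fun q _ x hx => ?_⟩
  have h1 := h1 q x hx
  have h2 := h2 x hx
  have h3 := h3 x hx
  have h4 := abs_sum_one_div_log_sub_integral_le hx
  have h5 := sum_not_prime_vonMangoldt_div_log_le hx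
  set N := ⌊x⌋₊ with hN
  set R := x / Real.log x ^ j with hR
  set E := ∑ n ∈ Finset.Icc 2 N, (if n.Prime then 0 else vonMangoldt n / Real.log n) with hE
  have hlog : 0 < Real.log x := Real.log_pos (by linarith)
  have hR0 : 0 < R := by positivity
  have hE0 : 0 ≤ E := Finset.sum_nonneg fun n hn => by
    have := Real.log_natCast_nonneg n
    have := ArithmeticFunction.vonMangoldt_nonneg (n := n)
    split_ifs <;> positivity
  have hone : 1 ≤ 2 * (C3 * R) := by
    have h := Real.log_le_log (by norm_num) hx
    have h' := Real.log_two_gt_d9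
    have hs1 : 1 ≤ √x := Real.one_le_sqrt.2 (by linarith)
    nlinarith
  have hq : (1 : ℝ) ≤ q := by exact_mod_cast NeZero.one_le
  have hφ : (q.totient : ℝ) ≤ q := by exact_mod_cast Nat.totient_le q
  have hφ0 : (0 : ℝ) ≤ q.totient := by positivity
  have hu : ∀ n ∈ Finset.Icc 2 N, vonMangoldt n / Real.log n
      = (if n.Prime then 1 else 0) + (if n.Prime then 0 else vonMangoldt n / Real.log n) := by
    intro n hn
    have hl := log_two_le_log_natCast (Finset.mem_Icc.1 hn).1
    have h' := Real.log_two_gt_d9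
    by_cases hp : n.Prime
    · simp only [hp, if_true, ArithmeticFunction.vonMangoldt_apply_prime hp]
      rw [div_self (by linarith), add_zero]
    · simp [hp]
  have k1 : ∑ n ∈ Finset.Icc 2 N, (vonMangoldt n - 1) / Real.log n
      = ∑ n ∈ Finset.Icc 2 N, (if n.Prime then (1 : ℝ) else 0) + E - ∑ n ∈ Finset.Icc 2 N,
          1 / Real.log n := by
    rw [hE, ← Finset.sum_add_distrib, ← Finset.sum_sub_distrib]
    exact Finset.sum_congr rfl fun n hn => by rw [sub_div, ← hu n hn]
  set κ : ℕ → ℝ := fun n => (if (n : ZMod q) = 1 then (q.totient : ℝ) else 0) -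
    (if IsUnit (n : ZMod q) then 1 else 0) with hκ
  have hκ1 : ∀ n, |κ n| ≤ q := fun n => by
    rw [abs_le, hκ]
    dsimp only
    split_ifs <;> constructor <;> linarith
  have k2 : ∑ n ∈ Finset.Icc 2 N, progressionDiff q n / Real.log n
      = ∑ n ∈ Finset.Icc 2 N, κ n * (if n.Prime then (1 : ℝ) else 0)
        + ∑ n ∈ Finset.Icc 2 N, κ n * (if n.Prime then 0 else vonMangoldt n / Real.log n) := by
    rw [← Finset.sum_add_distrib]
    refine Finset.sum_congr rfl fun n hn => ?_
    rw [← mul_add, ← hu n hn, progressionDiff, mul_div_assoc]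
    congr!
  have k3 : |∑ n ∈ Finset.Icc 2 N, κ n * (if n.Prime then 0 else vonMangoldt n / Real.log n)| ≤
      q * E := by
    rw [hE, Finset.mul_sum]
    refine (Finset.abs_sum_le_sum_abs _ _).trans (Finset.sum_le_sum fun n _ => ?_)
    have hnn : 0 ≤ (if n.Prime then 0 else vonMangoldt n / Real.log n) := by
      have := Real.log_natCast_nonneg n
      have := ArithmeticFunction.vonMangoldt_nonneg (n := n)
      split_ifs <;> positivity
    rw [abs_mul, abs_of_nonneg hnn]
    exact mul_le_mul_of_nonneg_right (hκ1 n) hnn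
  have k4 : ∑ n ∈ Finset.Icc 2 N, κ n * (if n.Prime then (1 : ℝ) else 0)
      = q.totient * primeCountOne q x - ∑ n ∈ Finset.Icc 2 N, (if n.Prime then (1 : ℝ) else 0)
        + ((Finset.Icc 2 N).filter fun n : ℕ => n.Prime ∧ ¬ IsUnit (n : ZMod q)).card := by
    have e : (Finset.Icc 1 N).filter (fun p => p.Prime ∧ q ∣ p - 1)
        = (Finset.Icc 2 N).filter fun p => p.Prime ∧ q ∣ p - 1 := by
      ext p
      simp only [Finset.mem_filter, Finset.mem_Icc]
      exact ⟨fun h => ⟨⟨h.2.1.two_le, h.1.2⟩, h.2⟩, fun h => ⟨⟨by omega, h.1.2⟩, h.2⟩⟩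
    rw [primeCountOne, e, Finset.natCast_card_filter, Finset.natCast_card_filter, Finset.mul_sum,
      ← Finset.sum_sub_distrib, ← Finset.sum_add_distrib]
    refine Finset.sum_congr rfl fun n hn => ?_
    have hd := natCast_eq_one_iff_dvd (q := q) (p := n) (by have := (Finset.mem_Icc.1 hn).1; omega)
    rw [hκ]
    simp only [hd]
    by_cases hp : n.Prime <;> by_cases h1 : q ∣ n - 1 <;> by_cases h2 : IsUnit (n : ZMod q) <;>
      simp [hp, h1, h2]
  have k5 : (((Finset.Icc 2 N).filter fun n : ℕ => n.Prime ∧ ¬ IsUnit (n : ZMod q)).card : ℝ) ≤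
      q := by
    have : ((Finset.Icc 2 N).filter fun n : ℕ => n.Prime ∧ ¬ IsUnit
        (n : ZMod q)) ⊆ Finset.Icc 1 q := by
      intro n hn
      obtain ⟨_, hp, hnu⟩ := Finset.mem_filter.1 hn
      rw [ZMod.isUnit_iff_coprime, Nat.Prime.coprime_iff_not_dvd hp, not_not] at hnu
      exact Finset.mem_Icc.2 ⟨hp.one_le, Nat.le_of_dvd (NeZero.pos q) hnu⟩
    have := Finset.card_le_card this
    rw [Nat.card_Icc] at this
    exact_mod_cast this
  have k6 : (0 : ℝ) ≤ ((Finset.Icc 2 N).filter fun n : ℕ => n.Prime ∧ ¬ IsUnit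
      (n : ZMod q)).card := by positivity
  rw [k1] at h2
  rw [k2, k4] at h1
  rw [mul_div_assoc, ← hR] at h1 h2
  have hEle : E ≤ 4 * (C3 * R) := by linarith
  have hbound : C1 * q ^ 2 * R + q * E + q + C2 * R + E + 4 ≤ (C1 + C2 + 20 * C3) * q ^ 2 * R := by
    have hq2 : (q : ℝ) ≤ q ^ 2 := by nlinarith
    have hq3 : (1 : ℝ) ≤ q ^ 2 := by nlinarith
    have hCR : 0 ≤ C3 * R := by positivity
    have a1 : q * E ≤ q ^ 2 * (4 * (C3 * R)) := by gcongr
    have a2 : (q : ℝ) ≤ q ^ 2 * (2 * (C3 * R)) := by nlinarith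
    have a3 : C2 * R ≤ C2 * q ^ 2 * R := by
      have : 0 ≤ C2 * R := by positivity
      nlinarith
    have a4 : C3 * R ≤ q ^ 2 * (C3 * R) := le_mul_of_one_le_left hCR hq3
    have e : (C1 + C2 + 20 * C3) * q ^ 2 * R
        = C1 * q ^ 2 * R + C2 * q ^ 2 * R + 20 * (q ^ 2 * (C3 * R)) := by ring
    rw [e]
    linarith
  refine le_trans ?_ hbound
  rw [abs_le] at h1 h2 h4 k3 ⊢
  constructor <;> linarith [h1.1, h1.2, h2.1, h2.2, h4.1, h4.2, k3.1, k3.2]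

end SiegelWalfisz

namespace SiegelWalfisz
open Set Filter Topology

/-- The indicator of squarefree `d`, divided by `φ d`. -/
noncomputable def sqfreeInvTotient (d : ℕ) : ℝ := if Squarefree d then 1 / (d.totient : ℝ) else 0

lemma sqfreeInvTotient_nonneg (d : ℕ) : 0 ≤ sqfreeInvTotient d := by
  unfold sqfreeInvTotient
  split_ifs <;> positivity

lemma totient_prod_primes {t : Finset ℕ} (ht : ∀ p ∈ t, p.Prime) :
    (∏ p ∈ t, p).totient = ∏ p ∈ t, (p - 1) := by
  induction t using Finset.induction_on with
  | empty => simp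
  | insert a t ha ih =>
    have hp := ht a (Finset.mem_insert_self _ _)
    have ht' : ∀ p ∈ t, p.Prime := fun p hp => ht p (Finset.mem_insert_of_mem hp)
    rw [Finset.prod_insert ha, Finset.prod_insert ha, Nat.totient_mul, ih ht', Nat.totient_prime hp]
    exact Nat.Coprime.prod_right fun p hpt =>
      (Nat.coprime_primes hp (ht' p hpt)).2 fun h => ha (h ▸ hpt)

lemma totient_eq_mul_prod (n : ℕ) :
    (n.totient : ℝ) = n * ∏ p ∈ n.primeFactors, (1 - (p : ℝ)⁻¹) := by
  have := congrArg (Rat.cast : ℚ → ℝ) (Nat.totient_eq_mul_prod_factors n)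
  push_cast at this
  exact this

lemma div_totient_eq_prod {n : ℕ} (hn : n ≠ 0) :
    (n : ℝ) / n.totient = ∏ p ∈ n.primeFactors, (1 + 1 / ((p : ℝ) - 1)) := by
  have h : (n.totient : ℝ) = n * ∏ p ∈ n.primeFactors, (1 - (p : ℝ)⁻¹) := totient_eq_mul_prod n
  have hp : ∀ p ∈ n.primeFactors, (1 + 1 / ((p : ℝ) - 1)) = (1 - (p : ℝ)⁻¹)⁻¹ := by
    intro p hp
    have h2 : (2 : ℝ) ≤ p := by exact_mod_cast (Nat.prime_of_mem_primeFactors hp).two_le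
    have h3 : (p : ℝ) - 1 ≠ 0 := by linarith
    have h4 : (p : ℝ) ≠ 0 := by linarith
    have h5 : 1 - (p : ℝ)⁻¹ ≠ 0 := by
      rw [show 1 - (p : ℝ)⁻¹ = (p - 1) / p by field_simp]
      exact div_ne_zero h3 h4
    field_simp
    ring
  rw [Finset.prod_congr rfl hp, Finset.prod_inv_distrib, h]
  have hn' : (n : ℝ) ≠ 0 := by exact_mod_cast hn
  rw [← div_div, div_self hn', one_div]

lemma div_totient_eq_sum_divisors {n : ℕ} (hn : n ≠ 0) :
    (n : ℝ) / n.totient = ∑ d ∈ n.divisors, sqfreeInvTotient d := by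
  unfold sqfreeInvTotient
  rw [← Finset.sum_filter, Nat.sum_divisors_filter_squarefree hn, div_totient_eq_prod hn,
    Finset.prod_one_add]
  have e : (UniqueFactorizationMonoid.normalizedFactors n).toFinset = n.primeFactors := by
    ext p
    rw [Multiset.mem_toFinset, Nat.mem_primeFactors_of_ne_zero hn,
      UniqueFactorizationMonoid.mem_normalizedFactors_iff hn, Nat.prime_iff]
  rw [e]
  refine Finset.sum_congr rfl fun t ht => ?_
  have htp : ∀ p ∈ t, p.Prime := fun p hp => Nat.prime_of_mem_primeFactors
      (Finset.mem_powerset.1 ht hp)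
  have e2 : t.val.prod = ∏ p ∈ t, p := Finset.prod_val t
  rw [e2, totient_prod_primes htp, Nat.cast_prod, one_div, ← Finset.prod_inv_distrib]
  refine Finset.prod_congr rfl fun p hp => ?_
  rw [Nat.cast_sub (htp p hp).one_le, Nat.cast_one, one_div]

/-- The indicator of squarefree `d`, divided by `φ d ^ 2`. -/
noncomputable def sqfreeInvTotientSq (d : ℕ) : ℝ :=
    if Squarefree d then 1 / (d.totient : ℝ) ^ 2 else 0

lemma sqfreeInvTotientSq_nonneg (d : ℕ) : 0 ≤ sqfreeInvTotientSq d := by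
  unfold sqfreeInvTotientSq
  split_ifs <;> positivity

lemma sqfreeInvTotientSq_le_one (d : ℕ) : sqfreeInvTotientSq d ≤ 1 := by
  unfold sqfreeInvTotientSq
  split_ifs with h
  · have : (1 : ℝ) ≤ d.totient := by
      exact_mod_cast Nat.totient_pos.2 (Nat.pos_of_ne_zero h.ne_zero)
    rw [div_le_one (by positivity)]
    exact one_le_pow₀ this
  · exact zero_le_one

lemma sqfreeInvTotient_eq_mul (d : ℕ) : sqfreeInvTotient d = sqfreeInvTotientSq d * d.totient := by
  unfold sqfreeInvTotientSq sqfreeInvTotient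
  split_ifs with h
  · have : (d.totient : ℝ) ≠ 0 := by
      exact_mod_cast (Nat.totient_pos.2 (Nat.pos_of_ne_zero h.ne_zero)).ne'
    field_simp
  · simp

lemma exists_sqfreeInvTotientSq_le : ∃ c : ℝ, 0 < c ∧ ∀ n : ℕ, n ≠ 0 →
    sqfreeInvTotientSq n ≤ c * (n : ℝ) ^ (-7 / 4 : ℝ) := by
  refine ⟨17 ^ 2, by positivity, fun n hn => ?_⟩
  have hn0 : (0 : ℝ) < n := by positivity
  unfold sqfreeInvTotientSq
  split_ifs
  · have h1 := card_primeFactors_add_one_le hn (η := 1 / 8) (by norm_num)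
    have h2 := inv_le_prod_one_sub_inv n
    have h3 : (n.totient : ℝ) = n * ∏ p ∈ n.primeFactors, (1 - (p : ℝ)⁻¹) := totient_eq_mul_prod n
    norm_num at h1
    have h4 : (n : ℝ) / (17 * (n : ℝ) ^ (1 / 8 : ℝ)) ≤ n.totient := by
      rw [h3, div_eq_mul_inv]
      refine mul_le_mul_of_nonneg_left (le_trans ?_ h2) hn0.le
      gcongr
    have h5 : (0 : ℝ) < (n : ℝ) / (17 * (n : ℝ) ^ (1 / 8 : ℝ)) := by positivity
    calc 1 / (n.totient : ℝ) ^ 2 ≤ 1 / ((n : ℝ) / (17 * (n : ℝ) ^ (1 / 8 : ℝ))) ^ 2 := by gcongr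
      _ = 17 ^ 2 * (((n : ℝ) ^ (1 / 8 : ℝ)) ^ 2 * ((n : ℝ) ^ 2)⁻¹) := by field_simp
      _ = _ := by
        rw [← Real.rpow_natCast ((n : ℝ) ^ (1 / 8 : ℝ)) 2, ← Real.rpow_mul hn0.le,
            ← Real.rpow_natCast (n : ℝ) 2, ← Real.rpow_neg hn0.le,
          ← Real.rpow_add hn0]
        norm_num
  · positivity

lemma summable_rpow_mul_sqfreeInvTotientSq :
    Summable fun n : ℕ => (n : ℝ) ^ (1 / 2 : ℝ) * sqfreeInvTotientSq n := by
  obtain ⟨c, hc, h⟩ := exists_sqfreeInvTotientSq_le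
  refine Summable.of_nonneg_of_le (fun n => mul_nonneg (by positivity)
      (sqfreeInvTotientSq_nonneg n)) (fun n => ?_)
    ((Real.summable_nat_rpow.2 (by norm_num : (-5 / 4 : ℝ) < -1)).mul_left c)
  rcases eq_or_ne n 0 with rfl | hn
  · simp
  · have hn0 : (0 : ℝ) < n := by positivity
    calc _ ≤ (n : ℝ) ^ (1 / 2 : ℝ) * (c * (n : ℝ) ^ (-7 / 4 : ℝ)) := by gcongr; exact h n hn
      _ = c * ((n : ℝ) ^ (1 / 2 : ℝ) * (n : ℝ) ^ (-7 / 4 : ℝ)) := by ring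
      _ = _ := by rw [← Real.rpow_add hn0]; norm_num

lemma summable_sqfreeInvTotientSq : Summable sqfreeInvTotientSq := by
  refine Summable.of_nonneg_of_le sqfreeInvTotientSq_nonneg
      (fun n => ?_) summable_rpow_mul_sqfreeInvTotientSq
  rcases eq_or_ne n 0 with rfl | hn
  · simp [sqfreeInvTotientSq]
  · refine le_mul_of_one_le_left (sqfreeInvTotientSq_nonneg n) (Real.one_le_rpow ?_ (by norm_num))
    exact_mod_cast Nat.one_le_iff_ne_zero.2 hn

lemma tsum_sqfreeInvTotientSq :
    ∏' p : Nat.Primes, (1 + 1 / ((p : ℝ) - 1) ^ 2) = ∑' n, sqfreeInvTotientSq n := by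
  have h := EulerProduct.eulerProduct_hasProd (f := sqfreeInvTotientSq)
      (by simp [sqfreeInvTotientSq])
    (fun {m n} hmn => by
      unfold sqfreeInvTotientSq
      by_cases h1 : Squarefree m <;> by_cases h2 : Squarefree n <;>
        simp [Nat.squarefree_mul hmn, Nat.totient_mul hmn, h1, h2, mul_pow, mul_comm])
    summable_sqfreeInvTotientSq.norm (by simp [sqfreeInvTotientSq])
  rw [← h.tprod_eq]
  refine tprod_congr fun p => ?_
  have hp := p.2
  rw [tsum_eq_sum (s := {0, 1}) (fun e he => ?_)]
  · rw [Finset.sum_pair zero_ne_one, pow_zero, pow_one]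
    simp only [sqfreeInvTotientSq, squarefree_one, if_true, hp.prime.squarefree, Nat.totient_one,
      Nat.totient_prime hp, Nat.cast_sub hp.one_le]
    norm_num
  · have he : 2 ≤ e := by
      simp only [Finset.mem_insert, Finset.mem_singleton] at he
      omega
    rw [sqfreeInvTotientSq, if_neg]
    intro hs
    have := (Nat.squarefree_pow_iff hp.ne_one (by omega)).1 hs
    omega

end SiegelWalfisz

namespace SiegelWalfisz
open Set Filter Topology

lemma primeCountOne_le_div (d : ℕ) (x : ℝ) : primeCountOne d x ≤ ⌊x⌋₊ / d := by
  rw [← Nat.Ioc_filter_dvd_card_eq_div, primeCountOne]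
  refine Finset.card_le_card_of_injOn (fun p => p - 1) (fun p hp => ?_) (fun p hp q hq h => ?_)
  · simp only [Finset.coe_filter, Finset.mem_Icc, mem_ofPred_eq, Finset.mem_Ioc] at hp ⊢
    have := hp.2.1.two_le
    exact ⟨by omega, hp.2.2⟩
  · simp only [Finset.coe_filter, Finset.mem_Icc, mem_ofPred_eq] at hp hq h
    have := hp.1.1
    have := hq.1.1
    omega

lemma primeCountOne_eq_zero {d : ℕ} {x : ℝ} (h : ⌊x⌋₊ < d) : primeCountOne d x = 0 :=
  Nat.le_zero.1 ((primeCountOne_le_div d x).trans (Nat.div_eq_of_lt h).le)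

lemma sum_div_totient_eq_sum (x : ℝ) :
    ∑ p ∈ (Finset.Icc 1 ⌊x⌋₊).filter Nat.Prime, ((p : ℝ) - 1) / (Nat.totient (p - 1) : ℝ) =
      ∑ d ∈ Finset.Icc 1 ⌊x⌋₊, sqfreeInvTotient d * primeCountOne d x := by
  have h : ∀ p ∈ (Finset.Icc 1 ⌊x⌋₊).filter Nat.Prime,
      ((p : ℝ) - 1) / (Nat.totient (p - 1) : ℝ) =
        ∑ d ∈ Finset.Icc 1 ⌊x⌋₊, if d ∣ p - 1 then sqfreeInvTotient d else 0 := by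
    intro p hp
    rw [Finset.mem_filter, Finset.mem_Icc] at hp
    have h2 := hp.2.two_le
    rw [show (p : ℝ) - 1 = ((p - 1 : ℕ) : ℝ) by rw [Nat.cast_sub hp.1.1, Nat.cast_one],
      div_totient_eq_sum_divisors (by omega), ← Finset.sum_filter]
    refine Finset.sum_congr ?_ fun _ _ => rfl
    ext d
    simp only [Nat.mem_divisors, Finset.mem_filter, Finset.mem_Icc]
    refine ⟨fun hd => ⟨⟨Nat.pos_of_ne_zero ?_, ?_⟩, hd.1⟩, fun hd => ⟨hd.2, by omega⟩⟩
    · rintro rfl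
      exact hd.2 (zero_dvd_iff.1 hd.1)
    · have := Nat.le_of_dvd (by omega) hd.1
      omega
  rw [Finset.sum_congr rfl h, Finset.sum_comm]
  refine Finset.sum_congr rfl fun d _ => ?_
  rw [← Finset.sum_filter, Finset.filter_filter, Finset.sum_const, nsmul_eq_mul, mul_comm,
    primeCountOne]

lemma hasSum_sqfreeInvTotient_mul_primeCountOne (x : ℝ) :
    HasSum (fun d => sqfreeInvTotient d * primeCountOne d x)
      (∑ p ∈ (Finset.Icc 1 ⌊x⌋₊).filter Nat.Prime, ((p : ℝ) - 1) / (Nat.totient (p - 1) : ℝ)) := by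
  rw [sum_div_totient_eq_sum]
  refine hasSum_sum_of_ne_finset_zero fun d hd => ?_
  rcases Nat.eq_zero_or_pos d with rfl | hd0
  · simp [sqfreeInvTotient]
  · rw [Finset.mem_Icc, not_and] at hd
    rw [primeCountOne_eq_zero (by have := hd hd0; omega), Nat.cast_zero, mul_zero]

lemma integral_one_div_log_nonneg {x : ℝ} (hx : 2 ≤ x) : 0 ≤ ∫ t in (2 : ℝ)..x, 1 / Real.log t :=
  intervalIntegral.integral_nonneg hx fun t ht =>
    one_div_nonneg.2 (Real.log_nonneg (by linarith [ht.1]))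

lemma integral_one_div_log_le {x : ℝ} (hx : 2 ≤ x) :
    ∫ t in (2 : ℝ)..x, 1 / Real.log t ≤ 2 * x := by
  have h := intervalIntegral.norm_integral_le_of_norm_le_const (a := 2) (b := x) (C := 2)
    (f := fun t => 1 / Real.log t) fun t ht => by
      rw [uIoc_of_le hx] at ht
      rw [Real.norm_eq_abs, abs_of_nonneg
        (one_div_nonneg.2 (Real.log_nonneg (by linarith [ht.1])))]
      exact one_div_log_le_two ht.1.le
  rw [abs_of_nonneg (by linarith)] at h
  exact ((le_abs_self _).trans h).trans (by linarith)

lemma sqfreeInvTotient_mul_primeCountOne_le (d : ℕ) {x : ℝ} (hx : 0 ≤ x) :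
    sqfreeInvTotient d * primeCountOne d x ≤ x * sqfreeInvTotientSq d := by
  rcases Nat.eq_zero_or_pos d with rfl | hd
  · simp [sqfreeInvTotient, sqfreeInvTotientSq]
  have hd' : (0 : ℝ) < d := by exact_mod_cast hd
  have h1 : (primeCountOne d x : ℝ) ≤ x / d :=
    calc (primeCountOne d x : ℝ) ≤ ((⌊x⌋₊ / d : ℕ) : ℝ) := by
          exact_mod_cast primeCountOne_le_div d x
      _ ≤ (⌊x⌋₊ : ℝ) / d := Nat.cast_div_le
      _ ≤ x / d := by gcongr; exact Nat.floor_le hx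
  have h2 : (d.totient : ℝ) ≤ d := by exact_mod_cast d.totient_le
  have hv := sqfreeInvTotientSq_nonneg d
  calc sqfreeInvTotient d * primeCountOne d x
      ≤ sqfreeInvTotientSq d * d * (x / d) := by
        rw [sqfreeInvTotient_eq_mul]
        gcongr
    _ = x * sqfreeInvTotientSq d := by field_simp

/-- The contribution of the divisor `d` to the error term. -/
noncomputable def divisorError (x : ℝ) (d : ℕ) : ℝ :=
  sqfreeInvTotient d * primeCountOne d x -
    sqfreeInvTotientSq d * ∫ t in (2 : ℝ)..x, 1 / Real.log t

lemma hasSum_divisorError (x : ℝ) :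
    HasSum (divisorError x)
      ((∑ p ∈ (Finset.Icc 1 ⌊x⌋₊).filter Nat.Prime, ((p : ℝ) - 1) / (Nat.totient (p - 1) : ℝ)) -
        (∏' p : Nat.Primes, (1 + 1 / ((p : ℝ) - 1) ^ 2)) * ∫ t in (2 : ℝ)..x, 1 / Real.log t) := by
  rw [tsum_sqfreeInvTotientSq]
  exact (hasSum_sqfreeInvTotient_mul_primeCountOne x).sub
    (summable_sqfreeInvTotientSq.hasSum.mul_right _)

lemma abs_divisorError_le (d : ℕ) {x : ℝ} (hx : 2 ≤ x) :
    |divisorError x d| ≤ 3 * x * sqfreeInvTotientSq d := by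
  have h1 := sqfreeInvTotient_mul_primeCountOne_le d (x := x) (by linarith)
  have h2 := mul_nonneg (sqfreeInvTotient_nonneg d) (Nat.cast_nonneg (α := ℝ) (primeCountOne d x))
  have hv := sqfreeInvTotientSq_nonneg d
  have h3 := mul_nonneg hv (integral_one_div_log_nonneg hx)
  have h4 := mul_le_mul_of_nonneg_left (integral_one_div_log_le hx) hv
  have h5 := mul_nonneg hv (by linarith : 0 ≤ x)
  rw [divisorError, abs_le]
  constructor <;> nlinarith

lemma exists_abs_divisorError_le (j : ℕ) : ∃ C > 0, ∀ d x, 2 ≤ x →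
    |divisorError x d| ≤ C * (d : ℝ) ^ 2 * (x / Real.log x ^ j) := by
  obtain ⟨C, hC, h⟩ := exists_abs_totient_mul_primeCountOne_sub_le j
  refine ⟨C, hC, fun d x hx => ?_⟩
  rcases Nat.eq_zero_or_pos d with rfl | hd
  · simp [divisorError, sqfreeInvTotient, sqfreeInvTotientSq]
  have : NeZero d := ⟨hd.ne'⟩
  rw [divisorError, sqfreeInvTotient_eq_mul, mul_assoc, ← mul_sub, abs_mul,
    abs_of_nonneg (sqfreeInvTotientSq_nonneg d)]
  exact (mul_le_of_le_one_left (abs_nonneg _) (sqfreeInvTotientSq_le_one d)).trans (h d x hx)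

lemma exists_abs_tsum_divisorError_le (j : ℕ) : ∃ C > 0, ∀ x D : ℝ, 2 ≤ x → 1 ≤ D →
    |∑' d, divisorError x d| ≤
      C * (D ^ 3 * (x / Real.log x ^ j) + x * D ^ (-(1 / 2) : ℝ)) := by
  obtain ⟨C, hC, h⟩ := exists_abs_divisorError_le j
  set V : ℝ := ∑' n : ℕ, (n : ℝ) ^ (1 / 2 : ℝ) * sqfreeInvTotientSq n with hV
  have hV0 : 0 ≤ V := tsum_nonneg fun n =>
    mul_nonneg (by positivity) (sqfreeInvTotientSq_nonneg n)
  refine ⟨C + 3 * V, by positivity, fun x D hx hD => ?_⟩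
  have hx0 : 0 < x := by linarith
  have hD0 : 0 < D := by linarith
  have hR : 0 ≤ x / Real.log x ^ j :=
    div_nonneg hx0.le (pow_nonneg (Real.log_nonneg (by linarith)) _)
  have hs : HasSum
      (fun d : ℕ => if d ∈ Finset.Icc 1 ⌊D⌋₊ then C * D ^ 2 * (x / Real.log x ^ j) else 0)
      (⌊D⌋₊ * (C * D ^ 2 * (x / Real.log x ^ j))) := by
    have := hasSum_sum_of_ne_finset_zero (L := SummationFilter.unconditional ℕ)
        (s := Finset.Icc 1 ⌊D⌋₊)
      (f := fun d : ℕ => if d ∈ Finset.Icc 1 ⌊D⌋₊ then C * D ^ 2 * (x / Real.log x ^ j) else 0)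
      fun d hd => if_neg hd
    rwa [Finset.sum_ite_mem, Finset.inter_self, Finset.sum_const, Nat.card_Icc, nsmul_eq_mul,
      Nat.add_sub_cancel] at this
  have hb := hs.add (summable_rpow_mul_sqfreeInvTotientSq.hasSum.mul_left
    (3 * x * D ^ (-(1 / 2) : ℝ)))
  have hle : ∀ d, |divisorError x d| ≤
      (if d ∈ Finset.Icc 1 ⌊D⌋₊ then C * D ^ 2 * (x / Real.log x ^ j) else 0) +
        3 * x * D ^ (-(1 / 2) : ℝ) * ((d : ℝ) ^ (1 / 2 : ℝ) * sqfreeInvTotientSq d) := by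
    intro d
    have hv := sqfreeInvTotientSq_nonneg d
    split_ifs with hd
    · refine ((h d x hx).trans ?_).trans (le_add_of_nonneg_right (by positivity))
      have : (d : ℝ) ≤ D := (Nat.le_floor_iff hD0.le).1 (Finset.mem_Icc.1 hd).2
      gcongr
    · rw [zero_add]
      refine (abs_divisorError_le d hx).trans ?_
      rcases Nat.eq_zero_or_pos d with rfl | hd0
      · simp [sqfreeInvTotientSq]
      have hDd : D ≤ d := by
        by_contra! hlt
        exact hd (Finset.mem_Icc.2 ⟨hd0, Nat.le_floor hlt.le⟩)
      have h1 : 1 ≤ D ^ (-(1 / 2) : ℝ) * (d : ℝ) ^ (1 / 2 : ℝ) :=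
        calc (1 : ℝ) = D ^ (-(1 / 2) : ℝ) * D ^ (1 / 2 : ℝ) := by
              rw [← Real.rpow_add hD0, neg_add_cancel, Real.rpow_zero]
          _ ≤ _ := by gcongr
      calc 3 * x * sqfreeInvTotientSq d ≤
          3 * x * sqfreeInvTotientSq d * (D ^ (-(1 / 2) : ℝ) * (d : ℝ) ^ (1 / 2 : ℝ)) :=
            le_mul_of_one_le_right (by positivity) h1
        _ = _ := by ring
  have : ‖∑' d, divisorError x d‖ ≤ _ := tsum_of_norm_bounded hb hle
  rw [Real.norm_eq_abs] at this
  refine this.trans ?_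
  have hfl : (⌊D⌋₊ : ℝ) ≤ D := Nat.floor_le hD0.le
  have hp : 0 ≤ D ^ (-(1 / 2) : ℝ) := by positivity
  calc _ ≤ D * (C * D ^ 2 * (x / Real.log x ^ j)) + 3 * x * D ^ (-(1 / 2) : ℝ) * V := by gcongr
    _ = C * (D ^ 3 * (x / Real.log x ^ j)) + 3 * V * (x * D ^ (-(1 / 2) : ℝ)) := by ring
    _ ≤ _ := by
      rw [mul_add]
      gcongr
      · linarith
      · linarith

end SiegelWalfisz

theorem stmt_7 (c : ℝ) (hc : 2 < c) :
    ∃ K : ℝ, 0 < K ∧ ∀ x : ℝ, 3 ≤ x →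
      |(∑ p ∈ (Finset.Icc 1 ⌊x⌋₊).filter Nat.Prime,
            ((p : ℝ) - 1) / (Nat.totient (p - 1) : ℝ)) -
          (∏' p : Nat.Primes, (1 + 1 / ((p : ℝ) - 1) ^ 2)) *
            ∫ t in (2 : ℝ)..x, 1 / Real.log t| ≤
        K * x / (Real.log x) ^ (c - 1) := by
  obtain ⟨C, hC, h⟩ := SiegelWalfisz.exists_abs_tsum_divisorError_le ⌈7 * (c - 1)⌉₊
  refine ⟨2 * C, by positivity, fun x hx => ?_⟩
  have hL : 1 ≤ Real.log x := by
    rw [Real.le_log_iff_exp_le (by linarith)]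
    linarith [Real.exp_one_lt_d9]
  have hL0 : 0 < Real.log x := by linarith
  have hx0 : 0 < x := by linarith
  have hmain := h x (Real.log x ^ (2 * (c - 1))) (by linarith)
    (Real.one_le_rpow hL (by linarith))
  rw [(SiegelWalfisz.hasSum_divisorError x).tsum_eq] at hmain
  refine hmain.trans ?_
  have h1 : (Real.log x ^ (2 * (c - 1))) ^ 3 * (x / Real.log x ^ ⌈7 * (c - 1)⌉₊) ≤
      x * Real.log x ^ (-(c - 1)) := by
    rw [← Real.rpow_natCast (Real.log x ^ (2 * (c - 1))) 3, ← Real.rpow_mul hL0.le,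
      ← Real.rpow_natCast (Real.log x) ⌈7 * (c - 1)⌉₊, mul_div_left_comm, ← Real.rpow_sub hL0]
    refine mul_le_mul_of_nonneg_left (Real.rpow_le_rpow_of_exponent_le hL ?_) hx0.le
    have := Nat.le_ceil (7 * (c - 1))
    push_cast
    linarith
  have h2 : (Real.log x ^ (2 * (c - 1))) ^ (-(1 / 2) : ℝ) = Real.log x ^ (-(c - 1)) := by
    rw [← Real.rpow_mul hL0.le]
    ring_nf
  rw [h2]
  calc _ ≤ C * (x * Real.log x ^ (-(c - 1)) + x * Real.log x ^ (-(c - 1))) := by gcongr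
    _ = 2 * C * x / Real.log x ^ (c - 1) := by
      rw [Real.rpow_neg hL0.le]
      ring
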